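/- Suppose F(X_1,…,X_m,Z,T) = f(Z,T) + X_1⋯X_m·g(X_1,…,X_m,Z,T) for some g ∈ k[X_1,…,X_m,Z,T], and let G = X_1^{r_1}⋯X_m^{r_m}Y − F(X_1,…,X_m,Z,T). Then the following statements are equivalent: (i) k[X_1,…,X_m,Y,Z,T] = k[X_1,…,X_m,G]^{[2]}; (ii) k[X_1,…,X_m,Y,Z,T] = k[G]^{[m+2]}; (iii) A = k[x_1,…,x_m]^{[2]}, i.e., A is a polynomial ring in two variables over its subring E; (iv) A ≅ k^{[m+2]} as a k-algebra; (v) k[Z,T] = k[f(Z,T)]^{[1]}, i.e., f is a coordinate of k[Z,T]. -/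

import Mathlib

/-!
Common definitions: exponential maps, the Derksen and Makar-Limanov invariants,
𝔸ⁿ-fibrations, and the ring
`A = k[X_1,…,X_m,Y,Z,T]/(X_1^{r_1}⋯X_m^{r_m}·Y − F(X_1,…,X_m,Z,T))`.
-/

noncomputable section
open MvPolynomial

/-- An exponential map on a `k`-algebra `D`: a `k`-algebra homomorphism `φ : D → D[U]`
such that evaluating `U` at `0` gives the identity of `D`, and such that
`φ_V ∘ φ_U = φ_{U+V}` in `D[U,V]` (where `φ_V : D[U] → D[U,V]` extends `φ` with
`φ_V(U) = U`).  Here `D[U,V]` is modelled as `Polynomial (Polynomial D)`, with inner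
variable `U` and outer variable `V`. -/
structure ExpMap (k D : Type) [CommRing k] [CommRing D] [Algebra k D] where
  toAlgHom : D →ₐ[k] Polynomial D
  eval_zero : ∀ d, Polynomial.eval 0 (toAlgHom d) = d
  comp_add : ∀ d,
    Polynomial.eval₂ ((Polynomial.mapRingHom (Polynomial.C (R := D))).comp toAlgHom.toRingHom)
      (Polynomial.C Polynomial.X) (toAlgHom d)
    = Polynomial.eval₂ ((Polynomial.C (R := Polynomial D)).comp (Polynomial.C (R := D)))
      (Polynomial.C Polynomial.X + Polynomial.X) (toAlgHom d)

namespace ExpMap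
variable {k D : Type} [CommRing k] [CommRing D] [Algebra k D]

/-- The ring of invariants `D^φ = {d ∈ D | φ(d) = d}` of an exponential map. -/
def invariants (φ : ExpMap k D) : Subalgebra k D where
  carrier := {d | φ.toAlgHom d = Polynomial.C d}
  mul_mem' := fun ha hb => by
    simp only [Set.mem_setOf_eq] at *
    rw [map_mul, ha, hb, ← map_mul]
  add_mem' := fun ha hb => by
    simp only [Set.mem_setOf_eq] at *
    rw [map_add, ha, hb, ← map_add]
  algebraMap_mem' := fun c => by
    simp only [Set.mem_setOf_eq, AlgHom.commutes, Polynomial.algebraMap_apply]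

end ExpMap

/-- The Derksen invariant `DK(D)`: the `k`-subalgebra of `D` generated by the rings of
invariants of all non-trivial exponential maps on `D`. -/
def Derksen (k D : Type) [CommRing k] [CommRing D] [Algebra k D] : Subalgebra k D :=
  Algebra.adjoin k (⋃ φ ∈ {ψ : ExpMap k D | ψ.invariants ≠ ⊤}, (φ.invariants : Set D))

/-- The Makar-Limanov invariant `ML(D)`: the intersection of the rings of invariants of
all exponential maps on `D`. -/
def MakarLimanov (k D : Type) [CommRing k] [CommRing D] [Algebra k D] : Subalgebra k D :=
  ⨅ φ : ExpMap k D, φ.invariants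

/-- `D` is an `𝔸ⁿ`-fibration over `R`: a finitely generated flat `R`-algebra all of whose
fibres `D ⊗_R κ(p)` over primes `p` of `R` are polynomial rings `κ(p)^{[n]}`. -/
def IsAnFibration (R D : Type) [CommRing R] [CommRing D] [Algebra R D] (n : ℕ) : Prop :=
  Algebra.FiniteType R D ∧ Module.Flat R D ∧
  ∀ p : PrimeSpectrum R,
    Nonempty ((TensorProduct R (IsLocalRing.ResidueField (Localization.AtPrime p.asIdeal)) D)
      ≃ₐ[IsLocalRing.ResidueField (Localization.AtPrime p.asIdeal)]
      MvPolynomial (Fin n) (IsLocalRing.ResidueField (Localization.AtPrime p.asIdeal)))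

/-- The polynomial ring `k[X_1,…,X_m,Y,Z,T]`:
variables `Sum.inl i` are the `X i`; `Sum.inr 0 = Y`, `Sum.inr 1 = Z`, `Sum.inr 2 = T`. -/
abbrev BigP (k : Type) [CommRing k] (m : ℕ) := MvPolynomial (Fin m ⊕ Fin 3) k

/-- The inclusion `k[X_1,…,X_m,Z,T] → k[X_1,…,X_m,Y,Z,T]` (in the source,
`Sum.inr 0 = Z` and `Sum.inr 1 = T`). -/
def incl (k : Type) [CommRing k] (m : ℕ) : MvPolynomial (Fin m ⊕ Fin 2) k →ₐ[k] BigP k m :=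
  rename (Sum.map id Fin.succ)

/-- The polynomial `G = X_1^{r_1}⋯X_m^{r_m}·Y − F(X_1,…,X_m,Z,T)`. -/
def relG (k : Type) [CommRing k] (m : ℕ) (r : Fin m → ℕ) (F : MvPolynomial (Fin m ⊕ Fin 2) k) :
    BigP k m :=
  (∏ i, X (Sum.inl i) ^ r i) * X (Sum.inr 0) - incl k m F

/-- The ring `A = k[X_1,…,X_m,Y,Z,T]/(X_1^{r_1}⋯X_m^{r_m}·Y − F(X_1,…,X_m,Z,T))`. -/
abbrev RingA (k : Type) [CommRing k] (m : ℕ) (r : Fin m → ℕ)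
    (F : MvPolynomial (Fin m ⊕ Fin 2) k) :=
  BigP k m ⧸ Ideal.span {relG k m r F}

variable (k : Type) [CommRing k] (m : ℕ) (r : Fin m → ℕ) (F : MvPolynomial (Fin m ⊕ Fin 2) k)

/-- `x i`, the image of `X i` in `A`. -/
def xA (i : Fin m) : RingA k m r F := Ideal.Quotient.mk _ (X (Sum.inl i))
/-- `y`, the image of `Y` in `A`. -/
def yA : RingA k m r F := Ideal.Quotient.mk _ (X (Sum.inr 0))
/-- `z`, the image of `Z` in `A`. -/
def zA : RingA k m r F := Ideal.Quotient.mk _ (X (Sum.inr 1))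
/-- `t`, the image of `T` in `A`. -/
def tA : RingA k m r F := Ideal.Quotient.mk _ (X (Sum.inr 2))

/-- `f(Z,T) := F(0,…,0,Z,T) ∈ k[Z,T]`. -/
def fOf : MvPolynomial (Fin 2) k :=
  aeval (Sum.elim (fun _ => (0 : MvPolynomial (Fin 2) k)) X) F

/-- The subalgebra `E = k[x_1,…,x_m]` of `A`. -/
def EA : Subalgebra k (RingA k m r F) := Algebra.adjoin k (Set.range (xA k m r F))

/-- The subalgebra `B = k[x_1,…,x_m,z,t]` of `A`. -/
def BA : Subalgebra k (RingA k m r F) :=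
  Algebra.adjoin k (Set.range (xA k m r F) ∪ {zA k m r F, tA k m r F})

/-- A ring `A` with real-indexed coefficient maps to `R`, whose lowest coefficients multiply, together
with an exponential map `φ` which shifts the filtration by `μ` per power of the parameter. -/
structure FilteredExp (R A : Type) [CommRing R] [CommRing A] where
  c : ℝ → A →+ R
  φ : A →+* Polynomial A
  μ : ℝ
  exists_order : ∀ a, a ≠ 0 → ∃ e, (∀ g < e, c g a = 0) ∧ c e a ≠ 0
  mul_low : ∀ e e' a b, (∀ g < e, c g a = 0) → (∀ g < e', c g b = 0) →
    (∀ g < e + e', c g (a * b) = 0) ∧ c (e + e') (a * b) = c e a * c e' b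
  φ_zero : ∀ a, (φ a).coeff 0 = a
  φ_comp : ∀ a i j, (φ ((φ a).coeff i)).coeff j = (i + j).choose i • (φ a).coeff (i + j)
  low : ∀ e a, (∀ g < e, c g a = 0) → ∀ i : ℕ, ∀ g < e + i * μ, c g ((φ a).coeff i) = 0

namespace FilteredExp

variable {R A : Type} [CommRing R] [CommRing A] (E : FilteredExp R A)

/-- All coefficients of `a` below `e` vanish. -/
def Ge (e : ℝ) (a : A) : Prop := ∀ g < e, E.c g a = 0

/-- The effect of `φ` on the homogeneous component of degree `e` of `a`. -/
def psi (e : ℝ) (a : A) : Polynomial R :=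
  ∑ i ∈ (E.φ a).support, Polynomial.monomial i (E.c (e + i * E.μ) ((E.φ a).coeff i))

variable {E}

lemma coeff_psi (e : ℝ) (a : A) (i : ℕ) :
    (E.psi e a).coeff i = E.c (e + i * E.μ) ((E.φ a).coeff i) := by
  classical
  simp only [psi, Polynomial.finsetSum_coeff, Polynomial.coeff_monomial]
  rw [Finset.sum_ite_eq']
  split_ifs with h
  · rfl
  · rw [Polynomial.notMem_support_iff.1 h, map_zero]

lemma coeff_psi_zero (e : ℝ) (a : A) : (E.psi e a).coeff 0 = E.c e a := by
  rw [coeff_psi, E.φ_zero]; simp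

lemma Ge.mono {e e' : ℝ} {a : A} (h : E.Ge e a) (hle : e' ≤ e) : E.Ge e' a :=
  fun g hg => h g (hg.trans_le hle)

lemma Ge.add {e : ℝ} {a b : A} (ha : E.Ge e a) (hb : E.Ge e b) : E.Ge e (a + b) :=
  fun g hg => by rw [map_add, ha g hg, hb g hg, add_zero]

lemma Ge.neg {e : ℝ} {a : A} (ha : E.Ge e a) : E.Ge e (-a) :=
  fun g hg => by rw [map_neg, ha g hg, neg_zero]

lemma Ge.sub {e : ℝ} {a b : A} (ha : E.Ge e a) (hb : E.Ge e b) : E.Ge e (a - b) := by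
  rw [sub_eq_add_neg]; exact ha.add hb.neg

lemma Ge.mul {e e' : ℝ} {a b : A} (ha : E.Ge e a) (hb : E.Ge e' b) : E.Ge (e + e') (a * b) :=
  (E.mul_low e e' a b ha hb).1

lemma Ge.c_mul {e e' : ℝ} {a b : A} (ha : E.Ge e a) (hb : E.Ge e' b) :
    E.c (e + e') (a * b) = E.c e a * E.c e' b :=
  (E.mul_low e e' a b ha hb).2

lemma Ge.coeff {e : ℝ} {a : A} (ha : E.Ge e a) (i : ℕ) :
    E.Ge (e + i * E.μ) ((E.φ a).coeff i) := E.low e a ha i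

lemma Ge.psi_eq_zero {e : ℝ} {a : A} (ha : E.Ge e a) (h0 : E.c e a = 0) : E.psi e a = 0 := by
  by_cases hz : a = 0
  · subst hz; simp [psi]
  obtain ⟨e', h1, h2⟩ := E.exists_order a hz
  have hlt : e < e' := by
    rcases lt_trichotomy e e' with h | h | h
    · exact h
    · subst h; exact absurd h0 h2
    · exact absurd (ha e' h) h2
  ext i
  rw [coeff_psi, Polynomial.coeff_zero]
  exact E.low e' a h1 i _ (by linarith)

lemma psi_sub (e : ℝ) (a b : A) : E.psi e (a - b) = E.psi e a - E.psi e b := by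
  ext i; simp [coeff_psi]

lemma psi_add (e : ℝ) (a b : A) : E.psi e (a + b) = E.psi e a + E.psi e b := by
  ext i; simp [coeff_psi]

lemma Ge.psi_congr {e : ℝ} {a b : A} (ha : E.Ge e a) (hb : E.Ge e b) (h : E.c e a = E.c e b) :
    E.psi e a = E.psi e b := by
  rw [← sub_eq_zero, ← psi_sub]
  exact (ha.sub hb).psi_eq_zero (by rw [map_sub, h, sub_self])

lemma Ge.psi_mul {e e' : ℝ} {a b : A} (ha : E.Ge e a) (hb : E.Ge e' b) :
    E.psi (e + e') (a * b) = E.psi e a * E.psi e' b := by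
  ext n
  rw [coeff_psi, map_mul, Polynomial.coeff_mul, Polynomial.coeff_mul, map_sum]
  refine Finset.sum_congr rfl fun ij hij => ?_
  rw [Finset.HasAntidiagonal.mem_antidiagonal] at hij
  rw [coeff_psi, coeff_psi, ← (ha.coeff ij.1).c_mul (hb.coeff ij.2), ← hij]
  congr 2
  push_cast; ring

lemma coeff_psi_coeff (e : ℝ) (a : A) (i j : ℕ) :
    (E.psi (e + i * E.μ) ((E.φ a).coeff i)).coeff j
      = ((i + j).choose i : R) * (E.psi e a).coeff (i + j) := by
  rw [coeff_psi, coeff_psi, E.φ_comp, map_nsmul, nsmul_eq_mul]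
  congr 3
  push_cast; ring

lemma Ge.one [IsDomain R] (h : E.Ge 0 1) (h1 : E.c 0 1 = 1) : E.psi 0 1 = 1 := by
  have := h.psi_mul h
  rw [add_zero, mul_one] at this
  have h0 : E.psi 0 1 ≠ 0 := fun h0 => by
    have := coeff_psi_zero (E := E) 0 1
    rw [h0, h1] at this; simp at this
  exact (mul_left_cancel₀ h0 (by rw [← this, mul_one])).symm

variable (E) in
/-- The homogeneous elements of degree `e` fixed by the graded exponential map. -/
def Inv (e : ℝ) : Set R := {r | ∃ a, E.Ge e a ∧ E.c e a = r ∧ (E.psi e a).natDegree = 0}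

lemma zero_mem_Inv (e : ℝ) : (0 : R) ∈ E.Inv e := by
  refine ⟨0, fun g _ => map_zero _, map_zero _, ?_⟩
  simp [psi]

lemma add_mem_Inv {e : ℝ} {r s : R} (hr : r ∈ E.Inv e) (hs : s ∈ E.Inv e) : r + s ∈ E.Inv e := by
  obtain ⟨a, ha, rfl, hda⟩ := hr
  obtain ⟨b, hb, rfl, hdb⟩ := hs
  refine ⟨a + b, ha.add hb, map_add _ _ _, ?_⟩
  rw [psi_add]
  have := Polynomial.natDegree_add_le (E.psi e a) (E.psi e b)
  omega

lemma mul_mem_Inv {e e' : ℝ} {r s : R} (hr : r ∈ E.Inv e) (hs : s ∈ E.Inv e') :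
    r * s ∈ E.Inv (e + e') := by
  obtain ⟨a, ha, rfl, hda⟩ := hr
  obtain ⟨b, hb, rfl, hdb⟩ := hs
  refine ⟨a * b, ha.mul hb, ha.c_mul hb, ?_⟩
  rw [ha.psi_mul hb]
  have := Polynomial.natDegree_mul_le (p := E.psi e a) (q := E.psi e' b)
  omega

lemma Ge.pow (h : E.Ge 0 1) {e : ℝ} {a : A} (ha : E.Ge e a) :
    ∀ n : ℕ, E.Ge (n * e) (a ^ n)
  | 0 => by simpa using h
  | n + 1 => by
    have := (Ge.pow h ha n).mul ha
    rw [pow_succ]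
    refine this.mono (le_of_eq ?_)
    push_cast; ring

lemma Ge.c_pow (h : E.Ge 0 1) (h1 : E.c 0 1 = 1) {e : ℝ} {a : A} (ha : E.Ge e a) :
    ∀ n : ℕ, E.c (n * e) (a ^ n) = E.c e a ^ n
  | 0 => by simpa using h1
  | n + 1 => by
    have := (Ge.pow h ha n).c_mul ha
    rw [Ge.c_pow h h1 ha n] at this
    rw [pow_succ, pow_succ, ← this]
    congr 2
    push_cast; ring

lemma Ge.psi_pow [IsDomain R] (h : E.Ge 0 1) (h1 : E.c 0 1 = 1) {e : ℝ} {a : A} (ha : E.Ge e a) :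
    ∀ n : ℕ, E.psi (n * e) (a ^ n) = E.psi e a ^ n
  | 0 => by simpa using h.one h1
  | n + 1 => by
    have := (Ge.pow h ha n).psi_mul ha
    rw [Ge.psi_pow h h1 ha n] at this
    rw [pow_succ, pow_succ, ← this]
    congr 1
    push_cast; ring

lemma choose_mod_eq_one {n : ℕ} (hn : 0 < n)
    (hch : ∀ i, 0 < i → i < n → (n.choose i : R) = 0) (N : ℕ) :
    (N.choose (N % n) : R) = 1 := by
  have key : ((1 + Polynomial.X : Polynomial R)) ^ n = 1 + Polynomial.X ^ n := by
    ext i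
    rw [add_comm (1 : Polynomial R) Polynomial.X, Polynomial.coeff_X_add_one_pow, Polynomial.coeff_add,
      Polynomial.coeff_X_pow, Polynomial.coeff_one]
    rcases Nat.eq_zero_or_pos i with rfl | hi
    · simp [hn.ne]
    · rcases lt_trichotomy i n with h | h | h
      · simp [hch i hi h, hi.ne', h.ne]
      · subst h; simp [hi.ne']
      · simp [Nat.choose_eq_zero_of_lt h, hi.ne', h.ne']
  have h2 : ((1 + Polynomial.X : Polynomial R)) ^ N
      = (1 + Polynomial.X ^ n) ^ (N / n) * (1 + Polynomial.X) ^ (N % n) := by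
    rw [← key, ← pow_mul, ← pow_add, Nat.div_add_mod]
  have h3 := congrArg (fun p => Polynomial.coeff p (N % n)) h2
  rw [add_comm (1 : Polynomial R) Polynomial.X, Polynomial.coeff_X_add_one_pow] at h3
  rw [h3]
  have h4 : ∃ q : Polynomial R, (1 + Polynomial.X ^ n : Polynomial R) ^ (N / n)
      = 1 + Polynomial.X ^ n * q := by
    obtain ⟨q, hq⟩ := (sub_dvd_pow_sub_pow (1 + Polynomial.X ^ n : Polynomial R) 1 (N / n))
    refine ⟨q, ?_⟩
    rw [one_pow, add_sub_cancel_left] at hq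
    rw [← hq]; ring
  obtain ⟨q, hq⟩ := h4
  rw [hq, add_mul, one_mul, Polynomial.coeff_add, Polynomial.coeff_X_add_one_pow, mul_assoc,
    Polynomial.coeff_X_pow_mul', if_neg (by have := Nat.mod_lt N hn; omega)]
  simp

/-- If `n` is the least positive degree, it divides every degree. -/
lemma dvd_natDegree_psi [IsDomain R] {n : ℕ} (hn : 0 < n) {w : ℝ} {W : A} (hW : E.Ge w W)
    (hWn : (E.psi w W).natDegree = n)
    (hmin : ∀ e a, E.Ge e a → 0 < (E.psi e a).natDegree → n ≤ (E.psi e a).natDegree)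
    {e : ℝ} {a : A} (ha : E.Ge e a) : n ∣ (E.psi e a).natDegree := by
  have step : ∀ {e : ℝ} {a : A}, E.Ge e a → ∀ i ≤ (E.psi e a).natDegree,
      (((E.psi e a).natDegree).choose i : R) ≠ 0 →
      (E.psi (e + i * E.μ) ((E.φ a).coeff i)).natDegree = (E.psi e a).natDegree - i := by
    intro e a ha i hi hne
    by_cases h0 : E.psi e a = 0
    · simp only [h0, Polynomial.natDegree_zero] at hi ⊢
      obtain rfl : i = 0 := by omega
      rw [E.φ_zero]; simp [h0]
    apply le_antisymm
    · rw [Polynomial.natDegree_le_iff_coeff_eq_zero]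
      intro j hj
      rw [coeff_psi_coeff, Polynomial.coeff_eq_zero_of_natDegree_lt (by omega), mul_zero]
    · apply Polynomial.le_natDegree_of_ne_zero
      rw [coeff_psi_coeff, Nat.add_sub_cancel' hi]
      exact mul_ne_zero hne (by simpa using h0)
  have hch : ∀ i, 0 < i → i < n → (n.choose i : R) = 0 := by
    intro i hi hin
    by_contra hne
    have h := step hW i (by omega) (by rwa [hWn])
    have := hmin _ _ (hW.coeff i) (by rw [h]; omega)
    rw [h] at this
    omega
  set N := (E.psi e a).natDegree with hN
  have h1 := choose_mod_eq_one hn hch N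
  have hle := Nat.mod_le N n
  have h := step ha (N - N % n) (by omega) (by
    rw [← hN, Nat.choose_symm hle, h1]; exact one_ne_zero)
  rw [← hN, Nat.sub_sub_self hle] at h
  by_contra hnd
  have hpos : 0 < N % n := Nat.pos_of_ne_zero fun h0 => hnd (Nat.dvd_of_mod_eq_zero h0)
  have := hmin _ _ (ha.coeff (N - N % n)) (by rw [h]; exact hpos)
  rw [h] at this
  exact absurd (Nat.mod_lt N hn) (by omega)

/-- Homogeneous local slice theorem. -/
lemma exists_slice_expansion [IsDomain R] (h : E.Ge 0 1) (h1 : E.c 0 1 = 1)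
    {n : ℕ} (hn : 0 < n) {w : ℝ} {W : A} (hW : E.Ge w W)
    (hWn : (E.psi w W).natDegree = n)
    (hmin : ∀ e a, E.Ge e a → 0 < (E.psi e a).natDegree → n ≤ (E.psi e a).natDegree)
    (N : ℕ) : ∀ {e : ℝ} {a : A}, E.Ge e a → (E.psi e a).natDegree ≤ N →
      ∃ e' γ, γ ∈ E.Inv e' ∧ γ ≠ 0 ∧ ∃ b : Polynomial R,
        (∀ i : ℕ, b.coeff i ∈ E.Inv (e + e' - i * w)) ∧ γ * E.c e a = b.eval (E.c w W) := by
  have hone : (1 : R) ∈ E.Inv 0 := ⟨1, h, h1, by rw [h.one h1]; simp⟩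
  have base : ∀ {e : ℝ} {a : A}, E.Ge e a → (E.psi e a).natDegree = 0 →
      ∃ e' γ, γ ∈ E.Inv e' ∧ γ ≠ 0 ∧ ∃ b : Polynomial R,
        (∀ i : ℕ, b.coeff i ∈ E.Inv (e + e' - i * w)) ∧ γ * E.c e a = b.eval (E.c w W) := by
    intro e a ha hd
    refine ⟨0, 1, hone, one_ne_zero, Polynomial.C (E.c e a), ?_, by simp⟩
    intro i
    rw [Polynomial.coeff_C]
    split_ifs with hi
    · subst hi
      simpa using (show E.c e a ∈ E.Inv e from ⟨a, ha, rfl, hd⟩)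
    · exact zero_mem_Inv _
  induction N with
  | zero => intro e a ha hd; exact base ha (by omega)
  | succ N ih =>
    intro e a ha hd
    by_cases hz : (E.psi e a).natDegree = 0
    · exact base ha hz
    obtain ⟨Q, hQ⟩ := dvd_natDegree_psi hn hW hWn hmin ha
    set M := (E.psi e a).natDegree with hM
    have hinv : ∀ {e : ℝ} {a : A}, E.Ge e a → 
        (E.psi (e + (E.psi e a).natDegree * E.μ) 
          ((E.φ a).coeff (E.psi e a).natDegree)).natDegree = 0 := by
      intro e a ha
      apply Nat.le_zero.1
      rw [Polynomial.natDegree_le_iff_coeff_eq_zero]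
      intro j hj
      rw [coeff_psi_coeff, Polynomial.coeff_eq_zero_of_natDegree_lt (by omega), mul_zero]
    set w' := w + n * E.μ
    set ω := (E.φ W).coeff n
    have hω : E.Ge w' ω := hW.coeff n
    have hωd : (E.psi w' ω).natDegree = 0 := by
      have := hinv hW; rwa [hWn] at this
    have hωc : E.c w' ω = (E.psi w W).leadingCoeff := by
      rw [Polynomial.leadingCoeff, hWn, coeff_psi]
    set a' := (E.φ a).coeff M
    have ha' : E.Ge (e + M * E.μ) a' := ha.coeff M
    have ha'd : (E.psi (e + M * E.μ) a').natDegree = 0 := hinv ha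
    have ha'c : E.c (e + M * E.μ) a' = (E.psi e a).leadingCoeff := by
      rw [Polynomial.leadingCoeff, coeff_psi]
    have hconst : ∀ {p : Polynomial R}, p.natDegree = 0 → p = Polynomial.C (p.coeff 0) :=
      fun hp => Polynomial.eq_C_of_natDegree_eq_zero hp
    have hψω : E.psi w' ω = Polynomial.C ((E.psi w W).leadingCoeff) := by
      rw [hconst hωd, coeff_psi_zero, hωc]
    have hψa' : E.psi (e + M * E.μ) a' = Polynomial.C ((E.psi e a).leadingCoeff) := by
      rw [hconst ha'd, coeff_psi_zero, ha'c]
    have hωQ := Ge.pow h hω Q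
    have hWQ := Ge.pow h hW Q
    have hdeg : (Q * w' + e : ℝ) = e + M * E.μ + Q * w := by
      rw [hQ]; push_cast; simp only [w']; ring
    set b := ω ^ Q * a - a' * W ^ Q
    have hb : E.Ge (Q * w' + e) b := by
      refine (hωQ.mul ha).sub ?_
      rw [hdeg]; exact ha'.mul hWQ
    have hψb : E.psi (Q * w' + e) b
        = Polynomial.C ((E.psi w W).leadingCoeff ^ Q) * E.psi e a
          - Polynomial.C (E.psi e a).leadingCoeff * E.psi w W ^ Q := by
      rw [psi_sub, hωQ.psi_mul ha, Ge.psi_pow h h1 hω, hψω, hdeg, ha'.psi_mul hWQ, hψa',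
        Ge.psi_pow h h1 hW, Polynomial.C_pow]
    have hlcW : (E.psi w W).leadingCoeff ≠ 0 := by
      rw [Polynomial.leadingCoeff_ne_zero]
      intro h0; rw [h0] at hWn; simp at hWn; omega
    have hlca : (E.psi e a).leadingCoeff ≠ 0 := by
      rw [Polynomial.leadingCoeff_ne_zero]
      intro h0; apply hz; rw [hM, h0]; simp
    have hbdeg : (E.psi (Q * w' + e) b).natDegree ≤ N := by
      have hle : (E.psi (Q * w' + e) b).natDegree ≤ M := by
        rw [hψb]
        refine (Polynomial.natDegree_sub_le _ _).trans (max_le ?_ ?_)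
        · exact Polynomial.natDegree_C_mul_le _ _
        · refine (Polynomial.natDegree_C_mul_le _ _).trans ?_
          rw [Polynomial.natDegree_pow, hWn, hQ, mul_comm]
      rcases Nat.lt_or_ge N (E.psi (Q * w' + e) b).natDegree with hlt | hge
      · exfalso
        have heq : (E.psi (Q * w' + e) b).natDegree = M := by omega
        have hc : (E.psi (Q * w' + e) b).coeff M = 0 := by
          rw [hψb, Polynomial.coeff_sub, Polynomial.coeff_C_mul, Polynomial.coeff_C_mul]
          have e1 : (E.psi e a).coeff M = (E.psi e a).leadingCoeff := rfl
          have e2 : (E.psi w W ^ Q).coeff M = (E.psi w W).leadingCoeff ^ Q := by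
            rw [← Polynomial.leadingCoeff_pow, Polynomial.leadingCoeff, Polynomial.natDegree_pow,
              hWn, hQ, mul_comm]
          rw [e1, e2]; ring
        rw [← heq] at hc
        have : E.psi (Q * w' + e) b = 0 := by simpa using hc
        rw [this] at heq; simp at heq; omega
      · exact hge
    obtain ⟨e', γ, hγ, hγ0, p, hp, hpe⟩ := ih hb hbdeg
    have hωI : (E.psi w W).leadingCoeff ^ Q ∈ E.Inv (Q * w') := by
      refine ⟨ω ^ Q, hωQ, by rw [Ge.c_pow h h1 hω, hωc], ?_⟩
      rw [Ge.psi_pow h h1 hω, hψω, ← Polynomial.C_pow, Polynomial.natDegree_C]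
    have haI : (E.psi e a).leadingCoeff ∈ E.Inv (e + M * E.μ) := ⟨a', ha', ha'c, ha'd⟩
    refine ⟨e' + Q * w', γ * (E.psi w W).leadingCoeff ^ Q, mul_mem_Inv hγ hωI,
      mul_ne_zero hγ0 (pow_ne_zero _ hlcW),
      p + Polynomial.monomial Q (γ * (E.psi e a).leadingCoeff), ?_, ?_⟩
    · intro i
      rw [Polynomial.coeff_add]
      refine add_mem_Inv ?_ ?_
      · convert hp i using 2; ring
      · rw [Polynomial.coeff_monomial]
        split_ifs with hi
        · subst hi
          convert mul_mem_Inv hγ haI using 2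
          linarith
        · exact zero_mem_Inv _
    · rw [Polynomial.eval_add, ← hpe, Polynomial.eval_monomial]
      have hcb : E.c (Q * w' + e) b = (E.psi w W).leadingCoeff ^ Q * E.c e a
          - (E.psi e a).leadingCoeff * E.c w W ^ Q := by
        rw [map_sub, hωQ.c_mul ha, Ge.c_pow h h1 hω, hωc, hdeg, ha'.c_mul hWQ, ha'c,
          Ge.c_pow h h1 hW]
      rw [hcb]; ring

end FilteredExp

/-- `k[X,Z,T] → k[Z,T][ℝ]`, sending `X i` to the monomial of exponent `v i`. -/
def weightHom {k : Type} [Field k] {m : ℕ} (v : Fin m → ℝ) :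
    MvPolynomial (Fin m ⊕ Fin 2) k →ₐ[k] AddMonoidAlgebra (MvPolynomial (Fin 2) k) ℝ :=
  aeval (Sum.elim (fun i => AddMonoidAlgebra.single (v i) 1)
    (fun j => AddMonoidAlgebra.single 0 (X j)))

/-- The extension of `weightHom` to `k[X,Y,Z,T]` killing `relG`. -/
def weightHomBig {k : Type} [Field k] {m : ℕ} (v : Fin m → ℝ) (r : Fin m → ℕ)
    (F : MvPolynomial (Fin m ⊕ Fin 2) k) :
    BigP k m →ₐ[k] AddMonoidAlgebra (MvPolynomial (Fin 2) k) ℝ :=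
  aeval (Sum.elim (fun i => AddMonoidAlgebra.single (v i) 1)
    ![AddMonoidAlgebra.single (-∑ i, r i * v i) 1 * weightHom v F,
      AddMonoidAlgebra.single 0 (X 0), AddMonoidAlgebra.single 0 (X 1)])

lemma weightHomBig_incl {k : Type} [Field k] {m : ℕ} (v : Fin m → ℝ) (r : Fin m → ℕ)
    (F P : MvPolynomial (Fin m ⊕ Fin 2) k) :
    weightHomBig v r F (incl k m P) = weightHom v P := by
  have : (weightHomBig v r F).comp (incl k m) = weightHom v := by
    ext i : 1
    rcases i with i | i
    · simp [weightHomBig, weightHom, incl]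
    · fin_cases i <;> simp [weightHomBig, weightHom, incl]
  exact DFunLike.congr_fun this P

lemma weightHomBig_relG {k : Type} [Field k] {m : ℕ} (v : Fin m → ℝ) (r : Fin m → ℕ)
    (F : MvPolynomial (Fin m ⊕ Fin 2) k) : weightHomBig v r F (relG k m r F) = 0 := by
  have h1 : weightHomBig v r F (∏ i, X (Sum.inl i) ^ r i)
      = AddMonoidAlgebra.single (∑ i, r i * v i) 1 := by
    rw [map_prod]
    simp only [map_pow, weightHomBig, aeval_X, Sum.elim_inl, AddMonoidAlgebra.single_pow, one_pow]
    have := (AddMonoidAlgebra.prod_single (R := MvPolynomial (Fin 2) k)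
      (s := Finset.univ) (m := fun i : Fin m => r i • v i) (r := fun _ => 1))
    simpa [nsmul_eq_mul] using this
  rw [relG, map_sub, map_mul, weightHomBig_incl, h1]
  simp only [weightHomBig, aeval_X, Sum.elim_inr, Matrix.cons_val_zero]
  rw [← mul_assoc, AddMonoidAlgebra.single_mul_single, add_neg_cancel, mul_one,
    ← AddMonoidAlgebra.one_def, one_mul, sub_self]

/-- The map from `A` to `k[Z,T][ℝ]` determined by weights of the `x i`. -/
def weightHomA {k : Type} [Field k] {m : ℕ} (v : Fin m → ℝ) (r : Fin m → ℕ)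
    (F : MvPolynomial (Fin m ⊕ Fin 2) k) :
    RingA k m r F →ₐ[k] AddMonoidAlgebra (MvPolynomial (Fin 2) k) ℝ :=
  Ideal.Quotient.liftₐ _ (weightHomBig v r F) (by
    intro a ha
    obtain ⟨b, rfl⟩ := Ideal.mem_span_singleton.1 ha
    rw [map_mul, weightHomBig_relG, zero_mul])

lemma weightHomA_mk {k : Type} [Field k] {m : ℕ} (v : Fin m → ℝ) (r : Fin m → ℕ)
    (F : MvPolynomial (Fin m ⊕ Fin 2) k) (P : BigP k m) :
    weightHomA v r F (Ideal.Quotient.mk _ P) = weightHomBig v r F P := rfl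

/-- The coefficient of degree `g`. -/
def wcoeff {k : Type} [Field k] {m : ℕ} (v : Fin m → ℝ) (r : Fin m → ℕ)
    (F : MvPolynomial (Fin m ⊕ Fin 2) k) (g : ℝ) : RingA k m r F →+ MvPolynomial (Fin 2) k where
  toFun a := (weightHomA v r F a).coeff g
  map_zero' := by simp
  map_add' a b := by simp

section low
open AddMonoidAlgebra
variable {R : Type} [CommRing R]

lemma coeff_mul_low_aux {x y : AddMonoidAlgebra R ℝ} {e e' : ℝ} (hx : ∀ g < e, x.coeff g = 0)
    (hy : ∀ g < e', y.coeff g = 0) :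
    (∀ g < e + e', (x * y).coeff g = 0) ∧ (x * y).coeff (e + e') = x.coeff e * y.coeff e' := by
  classical
  have hx' : ∀ a ∈ x.coeff.support, e ≤ a := fun a ha => by
    by_contra h; exact (Finsupp.mem_support_iff.1 ha) (hx a (not_le.1 h))
  have hy' : ∀ a ∈ y.coeff.support, e' ≤ a := fun a ha => by
    by_contra h; exact (Finsupp.mem_support_iff.1 ha) (hy a (not_le.1 h))
  constructor
  · intro g hg
    rw [AddMonoidAlgebra.coeff_mul, Finsupp.sum]
    refine Finset.sum_eq_zero fun a ha => ?_
    rw [Finsupp.sum]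
    refine Finset.sum_eq_zero fun b hb => ?_
    rw [if_neg]
    have := hx' a ha; have := hy' b hb
    intro h; linarith
  · refine coeff_mul_add_of_uniqueAdd ?_
    intro a b ha hb hab
    have := hx' a ha; have := hy' b hb
    constructor <;> linarith

end low

section
variable {k : Type} [Field k] {m : ℕ} {v : Fin m → ℝ} {r : Fin m → ℕ}
  {F : MvPolynomial (Fin m ⊕ Fin 2) k}

lemma wcoeff_mul_low (e e' : ℝ) (a b : RingA k m r F) (ha : ∀ g < e, wcoeff v r F g a = 0)
    (hb : ∀ g < e', wcoeff v r F g b = 0) :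
    (∀ g < e + e', wcoeff v r F g (a * b) = 0) ∧
      wcoeff v r F (e + e') (a * b) = wcoeff v r F e a * wcoeff v r F e' b := by
  have := coeff_mul_low_aux ha hb
  simpa only [wcoeff, AddMonoidHom.coe_mk, ZeroHom.coe_mk, map_mul] using this

/-- `a` has weight at least `e` and coefficient `c` in degree `e`. -/
def HasLow (v : Fin m → ℝ) (r : Fin m → ℕ) (F : MvPolynomial (Fin m ⊕ Fin 2) k)
    (e : ℝ) (a : RingA k m r F) (c : MvPolynomial (Fin 2) k) : Prop :=
  (∀ g < e, wcoeff v r F g a = 0) ∧ wcoeff v r F e a = c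

lemma HasLow.mul {e e' : ℝ} {a b : RingA k m r F} {c d : MvPolynomial (Fin 2) k}
    (ha : HasLow v r F e a c) (hb : HasLow v r F e' b d) :
    HasLow v r F (e + e') (a * b) (c * d) := by
  obtain ⟨h1, h2⟩ := wcoeff_mul_low e e' a b ha.1 hb.1
  exact ⟨h1, by rw [h2, ha.2, hb.2]⟩

lemma hasLow_of_weightHomA {e : ℝ} {a : RingA k m r F} {c : MvPolynomial (Fin 2) k}
    (h : weightHomA v r F a = AddMonoidAlgebra.single e c) : HasLow v r F e a c := by
  constructor
  · intro g hg
    change (weightHomA v r F a).coeff g = 0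
    rw [h, AddMonoidAlgebra.coeff_single, Finsupp.single_apply, if_neg (by intro h; linarith)]
  · change (weightHomA v r F a).coeff e = c
    rw [h, AddMonoidAlgebra.coeff_single, Finsupp.single_apply, if_pos rfl]

lemma hasLow_one : HasLow v r F 0 1 1 :=
  hasLow_of_weightHomA (by rw [map_one]; rfl)

lemma HasLow.pow {e : ℝ} {a : RingA k m r F} {c : MvPolynomial (Fin 2) k}
    (ha : HasLow v r F e a c) : ∀ n : ℕ, HasLow v r F (n * e) (a ^ n) (c ^ n)
  | 0 => by simpa using hasLow_one
  | n + 1 => by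
    have := (HasLow.pow ha n).mul ha
    rw [pow_succ, pow_succ]
    convert this using 1
    push_cast; ring

lemma HasLow.prod {ι : Type} (s : Finset ι) {e : ι → ℝ} {a : ι → RingA k m r F}
    {c : ι → MvPolynomial (Fin 2) k} (h : ∀ i ∈ s, HasLow v r F (e i) (a i) (c i)) :
    HasLow v r F (∑ i ∈ s, e i) (∏ i ∈ s, a i) (∏ i ∈ s, c i) := by
  classical
  induction s using Finset.induction_on with
  | empty => simpa using hasLow_one
  | insert i s hi ih =>
    rw [Finset.sum_insert hi, Finset.prod_insert hi, Finset.prod_insert hi]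
    exact (h i (Finset.mem_insert_self _ _)).mul
      (ih fun j hj => h j (Finset.mem_insert_of_mem hj))

lemma hasLow_x (i : Fin m) : HasLow v r F (v i) (xA k m r F i) 1 :=
  hasLow_of_weightHomA (by
    rw [xA, weightHomA_mk, weightHomBig, aeval_X, Sum.elim_inl])

/-- `k[Z,T] → A`. -/
def ztA (k : Type) [Field k] (m : ℕ) (r : Fin m → ℕ) (F : MvPolynomial (Fin m ⊕ Fin 2) k) :
    MvPolynomial (Fin 2) k →ₐ[k] RingA k m r F := aeval ![zA k m r F, tA k m r F]

lemma hasLow_zt (b : MvPolynomial (Fin 2) k) : HasLow v r F 0 (ztA k m r F b) b := by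
  apply hasLow_of_weightHomA
  have : (weightHomA v r F).comp (ztA k m r F) =
      (AddMonoidAlgebra.singleZeroAlgHom (R := k) (A := MvPolynomial (Fin 2) k) (M := ℝ)) := by
    ext i : 1
    fin_cases i <;>
    simp [ztA, zA, tA, weightHomA_mk, weightHomBig]
  exact DFunLike.congr_fun this b

lemma hasLow_y (hm : 1 ≤ m) (hv : ∀ i, 0 < v i) {g : MvPolynomial (Fin m ⊕ Fin 2) k}
    (hFg : F = rename Sum.inr (fOf k m F) + (∏ i, X (Sum.inl i)) * g) :
    HasLow v r F (-∑ i, r i * v i) (yA k m r F) (fOf k m F) := by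
  have hnn : ∀ P : MvPolynomial (Fin m ⊕ Fin 2) k, ∀ g < 0, (weightHom v P).coeff g = 0 := by
    intro P
    induction P using MvPolynomial.induction_on with
    | C a =>
      intro g hg
      rw [← algebraMap_eq, AlgHom.commutes, AddMonoidAlgebra.coe_algebraMap]
      simp [Finsupp.single_apply, hg.ne']
    | add p q hp hq => intro g hg; rw [map_add]; simp [hp g hg, hq g hg]
    | mul_X p i hp =>
      intro g hg
      rw [map_mul]
      have h2 : ∀ g < 0, (weightHom v (X i : MvPolynomial (Fin m ⊕ Fin 2) k)).coeff g = 0 := by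
        intro g hg
        rcases i with i | i
        · have := hv i
          simp [weightHom, Finsupp.single_apply, show v i ≠ g by intro h; linarith]
        · simp [weightHom, Finsupp.single_apply, hg.ne']
      exact (coeff_mul_low_aux hp h2).1 g (by linarith)
  have hF : (∀ g < 0, (weightHom v F).coeff g = 0) ∧ (weightHom v F).coeff 0 = fOf k m F := by
    refine ⟨hnn F, ?_⟩
    have hu : weightHom v (∏ i, X (Sum.inl i) : MvPolynomial (Fin m ⊕ Fin 2) k)
        = AddMonoidAlgebra.single (∑ i, v i) 1 := by
      rw [map_prod]
      simp only [weightHom, aeval_X, Sum.elim_inl]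
      have := (AddMonoidAlgebra.prod_single (R := MvPolynomial (Fin 2) k)
        (s := Finset.univ) (m := fun i : Fin m => v i) (r := fun _ => 1))
      simpa using this
    have hpos : 0 < ∑ i, v i := Finset.sum_pos (fun i _ => hv i) ⟨⟨0, hm⟩, Finset.mem_univ _⟩
    have hr : ∀ p : MvPolynomial (Fin 2) k, weightHom v (rename Sum.inr p : MvPolynomial (Fin m ⊕ Fin 2) k)
        = AddMonoidAlgebra.single 0 p := by
      intro p
      have : (weightHom v).comp (rename (Sum.inr : Fin 2 → Fin m ⊕ Fin 2)) =
          (AddMonoidAlgebra.singleZeroAlgHom (R := k) (A := MvPolynomial (Fin 2) k) (M := ℝ)) := by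
        ext i : 1
        simp [weightHom]
      exact DFunLike.congr_fun this p
    conv_lhs => rw [hFg]
    rw [map_add, map_mul, hr, hu]
    have h3 := (coeff_mul_low_aux (x := AddMonoidAlgebra.single (∑ i, v i) 1)
      (y := weightHom v g) (e := ∑ i, v i) (e' := 0) (by
        intro g hg; simp [Finsupp.single_apply, hg.ne']) (hnn g)).1 0 (by linarith)
    simp only [AddMonoidAlgebra.coeff_add, Finsupp.add_apply, h3]
    simp
  have h := coeff_mul_low_aux (x := AddMonoidAlgebra.single (-∑ i, r i * v i) 1)
      (y := weightHom v F) (e := -∑ i, r i * v i) (e' := 0) (by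
        intro g hg; simp [Finsupp.single_apply, hg.ne']) hF.1
  rw [add_zero] at h
  have hy : weightHomA v r F (yA k m r F)
      = AddMonoidAlgebra.single (-∑ i, r i * v i) 1 * weightHom v F := by
    rw [yA, weightHomA_mk, weightHomBig, aeval_X]; rfl
  constructor
  · intro g hg
    change (weightHomA v r F _).coeff g = 0
    rw [hy]; exact h.1 g hg
  · change (weightHomA v r F _).coeff _ = _
    rw [hy, h.2, hF.2]; simp

end

section
variable {k : Type} [Field k] {m : ℕ} {v : Fin m → ℝ} {r : Fin m → ℕ}
  {F : MvPolynomial (Fin m ⊕ Fin 2) k}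

/-- The image in `A` of a polynomial not involving `Y`. -/
def inclA (k : Type) [Field k] (m : ℕ) (r : Fin m → ℕ) (F : MvPolynomial (Fin m ⊕ Fin 2) k) :
    MvPolynomial (Fin m ⊕ Fin 2) k →ₐ[k] RingA k m r F :=
  (Ideal.Quotient.mkₐ k _).comp (incl k m)

lemma inclA_apply (P : MvPolynomial (Fin m ⊕ Fin 2) k) :
    inclA k m r F P = Ideal.Quotient.mk _ (incl k m P) := rfl

lemma inclA_X_inl (i : Fin m) : inclA k m r F (X (Sum.inl i)) = xA k m r F i := by
  simp [inclA_apply, incl, xA]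

lemma inclA_rename (b : MvPolynomial (Fin 2) k) :
    inclA k m r F (rename Sum.inr b) = ztA k m r F b := by
  have : (inclA k m r F).comp (rename Sum.inr) = ztA k m r F := by
    ext i
    fin_cases i <;> simp [inclA_apply, incl, ztA, zA, tA]
  exact DFunLike.congr_fun this b

lemma xA_prod_mul_yA :
    (∏ i, xA k m r F i ^ r i) * yA k m r F = inclA k m r F F := by
  rw [inclA_apply, ← sub_eq_zero]
  simp only [xA, yA, ← map_pow, ← map_prod, ← map_mul, ← map_sub]
  exact Ideal.Quotient.eq_zero_iff_mem.2 (Ideal.mem_span_singleton_self _)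

/-- The element `x^l y^j b(z,t)`. -/
def monoA (k : Type) [Field k] {m : ℕ} (r : Fin m → ℕ) (F : MvPolynomial (Fin m ⊕ Fin 2) k)
    (p : (Fin m → ℕ) × ℕ) (b : MvPolynomial (Fin 2) k) : RingA k m r F :=
  (∏ i, xA k m r F i ^ p.1 i) * yA k m r F ^ p.2 * ztA k m r F b

lemma monoA_zero (p : (Fin m → ℕ) × ℕ) : monoA k r F p 0 = 0 := by simp [monoA]

lemma monoA_add (p : (Fin m → ℕ) × ℕ) (b c : MvPolynomial (Fin 2) k) :
    monoA k r F p (b + c) = monoA k r F p b + monoA k r F p c := by simp [monoA, mul_add]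

lemma inclA_monomial (s : Fin m ⊕ Fin 2 →₀ ℕ) (a : k) (j : ℕ) :
    inclA k m r F (monomial s a) * yA k m r F ^ j
      = monoA k r F (fun i => s (Sum.inl i), j)
        (C a * ∏ i, X i ^ s (Sum.inr i)) := by
  have h : (monomial s a : MvPolynomial (Fin m ⊕ Fin 2) k) = (∏ i, X (Sum.inl i) ^ s (Sum.inl i)) *
      rename Sum.inr (C a * ∏ i, X i ^ s (Sum.inr i) : MvPolynomial (Fin 2) k) := by
    rw [monomial_eq, Finsupp.prod_fintype _ _ (fun i => pow_zero _), Fintype.prod_sum_type]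
    simp only [map_mul, map_prod, map_pow, rename_X, rename_C]
    ring
  rw [h, map_mul, inclA_rename, map_prod]
  simp only [map_pow, inclA_X_inl, monoA]
  ring

/-- `N` is supported on exponents whose monomials are not divisible by `x^r y`. -/
def IsNormal (r : Fin m → ℕ) (N : ((Fin m → ℕ) × ℕ) →₀ MvPolynomial (Fin 2) k) : Prop :=
  ∀ p ∈ N.support, p.2 = 0 ∨ ∃ i, p.1 i < r i

/-- The element of `A` with the given coefficients. -/
def evalA (k : Type) [Field k] {m : ℕ} (r : Fin m → ℕ) (F : MvPolynomial (Fin m ⊕ Fin 2) k)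
    (N : ((Fin m → ℕ) × ℕ) →₀ MvPolynomial (Fin 2) k) : RingA k m r F :=
  N.sum (monoA k r F)

lemma evalA_add (N N' : ((Fin m → ℕ) × ℕ) →₀ MvPolynomial (Fin 2) k) :
    evalA k r F (N + N') = evalA k r F N + evalA k r F N' :=
  Finsupp.sum_add_index' monoA_zero monoA_add

lemma evalA_zero : evalA k r F 0 = 0 := Finsupp.sum_zero_index

lemma evalA_single (p : (Fin m → ℕ) × ℕ) (b : MvPolynomial (Fin 2) k) :
    evalA k r F (Finsupp.single p b) = monoA k r F p b :=
  Finsupp.sum_single_index (monoA_zero _)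

lemma IsNormal.add {N N' : ((Fin m → ℕ) × ℕ) →₀ MvPolynomial (Fin 2) k} (h : IsNormal r N)
    (h' : IsNormal r N') : IsNormal r (N + N') := by
  classical
  intro p hp
  rcases Finset.mem_union.1 (Finsupp.support_add hp) with h1 | h1
  · exact h p h1
  · exact h' p h1

/-- Elements of `A` having a normal form. -/
def normalA (k : Type) [Field k] {m : ℕ} (r : Fin m → ℕ) (F : MvPolynomial (Fin m ⊕ Fin 2) k) :
    AddSubmonoid (RingA k m r F) where
  carrier := {a | ∃ N, IsNormal r N ∧ evalA k r F N = a}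
  zero_mem' := ⟨0, fun p hp => by simp at hp, evalA_zero⟩
  add_mem' := by
    rintro _ _ ⟨N, h, rfl⟩ ⟨N', h', rfl⟩
    exact ⟨N + N', h.add h', evalA_add _ _⟩

lemma monoA_mem_normalA {p : (Fin m → ℕ) × ℕ} (hp : p.2 = 0 ∨ ∃ i, p.1 i < r i)
    (b : MvPolynomial (Fin 2) k) : monoA k r F p b ∈ normalA k r F := by
  refine ⟨Finsupp.single p b, ?_, evalA_single _ _⟩
  intro q hq
  rw [Finset.mem_singleton.1 (Finsupp.support_single_subset hq)]
  exact hp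

lemma inclA_mul_yA_pow_mem (j : ℕ) : ∀ P : MvPolynomial (Fin m ⊕ Fin 2) k,
    inclA k m r F P * yA k m r F ^ j ∈ normalA k r F := by
  induction j with
  | zero =>
    intro P
    induction P using MvPolynomial.induction_on' with
    | monomial s a =>
      rw [inclA_monomial]
      exact monoA_mem_normalA (Or.inl rfl) _
    | add p q hp hq => rw [map_add, add_mul]; exact add_mem hp hq
  | succ j ih =>
    intro P
    induction P using MvPolynomial.induction_on' with
    | monomial s a =>
      by_cases h : ∃ i, s (Sum.inl i) < r i
      · rw [inclA_monomial]
        exact monoA_mem_normalA (Or.inr h) _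
      · push Not at h
        obtain ⟨β, hβ⟩ : ∃ β : MvPolynomial (Fin 2) k, β = C a * ∏ i, X i ^ s (Sum.inr i) :=
          ⟨_, rfl⟩
        have hs : inclA k m r F (monomial s a) = (∏ i, xA k m r F i ^ r i) *
            inclA k m r F ((∏ i, X (Sum.inl i) ^ (s (Sum.inl i) - r i)) *
              rename Sum.inr β) := by
          have := inclA_monomial (r := r) (F := F) s a 0
          rw [pow_zero, mul_one, ← hβ] at this
          rw [this, monoA, map_mul, inclA_rename, map_prod, pow_zero, mul_one, ← mul_assoc,
            ← Finset.prod_mul_distrib]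
          congr 1
          refine Finset.prod_congr rfl fun i _ => ?_
          rw [map_pow, inclA_X_inl, ← pow_add, Nat.add_sub_cancel' (h i)]
        rw [hs, pow_succ]
        have := ih (F * ((∏ i, X (Sum.inl i) ^ (s (Sum.inl i) - r i)) *
              rename Sum.inr β))
        rw [map_mul, ← xA_prod_mul_yA] at this
        convert this using 1
        ring
    | add p q hp hq => rw [map_add, add_mul]; exact add_mem hp hq

lemma exists_normal_form (a : RingA k m r F) : ∃ N, IsNormal r N ∧ evalA k r F N = a := by
  have key : ∀ Q : BigP k m, (Ideal.Quotient.mk _ Q : RingA k m r F) ∈ AddSubmonoid.closure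
      {a | ∃ P j, a = inclA k m r F P * yA k m r F ^ j} := by
    intro Q
    induction Q using MvPolynomial.induction_on with
    | C c =>
      refine AddSubmonoid.subset_closure ⟨C c, 0, ?_⟩
      rw [pow_zero, mul_one, inclA_apply, incl, rename_C]
    | add p q hp hq => rw [map_add]; exact add_mem hp hq
    | mul_X p i hp =>
      rw [map_mul]
      generalize (Ideal.Quotient.mk (Ideal.span {relG k m r F}) p) = w at hp
      induction hp using AddSubmonoid.closure_induction with
      | mem a ha =>
        obtain ⟨P, j, rfl⟩ := ha
        refine AddSubmonoid.subset_closure ?_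
        rcases i with i | i
        · refine ⟨P * X (Sum.inl i), j, ?_⟩
          rw [map_mul, inclA_X_inl, xA]; ring
        · fin_cases i
          · exact ⟨P, j + 1, by rw [pow_succ, yA]; simp; ring⟩
          · refine ⟨P * X (Sum.inr 0), j, ?_⟩
            have : inclA k m r F (X (Sum.inr 0)) = Ideal.Quotient.mk _ (X (Sum.inr 1)) := by
              simp [inclA_apply, incl]
            rw [map_mul, this]; simp; ring
          · refine ⟨P * X (Sum.inr 1), j, ?_⟩
            have : inclA k m r F (X (Sum.inr 1)) = Ideal.Quotient.mk _ (X (Sum.inr 2)) := by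
              simp [inclA_apply, incl]
            rw [map_mul, this]; simp; ring
      | zero => rw [zero_mul]; exact zero_mem _
      | add a b _ _ ha hb => rw [add_mul]; exact add_mem ha hb
  obtain ⟨Q, rfl⟩ := Ideal.Quotient.mk_surjective a
  have hle : AddSubmonoid.closure {a | ∃ P j, a = inclA k m r F P * yA k m r F ^ j}
      ≤ normalA k r F := by
    rw [AddSubmonoid.closure_le]
    rintro _ ⟨P, j, rfl⟩
    exact inclA_mul_yA_pow_mem j P
  exact hle (key Q)

/-- The weight of `x^l y^j`. -/
def weightOf (v : Fin m → ℝ) (r : Fin m → ℕ) (p : (Fin m → ℕ) × ℕ) : ℝ :=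
  ∑ i, p.1 i * v i + p.2 * (-∑ i, r i * v i)

/-- `v` has positive, rationally independent entries. -/
structure GoodWeight (v : Fin m → ℝ) : Prop where
  pos : ∀ i, 0 < v i
  inj : ∀ n : Fin m → ℤ, ∑ i, n i * v i = 0 → n = 0

lemma weightOf_inj (hv : GoodWeight v) {p q : (Fin m → ℕ) × ℕ}
    (hp : p.2 = 0 ∨ ∃ i, p.1 i < r i) (hq : q.2 = 0 ∨ ∃ i, q.1 i < r i)
    (h : weightOf v r p = weightOf v r q) : p = q := by
  have h0 := hv.inj (fun i => (p.1 i - p.2 * r i : ℤ) - (q.1 i - q.2 * r i : ℤ)) (by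
    have : weightOf v r p - weightOf v r q = 0 := by rw [h, sub_self]
    rw [← this]
    simp only [weightOf, mul_neg, Finset.mul_sum]
    rw [← Finset.sum_neg_distrib, ← Finset.sum_neg_distrib, ← Finset.sum_add_distrib,
      ← Finset.sum_add_distrib, ← Finset.sum_sub_distrib]
    refine Finset.sum_congr rfl fun i _ => ?_
    push_cast; ring)
  have h1 : ∀ i, (p.1 i : ℤ) - p.2 * r i = q.1 i - q.2 * r i := fun i => by
    have := congrFun h0 i
    simp only [Pi.zero_apply] at this
    linarith
  have aux : ∀ p q : (Fin m → ℕ) × ℕ, (∀ i, (p.1 i : ℤ) - p.2 * r i = q.1 i - q.2 * r i) →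
      (q.2 = 0 ∨ ∃ i, q.1 i < r i) → q.2 ≤ p.2 := by
    intro p q h hq
    rcases hq with hq | ⟨i, hi⟩
    · omega
    · by_contra hlt
      push Not at hlt
      have := h i
      have h2 : ((q.2 : ℤ) - p.2) * r i = q.1 i - p.1 i := by linarith
      have h3 : (1 : ℤ) * r i ≤ ((q.2 : ℤ) - p.2) * r i := by gcongr; omega
      omega
  have h2 : p.2 = q.2 := le_antisymm (aux q p (fun i => (h1 i).symm) hp) (aux p q h1 hq)
  refine Prod.ext (funext fun i => ?_) h2
  have := h1 i
  rw [h2] at this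
  omega

lemma HasLow.mono {e e' : ℝ} {a : RingA k m r F} {c : MvPolynomial (Fin 2) k}
    (h : HasLow v r F e a c) (hlt : e' < e) : HasLow v r F e' a 0 :=
  ⟨fun g hg => h.1 g (hg.trans hlt), h.1 _ hlt⟩

lemma hasLow_zero (e : ℝ) : HasLow v r F e 0 0 := ⟨fun _ _ => map_zero _, map_zero _⟩

lemma HasLow.add {e : ℝ} {a b : RingA k m r F} {c d : MvPolynomial (Fin 2) k}
    (ha : HasLow v r F e a c) (hb : HasLow v r F e b d) : HasLow v r F e (a + b) (c + d) :=
  ⟨fun g hg => by rw [map_add, ha.1 g hg, hb.1 g hg, add_zero], by rw [map_add, ha.2, hb.2]⟩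

lemma HasLow.sum {ι : Type} (s : Finset ι) {e : ℝ} {a : ι → RingA k m r F}
    {c : ι → MvPolynomial (Fin 2) k} (h : ∀ i ∈ s, HasLow v r F e (a i) (c i)) :
    HasLow v r F e (∑ i ∈ s, a i) (∑ i ∈ s, c i) := by
  classical
  induction s using Finset.induction_on with
  | empty => simpa using hasLow_zero e
  | insert i s hi ih =>
    rw [Finset.sum_insert hi, Finset.sum_insert hi]
    exact (h i (Finset.mem_insert_self _ _)).add
      (ih fun j hj => h j (Finset.mem_insert_of_mem hj))

variable {g : MvPolynomial (Fin m ⊕ Fin 2) k}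

lemma hasLow_monoA (hm : 1 ≤ m) (hv : GoodWeight v)
    (hFg : F = rename Sum.inr (fOf k m F) + (∏ i, X (Sum.inl i)) * g)
    (p : (Fin m → ℕ) × ℕ) (b : MvPolynomial (Fin 2) k) :
    HasLow v r F (weightOf v r p) (monoA k r F p b) (fOf k m F ^ p.2 * b) := by
  have h1 := HasLow.prod (v := v) (r := r) (F := F) Finset.univ
    (e := fun i => p.1 i * v i) (c := fun i => 1 ^ p.1 i)
    (a := fun i => xA k m r F i ^ p.1 i) (fun i _ => (hasLow_x i).pow _)
  have h := (h1.mul ((hasLow_y hm hv.pos hFg).pow p.2)).mul (hasLow_zt b)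
  rw [monoA, weightOf]
  convert h using 1
  · ring
  · simp

/-- The lowest term of a normal form. -/
lemma exists_lowest_term (hm : 1 ≤ m) (hv : GoodWeight v) (hf : fOf k m F ≠ 0)
    (hFg : F = rename Sum.inr (fOf k m F) + (∏ i, X (Sum.inl i)) * g)
    {N : ((Fin m → ℕ) × ℕ) →₀ MvPolynomial (Fin 2) k} (hN : IsNormal r N) (h0 : N ≠ 0) :
    ∃ p ∈ N.support, (∀ q ∈ N.support, weightOf v r p ≤ weightOf v r q) ∧
      fOf k m F ^ p.2 * N p ≠ 0 ∧
      HasLow v r F (weightOf v r p) (evalA k r F N) (fOf k m F ^ p.2 * N p) := by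
  classical
  obtain ⟨p, hp, hmin⟩ := Finset.exists_min_image N.support (weightOf v r)
    (Finsupp.support_nonempty_iff.2 h0)
  refine ⟨p, hp, hmin, mul_ne_zero (pow_ne_zero _ hf) (Finsupp.mem_support_iff.1 hp), ?_⟩
  have h := HasLow.sum (v := v) (r := r) (F := F) N.support (e := weightOf v r p)
    (a := fun q => monoA k r F q (N q)) (c := fun q => if q = p then fOf k m F ^ p.2 * N p else 0)
    (fun q hq => by
      split_ifs with hqp
      · subst hqp; exact hasLow_monoA hm hv hFg _ _
      · refine (hasLow_monoA hm hv hFg q (N q)).mono (lt_of_le_of_ne (hmin q hq) fun he => hqp ?_)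
        exact (weightOf_inj hv (hN p hp) (hN q hq) he).symm)
  rw [Finset.sum_ite_eq' N.support p, if_pos hp] at h
  exact h

lemma exists_order_A (hm : 1 ≤ m) (hv : GoodWeight v) (hf : fOf k m F ≠ 0)
    (hFg : F = rename Sum.inr (fOf k m F) + (∏ i, X (Sum.inl i)) * g)
    (a : RingA k m r F) (ha : a ≠ 0) :
    ∃ e, (∀ g < e, wcoeff v r F g a = 0) ∧ wcoeff v r F e a ≠ 0 := by
  obtain ⟨N, hN, rfl⟩ := exists_normal_form a
  have h0 : N ≠ 0 := by rintro rfl; exact ha evalA_zero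
  obtain ⟨p, -, -, h1, h2⟩ := exists_lowest_term hm hv hf hFg hN h0
  exact ⟨_, h2.1, by rw [h2.2]; exact h1⟩

end

lemma exists_linearIndependent_real (m : ℕ) : ∃ u : Fin m → ℝ, LinearIndependent ℚ u := by
  induction m with
  | zero => exact ⟨Fin.elim0, linearIndependent_empty_type⟩
  | succ m ih =>
    obtain ⟨u, hu⟩ := ih
    obtain ⟨x, hx⟩ := exists_linearIndependent_snoc_of_lt_rank hu (by
      rw [Real.rank_rat_real]; exact Cardinal.nat_lt_continuum m)
    exact ⟨_, hx⟩

/-- Rationally independent positive weights can be chosen so that a given monomial `x^l y^j` in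
normal form, with `j > 0`, has negative weight. -/
lemma exists_goodWeight {m : ℕ} (r : Fin m → ℕ) (p : (Fin m → ℕ) × ℕ) (hp : 0 < p.2)
    (i₀ : Fin m) (hi : p.1 i₀ < r i₀) : ∃ v : Fin m → ℝ, GoodWeight v ∧ weightOf v r p < 0 := by
  classical
  obtain ⟨u, hu⟩ := exists_linearIndependent_real m
  have hu0 : ∀ i, 0 < |u i| := fun i => abs_pos.2 (hu.ne_zero i)
  set B : ℝ := ∑ i, p.1 i * |u i|
  obtain ⟨n, hn⟩ := exists_nat_gt (B / |u i₀|)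
  have hnpos : (0 : ℝ) < n := lt_of_le_of_lt (by positivity) hn
  rw [div_lt_iff₀ (hu0 i₀)] at hn
  set v : Fin m → ℝ := fun i => if i = i₀ then n * |u i| else |u i| with hv
  have hvpos : ∀ i, 0 < v i := fun i => by
    simp only [hv]; split_ifs
    · exact mul_pos hnpos (hu0 i)
    · exact hu0 i
  refine ⟨v, ⟨hvpos, ?_⟩, ?_⟩
  · intro c hc
    have hq : ∀ i, ∃ q : ℚ, v i = q * u i := by
      intro i
      have h1 : ∃ q : ℚ, |u i| = q * u i := by
        rcases abs_choice (u i) with h | h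
        · exact ⟨1, by rw [h]; simp⟩
        · exact ⟨-1, by rw [h]; simp⟩
      obtain ⟨q, hq⟩ := h1
      simp only [hv]; split_ifs
      · exact ⟨n * q, by rw [hq]; push_cast; ring⟩
      · exact ⟨q, hq⟩
    choose q hq using hq
    have h0 : ∀ i, q i ≠ 0 := fun i h => by
      have := hvpos i
      rw [hq, h] at this; simp at this
    have := Fintype.linearIndependent_iff.1 hu (fun i => c i * q i) (by
      rw [← hc]
      refine Finset.sum_congr rfl fun i _ => ?_
      rw [Rat.smul_def, hq i]; push_cast; ring)
    funext i
    have h1 := this i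
    rcases mul_eq_zero.1 h1 with h | h
    · exact_mod_cast h
    · exact absurd h (h0 i)
  · have h1 : weightOf v r p = ∑ i, ((p.1 i : ℝ) - p.2 * r i) * v i := by
      simp only [weightOf, mul_neg, Finset.mul_sum, sub_mul, Finset.sum_sub_distrib]
      rw [← sub_eq_add_neg]
      congr 1
      exact Finset.sum_congr rfl fun i _ => by ring
    rw [h1, ← Finset.add_sum_erase _ _ (Finset.mem_univ i₀)]
    have h2 : ∑ i ∈ Finset.univ.erase i₀, ((p.1 i : ℝ) - p.2 * r i) * v i ≤ B := by
      refine (Finset.sum_le_sum (g := fun i => p.1 i * |u i|) fun i hi => ?_).trans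
        (Finset.sum_le_sum_of_subset_of_nonneg (Finset.erase_subset _ _)
          fun i _ _ => mul_nonneg (Nat.cast_nonneg _) (abs_nonneg _))
      simp only [hv, if_neg (Finset.ne_of_mem_erase hi)]
      refine mul_le_mul_of_nonneg_right ?_ (abs_nonneg _)
      have : (0 : ℝ) ≤ p.2 * r i := by positivity
      linarith
    have h3 : ((p.1 i₀ : ℝ) - p.2 * r i₀) * v i₀ ≤ -(n * |u i₀|) := by
      simp only [hv, if_true]
      have h4 : (p.1 i₀ : ℝ) + 1 ≤ r i₀ := by exact_mod_cast hi
      have h5 : (1 : ℝ) ≤ p.2 := by exact_mod_cast hp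
      have h6 : (r i₀ : ℝ) ≤ p.2 * r i₀ := le_mul_of_one_le_left (Nat.cast_nonneg _) h5
      have h7 := mul_pos hnpos (hu0 i₀)
      nlinarith
    linarith

section
variable {D : Type} [CommRing D]

/-- The translation `p(X) ↦ p(X + U)`. -/
def shiftHom (D : Type) [CommRing D] : Polynomial D →+* Polynomial (Polynomial D) :=
  (Polynomial.taylorAlgHom (Polynomial.X : Polynomial D)).toRingHom.comp
    (Polynomial.mapRingHom Polynomial.C)

lemma coeff_shiftHom (p : Polynomial D) (n : ℕ) :
    (shiftHom D p).coeff n = Polynomial.hasseDeriv n p := by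
  have h : Polynomial.hasseDeriv n (p.map Polynomial.C : Polynomial (Polynomial D))
      = (Polynomial.hasseDeriv n p).map Polynomial.C := by
    ext i : 1
    simp [Polynomial.hasseDeriv_coeff]
  have h2 : (shiftHom D p).coeff n
      = (Polynomial.taylor (Polynomial.X : Polynomial D) (p.map Polynomial.C)).coeff n := rfl
  rw [h2, Polynomial.taylor_coeff, h, Polynomial.eval_map, Polynomial.eval₂_C_X]

end

section
variable {k : Type} [Field k] {m : ℕ} {v : Fin m → ℝ} {r : Fin m → ℕ}
  {F g : MvPolynomial (Fin m ⊕ Fin 2) k} {D : Type} [CommRing D] [Algebra k D]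

/-- Translation transported along an isomorphism. -/
def phiA (Φ : RingA k m r F ≃ₐ[k] Polynomial D) : RingA k m r F →+* Polynomial (RingA k m r F) :=
  (Polynomial.mapRingHom (Φ.symm : Polynomial D →+* RingA k m r F)).comp
    ((shiftHom D).comp (Φ : RingA k m r F →+* Polynomial D))

lemma coeff_phiA (Φ : RingA k m r F ≃ₐ[k] Polynomial D) (a : RingA k m r F) (i : ℕ) :
    (phiA Φ a).coeff i = Φ.symm (Polynomial.hasseDeriv i (Φ a)) := by
  simp [phiA, coeff_shiftHom]

lemma phiA_eq_C (Φ : RingA k m r F ≃ₐ[k] Polynomial D) {a : RingA k m r F} {d : D}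
    (h : Φ a = Polynomial.C d) : phiA Φ a = Polynomial.C a := by
  ext i
  rw [coeff_phiA, Polynomial.coeff_C, h]
  split_ifs with hi
  · subst hi; rw [Polynomial.hasseDeriv_zero', ← h, Φ.symm_apply_apply]
  · rw [Polynomial.hasseDeriv_C _ _ (Nat.pos_of_ne_zero hi), map_zero]

/-- The shift of weights under `φ` is bounded by the slope `μ`. -/
def LowShift (v : Fin m → ℝ) (Φ : RingA k m r F ≃ₐ[k] Polynomial D) (μ e : ℝ)
    (a : RingA k m r F) : Prop :=
  ∀ i : ℕ, ∀ g < e + i * μ, wcoeff v r F g ((phiA Φ a).coeff i) = 0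

variable {Φ : RingA k m r F ≃ₐ[k] Polynomial D} {μ : ℝ}

lemma LowShift.mul {e e' : ℝ} {a b : RingA k m r F} (ha : LowShift v Φ μ e a)
    (hb : LowShift v Φ μ e' b) : LowShift v Φ μ (e + e') (a * b) := by
  intro n g hg
  rw [map_mul, Polynomial.coeff_mul, map_sum]
  refine Finset.sum_eq_zero fun ij hij => ?_
  rw [Finset.HasAntidiagonal.mem_antidiagonal] at hij
  refine (wcoeff_mul_low _ _ _ _ (ha ij.1) (hb ij.2)).1 g ?_
  rw [← hij] at hg
  push_cast at hg
  linarith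

lemma LowShift.add {e : ℝ} {a b : RingA k m r F} (ha : LowShift v Φ μ e a)
    (hb : LowShift v Φ μ e b) : LowShift v Φ μ e (a + b) := by
  intro n g hg
  rw [map_add, Polynomial.coeff_add, map_add, ha n g hg, hb n g hg, add_zero]

lemma LowShift.mono {e e' : ℝ} {a : RingA k m r F} (ha : LowShift v Φ μ e a) (h : e' ≤ e) :
    LowShift v Φ μ e' a := fun n g hg => ha n g (by linarith)

lemma lowShift_zero (e : ℝ) : LowShift v Φ μ e 0 := fun n g _ => by simp

lemma lowShift_algebraMap (c : k) : LowShift v Φ μ 0 (algebraMap k _ c) := by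
  intro n g hg
  rw [phiA_eq_C Φ (d := algebraMap k D c) (by rw [Φ.commutes]; rfl), Polynomial.coeff_C]
  split_ifs with h
  · subst h
    have : algebraMap k (RingA k m r F) c = ztA k m r F (C c) := by
      rw [← algebraMap_eq, AlgHom.commutes]
    rw [this]
    exact (hasLow_zt (C c)).1 g (by simpa using hg)
  · exact map_zero _

lemma LowShift.pow {e : ℝ} {a : RingA k m r F} (ha : LowShift v Φ μ e a) :
    ∀ n : ℕ, LowShift v Φ μ (n * e) (a ^ n)
  | 0 => by simpa using lowShift_algebraMap (v := v) (Φ := Φ) (μ := μ) 1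
  | n + 1 => by
    rw [pow_succ]
    refine ((LowShift.pow ha n).mul ha).mono (le_of_eq ?_)
    push_cast; ring

lemma LowShift.prod {ι : Type} (s : Finset ι) {e : ι → ℝ} {a : ι → RingA k m r F}
    (h : ∀ i ∈ s, LowShift v Φ μ (e i) (a i)) :
    LowShift v Φ μ (∑ i ∈ s, e i) (∏ i ∈ s, a i) := by
  classical
  induction s using Finset.induction_on with
  | empty => simpa using lowShift_algebraMap (v := v) (Φ := Φ) (μ := μ) 1
  | insert i s hi ih =>
    rw [Finset.sum_insert hi, Finset.prod_insert hi]
    exact (h i (Finset.mem_insert_self _ _)).mul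
      (ih fun j hj => h j (Finset.mem_insert_of_mem hj))

lemma LowShift.sum {ι : Type} (s : Finset ι) {e : ℝ} {a : ι → RingA k m r F}
    (h : ∀ i ∈ s, LowShift v Φ μ e (a i)) : LowShift v Φ μ e (∑ i ∈ s, a i) := by
  classical
  induction s using Finset.induction_on with
  | empty => simpa using lowShift_zero e
  | insert i s hi ih =>
    rw [Finset.sum_insert hi]
    exact (h i (Finset.mem_insert_self _ _)).add
      (ih fun j hj => h j (Finset.mem_insert_of_mem hj))

lemma lowShift_zt (hz : LowShift v Φ μ 0 (zA k m r F)) (ht : LowShift v Φ μ 0 (tA k m r F))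
    (b : MvPolynomial (Fin 2) k) : LowShift v Φ μ 0 (ztA k m r F b) := by
  induction b using MvPolynomial.induction_on with
  | C c => rw [← algebraMap_eq, AlgHom.commutes]; exact lowShift_algebraMap c
  | add p q hp hq => rw [map_add]; exact hp.add hq
  | mul_X p i hp =>
    rw [map_mul]
    refine (hp.mul (e' := 0) ?_).mono (by simp)
    fin_cases i
    · simpa [ztA] using hz
    · simpa [ztA] using ht

/-- Weights of the generators of `A`. -/
def genWeight (v : Fin m → ℝ) (r : Fin m → ℕ) : Fin m ⊕ Fin 3 → ℝ :=
  Sum.elim v ![-∑ i, r i * v i, 0, 0]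

/-- An isomorphism of `A` with a polynomial ring induces a nontrivial filtered exponential map. -/
theorem exists_filteredExp [Nontrivial D] (hm : 1 ≤ m) (hv : GoodWeight v) (hf : fOf k m F ≠ 0)
    (hFg : F = rename Sum.inr (fOf k m F) + (∏ i, X (Sum.inl i)) * g)
    (Φ : RingA k m r F ≃ₐ[k] Polynomial D) :
    ∃ E : FilteredExp (MvPolynomial (Fin 2) k) (RingA k m r F), E.c = wcoeff v r F ∧
      E.φ = phiA Φ ∧ ∃ e a, E.Ge e a ∧ 0 < (E.psi e a).natDegree := by
  classical
  set gen : Fin m ⊕ Fin 3 → RingA k m r F := fun s => Ideal.Quotient.mk _ (X s) with hgen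
  have hlow : ∀ s, ∃ c, HasLow v r F (genWeight v r s) (gen s) c := by
    rintro (i | i)
    · exact ⟨_, hasLow_x i⟩
    · fin_cases i
      · exact ⟨_, hasLow_y hm hv.pos hFg⟩
      · refine ⟨X 0, ?_⟩
        have := hasLow_zt (v := v) (r := r) (F := F) (X 0)
        simp only [ztA, aeval_X] at this
        exact this
      · refine ⟨X 1, ?_⟩
        have := hasLow_zt (v := v) (r := r) (F := F) (X 1)
        simp only [ztA, aeval_X] at this
        exact this
  have hord : ∀ a : RingA k m r F, ∃ e, a ≠ 0 →
      (∀ g < e, wcoeff v r F g a = 0) ∧ wcoeff v r F e a ≠ 0 := by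
    intro a
    by_cases ha : a = 0
    · exact ⟨0, fun h => absurd ha h⟩
    · obtain ⟨e, he⟩ := exists_order_A hm hv hf hFg a ha
      exact ⟨e, fun _ => he⟩
  choose ord hord using hord
  set T : Finset (Σ _ : Fin m ⊕ Fin 3, ℕ) :=
    Finset.univ.sigma (fun s => (phiA Φ (gen s)).support.erase 0) with hT
  have hTmem : ∀ s i, (⟨s, i⟩ : Σ _ : Fin m ⊕ Fin 3, ℕ) ∈ T ↔
      i ≠ 0 ∧ (phiA Φ (gen s)).coeff i ≠ 0 := by
    intro s i
    simp [hT]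
  have hTne : T.Nonempty := by
    by_contra hemp
    rw [Finset.not_nonempty_iff_eq_empty] at hemp
    have h1 : ∀ s, phiA Φ (gen s) = Polynomial.C (gen s) := by
      intro s
      ext i
      rw [Polynomial.coeff_C]
      split_ifs with hi
      · subst hi; rw [coeff_phiA, Polynomial.hasseDeriv_zero', Φ.symm_apply_apply]
      · by_contra hne
        have := (hTmem s i).2 ⟨hi, hne⟩
        rw [hemp] at this; simp at this
    have h2 : (phiA Φ).comp (Ideal.Quotient.mk (Ideal.span {relG k m r F}))
        = Polynomial.C.comp (Ideal.Quotient.mk (Ideal.span {relG k m r F})) := by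
      apply MvPolynomial.ringHom_ext
      · intro c
        refine phiA_eq_C Φ (d := algebraMap k D c) ?_
        exact Φ.commutes c
      · exact h1
    obtain ⟨Q, hQ⟩ := Ideal.Quotient.mk_surjective (Φ.symm Polynomial.X)
    have h3 := congrArg (fun p => p.coeff 1) (DFunLike.congr_fun h2 Q)
    simp only [RingHom.comp_apply, hQ, coeff_phiA, Φ.apply_symm_apply, Polynomial.coeff_C] at h3
    rw [Polynomial.hasseDeriv_one'] at h3
    have h4 := congrArg Φ h3
    simp at h4
  obtain ⟨⟨s₀, i₀⟩, hst, hmin⟩ := Finset.exists_min_image T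
    (fun x => (ord ((phiA Φ (gen x.1)).coeff x.2) - genWeight v r x.1) / x.2) hTne
  set μ := (ord ((phiA Φ (gen s₀)).coeff i₀) - genWeight v r s₀) / i₀ with hμ
  have hLgen : ∀ s, LowShift v Φ μ (genWeight v r s) (gen s) := by
    intro s i g hg
    by_cases hi : i = 0
    · subst hi
      obtain ⟨c, hc⟩ := hlow s
      rw [coeff_phiA, Polynomial.hasseDeriv_zero', Φ.symm_apply_apply]
      exact hc.1 g (by simpa using hg)
    by_cases hz : (phiA Φ (gen s)).coeff i = 0
    · rw [hz, map_zero]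
    have h1 := hmin _ ((hTmem s i).2 ⟨hi, hz⟩)
    simp only at h1
    rw [le_div_iff₀ (by positivity)] at h1
    refine (hord _ hz).1 g ?_
    linarith
  have hLmono : ∀ p b, LowShift v Φ μ (weightOf v r p) (monoA k r F p b) := by
    intro p b
    have h1 := LowShift.prod (v := v) (Φ := Φ) (μ := μ) Finset.univ
      (e := fun i => p.1 i * v i) (a := fun i => xA k m r F i ^ p.1 i)
      (fun i _ => (hLgen (Sum.inl i)).pow _)
    have h2 := (h1.mul ((hLgen (Sum.inr 0)).pow p.2)).mul
      (lowShift_zt (hLgen (Sum.inr 1)) (hLgen (Sum.inr 2)) b)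
    refine h2.mono (le_of_eq ?_)
    simp [weightOf, genWeight]
  refine ⟨{ c := wcoeff v r F, φ := phiA Φ, μ := μ,
            exists_order := exists_order_A hm hv hf hFg
            mul_low := wcoeff_mul_low
            φ_zero := fun a => by rw [coeff_phiA]; simp
            φ_comp := ?_
            low := ?_ }, rfl, rfl, genWeight v r s₀, gen s₀, ?_, ?_⟩
  · intro a i j
    rw [coeff_phiA, coeff_phiA, coeff_phiA, Φ.apply_symm_apply, ← map_nsmul]
    congr 1
    have := DFunLike.congr_fun (Polynomial.hasseDeriv_comp (R := D) j i) (Φ a)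
    rw [LinearMap.comp_apply] at this
    rw [this, add_comm j i, Nat.choose_symm_add]
    rfl
  · intro e a ha
    by_cases h0 : a = 0
    · subst h0; intro i g _; simp
    obtain ⟨N, hN, rfl⟩ := exists_normal_form a
    have hN0 : N ≠ 0 := by rintro rfl; exact h0 evalA_zero
    obtain ⟨p, -, hpmin, h1, h2⟩ := exists_lowest_term hm hv hf hFg hN hN0
    have hle : e ≤ weightOf v r p := by
      by_contra hlt
      exact h1 (by rw [← h2.2]; exact ha _ (not_le.1 hlt))
    exact LowShift.sum (v := v) (Φ := Φ) (μ := μ) N.support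
      (fun q hq => (hLmono q (N q)).mono (hle.trans (hpmin q hq)))
  · obtain ⟨c, hc⟩ := hlow s₀
    exact hc.1
  · obtain ⟨hi, hne⟩ := (hTmem s₀ i₀).1 hst
    refine (Nat.pos_of_ne_zero hi).trans_le (Polynomial.le_natDegree_of_ne_zero ?_)
    rw [FilteredExp.coeff_psi]
    have : genWeight v r s₀ + i₀ * μ = ord ((phiA Φ (gen s₀)).coeff i₀) := by
      rw [hμ]; field_simp; ring
    change wcoeff v r F (genWeight v r s₀ + i₀ * μ) _ ≠ 0
    rw [this]
    exact (hord _ hne).2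

end

lemma weightOf_eq_add {m : ℕ} {v : Fin m → ℝ} {r : Fin m → ℕ} (hv : GoodWeight v)
    {p q : (Fin m → ℕ) × ℕ} {n : ℤ} {i₀ : Fin m}
    (h : weightOf v r p = weightOf v r q + n * v i₀) :
    (p.1 i₀ : ℤ) - p.2 * r i₀ = q.1 i₀ - q.2 * r i₀ + n := by
  have h0 := hv.inj (fun i => (p.1 i - p.2 * r i : ℤ) - (q.1 i - q.2 * r i : ℤ)
      - if i = i₀ then n else 0) (by
    have : weightOf v r p - weightOf v r q - n * v i₀ = 0 := by rw [h]; ring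
    rw [← this]
    have h3 : (n : ℝ) * v i₀ = ∑ i, (if i = i₀ then (n : ℝ) else 0) * v i := by simp
    rw [h3]
    simp only [weightOf, mul_neg, Finset.mul_sum]
    rw [← Finset.sum_neg_distrib, ← Finset.sum_neg_distrib, ← Finset.sum_add_distrib,
      ← Finset.sum_add_distrib, ← Finset.sum_sub_distrib, ← Finset.sum_sub_distrib]
    refine Finset.sum_congr rfl fun i _ => ?_
    push_cast; ring)
  have := congrFun h0 i₀
  simp only [Pi.zero_apply, if_true] at this
  linarith

section
variable {k : Type} [Field k] {m : ℕ} {v : Fin m → ℝ} {r : Fin m → ℕ}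
  {F g : MvPolynomial (Fin m ⊕ Fin 2) k}
  {E : FilteredExp (MvPolynomial (Fin 2) k) (RingA k m r F)}

lemma FilteredExp.natDegree_psi_of_eq_C {R A : Type} [CommRing R] [CommRing A]
    {E : FilteredExp R A} {e : ℝ} {a : A} (h : E.φ a = Polynomial.C a) :
    (E.psi e a).natDegree = 0 := by
  apply Nat.le_zero.1
  rw [Polynomial.natDegree_le_iff_coeff_eq_zero]
  intro j hj
  rw [FilteredExp.coeff_psi, h, Polynomial.coeff_C, if_neg hj.ne', map_zero]

/-- A nonzero lowest coefficient comes from a monomial. -/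
lemma exists_lead_monoA (hm : 1 ≤ m) (hv : GoodWeight v) (hf : fOf k m F ≠ 0)
    (hFg : F = rename Sum.inr (fOf k m F) + (∏ i, X (Sum.inl i)) * g) (hE : E.c = wcoeff v r F)
    {e : ℝ} {a : RingA k m r F} (ha : E.Ge e a) (h0 : E.c e a ≠ 0) :
    ∃ p b, weightOf v r p = e ∧ b ≠ 0 ∧ E.c e a = fOf k m F ^ p.2 * b ∧
      E.psi e a = E.psi e (monoA k r F p b) := by
  obtain ⟨N, hN, rfl⟩ := exists_normal_form a
  have hN0 : N ≠ 0 := by rintro rfl; rw [evalA_zero, map_zero] at h0; exact h0 rfl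
  obtain ⟨p, hp, -, h1, h2⟩ := exists_lowest_term hm hv hf hFg hN hN0
  have he : weightOf v r p = e := by
    rcases lt_trichotomy (weightOf v r p) e with h | h | h
    · exfalso; apply h1; rw [← h2.2, ← hE]; exact ha _ h
    · exact h
    · exfalso; apply h0; rw [hE]; exact h2.1 _ h
  subst he
  have h3 := hasLow_monoA (r := r) hm hv hFg p (N p)
  refine ⟨p, N p, rfl, Finsupp.mem_support_iff.1 hp, by rw [hE, h2.2], ?_⟩
  refine ha.psi_congr (fun g hg => by rw [hE]; exact h3.1 g hg) ?_
  rw [hE, h2.2, h3.2]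

lemma HasLow.ge (hE : E.c = wcoeff v r F) {e : ℝ} {a : RingA k m r F} {c : MvPolynomial (Fin 2) k}
    (h : HasLow v r F e a c) : E.Ge e a := fun g hg => by rw [hE]; exact h.1 g hg

lemma HasLow.c_eq (hE : E.c = wcoeff v r F) {e : ℝ} {a : RingA k m r F}
    {c : MvPolynomial (Fin 2) k} (h : HasLow v r F e a c) : E.c e a = c := by rw [hE]; exact h.2

lemma HasLow.psi_ne_zero (hE : E.c = wcoeff v r F) {e : ℝ} {a : RingA k m r F}
    {c : MvPolynomial (Fin 2) k} (h : HasLow v r F e a c) (hc : c ≠ 0) : E.psi e a ≠ 0 := by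
  intro h0
  have := FilteredExp.coeff_psi_zero (E := E) e a
  rw [h0, h.c_eq hE] at this
  exact hc this.symm

lemma HasLow.natDegree_mul (hE : E.c = wcoeff v r F) {e e' : ℝ} {a b : RingA k m r F}
    {c d : MvPolynomial (Fin 2) k} (h : HasLow v r F e a c) (h' : HasLow v r F e' b d)
    (hc : c ≠ 0) (hd : d ≠ 0) :
    (E.psi (e + e') (a * b)).natDegree = (E.psi e a).natDegree + (E.psi e' b).natDegree := by
  rw [(h.ge hE).psi_mul (h'.ge hE),
    Polynomial.natDegree_mul (h.psi_ne_zero hE hc) (h'.psi_ne_zero hE hd)]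

lemma natDegree_psi_one (hE : E.c = wcoeff v r F) : E.psi 0 1 = 1 :=
  (hasLow_one.ge hE).one (hasLow_one.c_eq hE)

lemma HasLow.natDegree_pow (hE : E.c = wcoeff v r F) {e : ℝ} {a : RingA k m r F}
    {c : MvPolynomial (Fin 2) k} (h : HasLow v r F e a c) (n : ℕ) :
    (E.psi (n * e) (a ^ n)).natDegree = n * (E.psi e a).natDegree := by
  rw [FilteredExp.Ge.psi_pow (hasLow_one.ge hE) (hasLow_one.c_eq hE) (h.ge hE),
    Polynomial.natDegree_pow]

lemma natDegree_psi_prod (hE : E.c = wcoeff v r F) {ι : Type} (s : Finset ι) {e : ι → ℝ}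
    {a : ι → RingA k m r F} {c : ι → MvPolynomial (Fin 2) k}
    (h : ∀ i ∈ s, HasLow v r F (e i) (a i) (c i)) (hc : ∀ i ∈ s, c i ≠ 0) :
    (E.psi (∑ i ∈ s, e i) (∏ i ∈ s, a i)).natDegree = ∑ i ∈ s, (E.psi (e i) (a i)).natDegree := by
  classical
  induction s using Finset.induction_on with
  | empty => simp [natDegree_psi_one hE]
  | insert i s hi ih =>
    rw [Finset.sum_insert hi, Finset.prod_insert hi, Finset.sum_insert hi,
      ← ih (fun j hj => h j (Finset.mem_insert_of_mem hj))
        (fun j hj => hc j (Finset.mem_insert_of_mem hj))]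
    exact (h i (Finset.mem_insert_self _ _)).natDegree_mul hE
      (HasLow.prod s fun j hj => h j (Finset.mem_insert_of_mem hj))
      (hc i (Finset.mem_insert_self _ _))
      (Finset.prod_ne_zero_iff.2 fun j hj => hc j (Finset.mem_insert_of_mem hj))

lemma natDegree_psi_monoA (hm : 1 ≤ m) (hv : GoodWeight v) (hf : fOf k m F ≠ 0)
    (hFg : F = rename Sum.inr (fOf k m F) + (∏ i, X (Sum.inl i)) * g) (hE : E.c = wcoeff v r F)
    (p : (Fin m → ℕ) × ℕ) {b : MvPolynomial (Fin 2) k} (hb : b ≠ 0) :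
    (E.psi (weightOf v r p) (monoA k r F p b)).natDegree
      = ∑ i, p.1 i * (E.psi (v i) (xA k m r F i)).natDegree
        + p.2 * (E.psi (-∑ i, r i * v i) (yA k m r F)).natDegree
        + (E.psi 0 (ztA k m r F b)).natDegree := by
  have h1 : HasLow v r F (∑ i, p.1 i * v i) (∏ i, xA k m r F i ^ p.1 i)
      (∏ i : Fin m, (1 : MvPolynomial (Fin 2) k) ^ p.1 i) :=
    HasLow.prod Finset.univ (fun i _ => (hasLow_x i).pow (p.1 i))
  have hy := hasLow_y (r := r) hm hv.pos hFg
  have h2 := hy.pow p.2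
  have h3 := hasLow_zt (v := v) (r := r) (F := F) b
  have hn1 : (∏ i : Fin m, (1 : MvPolynomial (Fin 2) k) ^ p.1 i) ≠ 0 := by simp
  have hn2 := pow_ne_zero p.2 hf
  have hw : weightOf v r p = ∑ i, p.1 i * v i + p.2 * (-∑ i, r i * v i) + 0 := by
    rw [weightOf, add_zero]
  rw [hw, monoA, (h1.mul h2).natDegree_mul hE h3 (mul_ne_zero hn1 hn2) hb,
    h1.natDegree_mul hE h2 hn1 hn2, hy.natDegree_pow hE,
    natDegree_psi_prod hE Finset.univ (fun i _ => (hasLow_x i).pow (p.1 i)) (by simp)]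
  congr 2
  exact Finset.sum_congr rfl fun i _ => (hasLow_x i).natDegree_pow hE _

/-- A factorially closed subalgebra over which everything is algebraic after adjoining `q`. -/
structure SliceData (k : Type) [Field k] (R₀ : Subalgebra k (MvPolynomial (Fin 2) k))
    (q : MvPolynomial (Fin 2) k) : Prop where
  closed : ∀ a b, a * b ≠ 0 → a * b ∈ R₀ → a ∈ R₀
  notMem : q ∉ R₀
  slice : ∀ ρ, ∃ c ∈ R₀, c ≠ 0 ∧ ∃ P : Polynomial (MvPolynomial (Fin 2) k),
    (∀ i, P.coeff i ∈ R₀) ∧ c * ρ = P.eval q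

/-- Elements of `k[Z,T]` of degree zero for the graded exponential map. -/
def degZero (E : FilteredExp (MvPolynomial (Fin 2) k) (RingA k m r F))
    (hE : E.c = wcoeff v r F) (hk : ∀ c : k, E.φ (algebraMap k _ c) = Polynomial.C (algebraMap k _ c)) :
    Subalgebra k (MvPolynomial (Fin 2) k) where
  carrier := {ρ | (E.psi 0 (ztA k m r F ρ)).natDegree = 0}
  mul_mem' := by
    intro a b ha hb
    have h : E.psi 0 (ztA k m r F (a * b))
        = E.psi 0 (ztA k m r F a) * E.psi 0 (ztA k m r F b) := by
      rw [map_mul, ← ((hasLow_zt (v := v) a).ge hE).psi_mul ((hasLow_zt (v := v) b).ge hE),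
        add_zero]
    change (E.psi 0 (ztA k m r F (a * b))).natDegree = 0
    change (E.psi 0 (ztA k m r F a)).natDegree = 0 at ha
    change (E.psi 0 (ztA k m r F b)).natDegree = 0 at hb
    rw [h]
    have := Polynomial.natDegree_mul_le (p := E.psi 0 (ztA k m r F a))
      (q := E.psi 0 (ztA k m r F b))
    omega
  add_mem' := by
    intro a b ha hb
    change (E.psi 0 (ztA k m r F (a + b))).natDegree = 0
    change (E.psi 0 (ztA k m r F a)).natDegree = 0 at ha
    change (E.psi 0 (ztA k m r F b)).natDegree = 0 at hb
    rw [map_add, FilteredExp.psi_add]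
    have := Polynomial.natDegree_add_le (E.psi 0 (ztA k m r F a)) (E.psi 0 (ztA k m r F b))
    omega
  algebraMap_mem' := by
    intro c
    change (E.psi 0 (ztA k m r F _)).natDegree = 0
    rw [AlgHom.commutes]
    exact FilteredExp.natDegree_psi_of_eq_C (hk c)

lemma mem_degZero {hE : E.c = wcoeff v r F}
    {hk : ∀ c : k, E.φ (algebraMap k _ c) = Polynomial.C (algebraMap k _ c)}
    {ρ : MvPolynomial (Fin 2) k} :
    ρ ∈ degZero E hE hk ↔ (E.psi 0 (ztA k m r F ρ)).natDegree = 0 := Iff.rfl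

/-- If `A` is a polynomial ring over `D` and some element of `D` is not a polynomial in
`x, z, t`, then `f` lies in (or is transcendental over) a ruling of `k[Z,T]`. -/
theorem exists_sliceData (hm : 1 ≤ m) (hr : ∀ i, 1 < r i) (hf : fOf k m F ≠ 0)
    (hFg : F = rename Sum.inr (fOf k m F) + (∏ i, X (Sum.inl i)) * g)
    {D : Type} [CommRing D] [Nontrivial D] [Algebra k D]
    (Φ : RingA k m r F ≃ₐ[k] Polynomial D) {h : RingA k m r F} {d : D}
    (hΦ : Φ h = Polynomial.C d) (hB : ∀ P, inclA k m r F P ≠ h) :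
    ∃ R₀ q, SliceData k R₀ q ∧ (fOf k m F ∈ R₀ ∨ fOf k m F = q) := by
  classical
  obtain ⟨N, hN, hNh⟩ := exists_normal_form h
  have hex : ∃ p ∈ N.support, 0 < p.2 := by
    by_contra hcon
    push Not at hcon
    refine hB (∑ p ∈ N.support, (∏ i, X (Sum.inl i) ^ p.1 i) * rename Sum.inr (N p)) ?_
    rw [← hNh, map_sum, evalA, Finsupp.sum]
    refine Finset.sum_congr rfl fun p hp => ?_
    rw [map_mul, inclA_rename, map_prod, monoA, Nat.le_zero.1 (hcon p hp), pow_zero, mul_one]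
    simp only [map_pow, inclA_X_inl]
  obtain ⟨p₁, hp₁, hp₁0⟩ := hex
  obtain ⟨i₁, hi₁⟩ := (hN p₁ hp₁).resolve_left hp₁0.ne'
  obtain ⟨v, hv, hneg⟩ := exists_goodWeight r p₁ hp₁0 i₁ hi₁
  obtain ⟨E, hE, hφ, hnt⟩ := exists_filteredExp hm hv hf hFg Φ
  have hk : ∀ c : k, E.φ (algebraMap k _ c) = Polynomial.C (algebraMap k _ c) := fun c => by
    rw [hφ]; exact phiA_eq_C Φ (d := algebraMap k D c) (Φ.commutes c)
  set dx : Fin m → ℕ := fun i => (E.psi (v i) (xA k m r F i)).natDegree with hdx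
  set dy := (E.psi (-∑ i, r i * v i) (yA k m r F)).natDegree with hdy
  set dR : MvPolynomial (Fin 2) k → ℕ := fun ρ => (E.psi 0 (ztA k m r F ρ)).natDegree with hdR
  have hmono : ∀ p {b : MvPolynomial (Fin 2) k}, b ≠ 0 →
      (E.psi (weightOf v r p) (monoA k r F p b)).natDegree
        = ∑ i, p.1 i * dx i + p.2 * dy + dR b :=
    fun p b hb => natDegree_psi_monoA hm hv hf hFg hE p hb
  -- the degree of `y` vanishes
  have hdy0 : dy = 0 := by
    have hN0 : N ≠ 0 := by rintro rfl; simp at hp₁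
    obtain ⟨p, hp, hmin, h1, h2⟩ := exists_lowest_term hm hv hf hFg hN hN0
    rw [hNh] at h2
    have h3 : (E.psi (weightOf v r p) h).natDegree = 0 :=
      FilteredExp.natDegree_psi_of_eq_C (by rw [hφ]; exact phiA_eq_C Φ hΦ)
    have h4 := hasLow_monoA (r := r) hm hv hFg p (N p)
    rw [(h2.ge hE).psi_congr (h4.ge hE) (by rw [h2.c_eq hE, h4.c_eq hE]),
      hmono p (Finsupp.mem_support_iff.1 hp)] at h3
    have hp2 : p.2 ≠ 0 := by
      intro h0
      have : 0 ≤ weightOf v r p := by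
        rw [weightOf, h0, Nat.cast_zero, zero_mul, add_zero]
        exact Finset.sum_nonneg fun i _ => mul_nonneg (Nat.cast_nonneg _) (hv.pos i).le
      linarith [hmin p₁ hp₁]
    have h5 : p.2 * dy = 0 := by omega
    exact (Nat.mul_eq_zero.1 h5).resolve_left hp2
  have hfdeg : dR (fOf k m F) = ∑ i, r i * dx i := by
    have h1 := hasLow_monoA (r := r) hm hv hFg (r, 1) 1
    have h0 : weightOf v r (r, 1) = 0 := by simp [weightOf]
    have h2 := hmono (r, 1) (b := 1) one_ne_zero
    have h3 := hasLow_zt (v := v) (r := r) (F := F) (fOf k m F)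
    rw [h0] at h1 h2
    rw [(h1.ge hE).psi_congr (h3.ge hE) (by rw [h1.c_eq hE, h3.c_eq hE]; simp)] at h2
    have h4 : dR 1 = 0 := by
      simp only [hdR, map_one]
      rw [natDegree_psi_one hE, Polynomial.natDegree_one]
    change dR (fOf k m F) = _ at h2
    rw [h2, h4, hdy0]; simp
  have hinv : ∀ {e γ}, γ ∈ E.Inv e → γ ≠ 0 → ∃ p b, weightOf v r p = e ∧ b ≠ 0 ∧
      γ = fOf k m F ^ p.2 * b ∧ dR b = 0 ∧ ∀ i, 0 < dx i → p.1 i = 0 := by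
    rintro e _ ⟨a, ha, rfl, hd⟩ hne
    obtain ⟨p, b, he, hb, hc, hpsi⟩ := exists_lead_monoA hm hv hf hFg hE ha hne
    rw [hpsi, ← he, hmono p hb] at hd
    refine ⟨p, b, he, hb, hc, by omega, fun i hi => ?_⟩
    have h1 : ∑ i, p.1 i * dx i = 0 := by omega
    have h2 := (Finset.sum_eq_zero_iff.1 h1) i (Finset.mem_univ _)
    exact (Nat.mul_eq_zero.1 h2).resolve_right hi.ne'
  have hclosed : ∀ a b, a * b ≠ 0 → a * b ∈ degZero E hE hk → a ∈ degZero E hE hk := by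
    intro a b hab h
    rw [mem_degZero, map_mul] at h
    have := (hasLow_zt (v := v) (r := r) (F := F) a).natDegree_mul hE
      (hasLow_zt (v := v) (r := r) (F := F) b) (left_ne_zero_of_mul hab)
      (right_ne_zero_of_mul hab)
    rw [add_zero, h] at this
    rw [mem_degZero]; omega
  -- the minimal positive degree
  have hP : ∃ n, 0 < n ∧ ∃ e a, E.Ge e a ∧ (E.psi e a).natDegree = n := by
    obtain ⟨e, a, ha, hd⟩ := hnt
    exact ⟨_, hd, e, a, ha, rfl⟩
  obtain ⟨hn, e, a, ha, had⟩ := Nat.find_spec hP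
  have hmin : ∀ e a, E.Ge e a → 0 < (E.psi e a).natDegree → Nat.find hP ≤ (E.psi e a).natDegree :=
    fun e a ha hd => Nat.find_min' hP ⟨hd, e, a, ha, rfl⟩
  set n := Nat.find hP with hndef
  have hc0 : E.c e a ≠ 0 := by
    intro h0
    rw [ha.psi_eq_zero h0] at had
    simp at had; omega
  obtain ⟨p, b, he, hb, -, hpsi⟩ := exists_lead_monoA hm hv hf hFg hE ha hc0
  rw [hpsi, ← he, hmono p hb, hdy0, mul_zero, add_zero] at had
  have hone := (hasLow_one (v := v) (r := r) (F := F)).ge hE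
  have hone1 := (hasLow_one (v := v) (r := r) (F := F)).c_eq hE
  by_cases hbz : 0 < dR b
  · -- the minimum is attained on `k[Z,T]`
    have hbn : dR b = n := by
      have := hmin 0 _ ((hasLow_zt (v := v) (r := r) (F := F) b).ge hE) hbz
      change n ≤ dR b at this
      omega
    have hW := (hasLow_zt (v := v) (r := r) (F := F) b).ge hE
    have hWc := (hasLow_zt (v := v) (r := r) (F := F) b).c_eq hE
    have hx0 : ∀ i, dx i = 0 := by
      intro i
      by_contra hxi
      have hxi := Nat.pos_of_ne_zero hxi
      obtain ⟨e', γ, hγ, hγ0, P, hP, hPe⟩ := FilteredExp.exists_slice_expansion hone hone1 hn hW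
        hbn hmin _ ((hasLow_x (v := v) (r := r) (F := F) i).ge hE) le_rfl
      rw [(hasLow_x (v := v) (r := r) (F := F) i).c_eq hE, mul_one] at hPe
      have hP0 : P ≠ 0 := by rintro rfl; rw [Polynomial.eval_zero] at hPe; exact hγ0 hPe
      obtain ⟨p, b, hpe, -, -, -, hp0⟩ := hinv hγ hγ0
      obtain ⟨p', b', hpe', -, -, -, hp0'⟩ := hinv (hP P.natDegree)
        (Polynomial.leadingCoeff_ne_zero.2 hP0)
      have h1 := weightOf_eq_add hv (p := p') (q := p) (n := 1) (i₀ := i) (r := r)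
        (by rw [hpe', hpe]; push_cast; ring)
      rw [hp0 i hxi, hp0' i hxi] at h1
      have h2 : (r i : ℤ) * (p.2 - p'.2) = 1 := by push_cast at h1; linarith
      have h3 := Int.eq_one_or_neg_one_of_mul_eq_one h2
      have := hr i
      omega
    have hfR : fOf k m F ∈ degZero E hE hk := by
      rw [mem_degZero]
      change dR _ = 0
      rw [hfdeg]; simp [hx0]
    have hInv : ∀ {e γ}, γ ∈ E.Inv e → γ ∈ degZero E hE hk := by
      intro e γ hγ
      by_cases h0 : γ = 0
      · rw [h0]; exact zero_mem _
      obtain ⟨p, b, -, -, rfl, hb, -⟩ := hinv hγ h0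
      exact mul_mem (pow_mem hfR _) hb
    refine ⟨degZero E hE hk, b, ⟨hclosed, ?_, ?_⟩, Or.inl hfR⟩
    · rw [mem_degZero]; exact hbz.ne'
    · intro ρ
      obtain ⟨e', γ, hγ, hγ0, P, hP, hPe⟩ := FilteredExp.exists_slice_expansion hone hone1 hn hW
        hbn hmin _ ((hasLow_zt (v := v) (r := r) (F := F) ρ).ge hE) le_rfl
      rw [(hasLow_zt (v := v) (r := r) (F := F) ρ).c_eq hE, hWc] at hPe
      exact ⟨γ, hInv hγ, hγ0, P, fun i => hInv (hP i), hPe⟩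
  · -- the minimum is attained at some `x i`
    have hsum : ∑ i, p.1 i * dx i = n := by omega
    obtain ⟨i, -, hi⟩ : ∃ i ∈ Finset.univ, p.1 i * dx i ≠ 0 := by
      by_contra hcon
      push Not at hcon
      rw [Finset.sum_eq_zero hcon] at hsum
      omega
    have hxpos : 0 < dx i := Nat.pos_of_ne_zero (right_ne_zero_of_mul hi)
    have hW := (hasLow_x (v := v) (r := r) (F := F) i).ge hE
    have hWc := (hasLow_x (v := v) (r := r) (F := F) i).c_eq hE
    have hxn : dx i = n := by
      have h1 := hmin _ _ hW hxpos
      change n ≤ dx i at h1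
      have h2 := Finset.single_le_sum (f := fun i => p.1 i * dx i) (fun i _ => Nat.zero_le _)
        (Finset.mem_univ i)
      have h3 : dx i ≤ p.1 i * dx i :=
        Nat.le_mul_of_pos_left _ (Nat.pos_of_ne_zero (left_ne_zero_of_mul hi))
      omega
    refine ⟨degZero E hE hk, fOf k m F, ⟨hclosed, ?_, ?_⟩, Or.inr rfl⟩
    · rw [mem_degZero]
      change dR _ ≠ 0
      rw [hfdeg]
      have h2 := Finset.single_le_sum (f := fun i => r i * dx i) (fun i _ => Nat.zero_le _)
        (Finset.mem_univ i)
      have h3 : 0 < r i * dx i := Nat.mul_pos (by have := hr i; omega) hxpos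
      omega
    · intro ρ
      obtain ⟨e', γ, hγ, hγ0, P, hP, hPe⟩ := FilteredExp.exists_slice_expansion hone hone1 hn hW
        hxn hmin _ ((hasLow_zt (v := v) (r := r) (F := F) ρ).ge hE) le_rfl
      rw [(hasLow_zt (v := v) (r := r) (F := F) ρ).c_eq hE, hWc] at hPe
      obtain ⟨p, b, hpe, hb0, hγe, hbR, hp0⟩ := hinv hγ hγ0
      have hcoef : ∀ j, ∃ s β, β ∈ degZero E hE hk ∧ P.coeff j = fOf k m F ^ (p.2 + s) * β := by
        intro j
        by_cases h0 : P.coeff j = 0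
        · exact ⟨0, 0, zero_mem _, by rw [h0, mul_zero]⟩
        obtain ⟨p', b', hpe', -, hbe', hbR', hp0'⟩ := hinv (hP j) h0
        have h1 := weightOf_eq_add hv (p := p') (q := p) (n := -j) (i₀ := i) (r := r)
          (by rw [hpe', hpe]; push_cast; ring)
        rw [hp0 i hxpos, hp0' i hxpos] at h1
        have h2 : p.2 ≤ p'.2 := by
          by_contra hlt
          push Not at hlt
          have h3 : ((p.2 : ℤ) - p'.2) * r i = -j := by push_cast at h1; linarith
          have h4 : (0 : ℤ) < ((p.2 : ℤ) - p'.2) * r i := by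
            apply mul_pos
            · omega
            · have := hr i; omega
          omega
        exact ⟨p'.2 - p.2, b', hbR', by rw [Nat.add_sub_cancel' h2, hbe']⟩
      choose s β hβ hcoef using hcoef
      refine ⟨b, hbR, hb0, ∑ j ∈ P.support, Polynomial.monomial (s j) (β j), ?_, ?_⟩
      · intro i
        rw [Polynomial.finsetSum_coeff]
        refine sum_mem fun j _ => ?_
        rw [Polynomial.coeff_monomial]
        split_ifs
        · exact hβ j
        · exact zero_mem _
      · have h1 : fOf k m F ^ p.2 * (b * ρ) = fOf k m F ^ p.2 *
            (∑ j ∈ P.support, Polynomial.monomial (s j) (β j)).eval (fOf k m F) := by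
          rw [← mul_assoc, ← hγe, hPe, Polynomial.eval_eq_sum, Polynomial.sum,
            Polynomial.eval_finsetSum, Finset.mul_sum]
          refine Finset.sum_congr rfl fun j _ => ?_
          rw [one_pow, mul_one, hcoef j, Polynomial.eval_monomial, pow_add]
          ring
        exact mul_left_cancel₀ (pow_ne_zero _ hf) h1

end

section
variable {k : Type} [Field k] {m : ℕ} {r : Fin m → ℕ} {F g : MvPolynomial (Fin m ⊕ Fin 2) k}

/-- The map eliminating `Y` by `Y = F / X^r`. -/
def fracHomBig (k : Type) [Field k] (m : ℕ) (r : Fin m → ℕ) (F : MvPolynomial (Fin m ⊕ Fin 2) k) :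
    BigP k m →ₐ[k] FractionRing (MvPolynomial (Fin m ⊕ Fin 2) k) :=
  aeval (Sum.elim
    (fun i => algebraMap (MvPolynomial (Fin m ⊕ Fin 2) k) _ (X (Sum.inl i)))
    ![algebraMap (MvPolynomial (Fin m ⊕ Fin 2) k) _ F /
      algebraMap (MvPolynomial (Fin m ⊕ Fin 2) k) _ (∏ i, X (Sum.inl i) ^ r i),
      algebraMap (MvPolynomial (Fin m ⊕ Fin 2) k) _ (X (Sum.inr 0)),
      algebraMap (MvPolynomial (Fin m ⊕ Fin 2) k) _ (X (Sum.inr 1))])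

lemma fracHomBig_incl (P : MvPolynomial (Fin m ⊕ Fin 2) k) :
    fracHomBig k m r F (incl k m P) = algebraMap _ _ P := by
  rw [← IsScalarTower.coe_toAlgHom' k, ← AlgHom.comp_apply]
  refine DFunLike.congr_fun (MvPolynomial.algHom_ext fun i => ?_) P
  rcases i with i | i
  · simp [incl, fracHomBig]
  · fin_cases i <;> simp [incl, fracHomBig]

lemma fracHomBig_relG : fracHomBig k m r F (relG k m r F) = 0 := by
  have hne : algebraMap (MvPolynomial (Fin m ⊕ Fin 2) k)
      (FractionRing (MvPolynomial (Fin m ⊕ Fin 2) k)) (∏ i, X (Sum.inl i) ^ r i) ≠ 0 := by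
    rw [Ne, IsFractionRing.to_map_eq_zero_iff, Finset.prod_eq_zero_iff]
    rintro ⟨i, -, hi⟩
    exact pow_ne_zero _ (X_ne_zero _) hi
  rw [relG, map_sub, fracHomBig_incl, fracHomBig, map_mul, aeval_X]
  simp only [map_prod, map_pow, aeval_X, Sum.elim_inl, Sum.elim_inr, Matrix.cons_val_zero] at hne ⊢
  rw [mul_div_cancel₀ _ hne, sub_self]

/-- Inverting `x^r` eliminates `y`. -/
def fracHom (k : Type) [Field k] (m : ℕ) (r : Fin m → ℕ) (F : MvPolynomial (Fin m ⊕ Fin 2) k) :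
    RingA k m r F →ₐ[k] FractionRing (MvPolynomial (Fin m ⊕ Fin 2) k) :=
  Ideal.Quotient.liftₐ _ (fracHomBig k m r F) (by
    intro a ha
    obtain ⟨b, rfl⟩ := Ideal.mem_span_singleton'.1 ha
    rw [map_mul, fracHomBig_relG, mul_zero])

lemma fracHom_inclA (P : MvPolynomial (Fin m ⊕ Fin 2) k) :
    fracHom k m r F (inclA k m r F P) = algebraMap _ _ P := fracHomBig_incl P

lemma inclA_injective : Function.Injective (inclA k m r F) := fun P Q h =>
  IsFractionRing.injective (MvPolynomial (Fin m ⊕ Fin 2) k)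
    (FractionRing (MvPolynomial (Fin m ⊕ Fin 2) k))
    (by rw [← fracHom_inclA (r := r) (F := F), h, fracHom_inclA])

lemma yA_notMem_range (hm : 1 ≤ m) (hr : ∀ i, 1 < r i) (hf : fOf k m F ≠ 0) :
    yA k m r F ∉ (inclA k m r F).range := by
  rintro ⟨P, hP⟩
  have h1 := xA_prod_mul_yA (k := k) (r := r) (F := F)
  simp only [← inclA_X_inl, ← map_pow, ← map_prod] at h1
  change inclA k m r F P = _ at hP
  rw [← hP, ← map_mul] at h1
  apply hf
  rw [fOf, ← inclA_injective h1, map_mul, map_prod,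
    Finset.prod_eq_zero (Finset.mem_univ (⟨0, hm⟩ : Fin m)), zero_mul]
  simp [(zero_lt_one.trans (hr _)).ne']

theorem exists_sliceData_of_algEquiv (hm : 1 ≤ m) (hr : ∀ i, 1 < r i) (hf : fOf k m F ≠ 0)
    (hFg : F = rename Sum.inr (fOf k m F) + (∏ i, X (Sum.inl i)) * g)
    (Ψ : RingA k m r F ≃ₐ[k] MvPolynomial (Fin (m + 2)) k) :
    ∃ R₀ q, SliceData k R₀ q ∧ (fOf k m F ∈ R₀ ∨ fOf k m F = q) := by
  obtain ⟨j, hj⟩ : ∃ j, Ψ.symm (X j) ∉ (inclA k m r F).range := by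
    by_contra! hcon
    apply yA_notMem_range hm hr hf
    have h1 : Algebra.adjoin k (Set.range X) ≤ 
        (inclA k m r F).range.comap (Ψ.symm : MvPolynomial (Fin (m + 2)) k →ₐ[k] RingA k m r F) :=
      Algebra.adjoin_le (by rintro _ ⟨j, rfl⟩; exact hcon j)
    rw [adjoin_range_X] at h1
    have h2 : Ψ.symm (Ψ (yA k m r F)) ∈ (inclA k m r F).range :=
      h1 (Algebra.mem_top (x := Ψ (yA k m r F)))
    rwa [AlgEquiv.symm_apply_apply] at h2
  obtain ⟨σ, l, hl⟩ : ∃ (σ : Equiv.Perm (Fin (m + 2))) (l : Fin (m + 1)), σ j = l.succ := by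
    refine Fin.cases ⟨Equiv.swap 0 1, 0, ?_⟩ (fun l => ⟨1, l, rfl⟩) j
    simp
  refine exists_sliceData hm hr hf hFg
    ((Ψ.trans (renameEquiv k σ)).trans (finSuccEquiv k (m + 1)))
    (h := Ψ.symm (X j)) (d := X l) ?_ (fun P hP => hj ⟨P, hP⟩)
  simp [hl, finSuccEquiv_X_succ]

end

lemma Polynomial.exists_eq_X_pow_mul {S : Type} [CommRing S] {P : Polynomial S} (hP : P ≠ 0) :
    ∃ n P', P = Polynomial.X ^ n * P' ∧ P'.coeff 0 ≠ 0 := by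
  obtain ⟨P', h1, h2⟩ := P.exists_eq_pow_rootMultiplicity_mul_and_not_dvd hP 0
  rw [Polynomial.C_0, sub_zero] at h1 h2
  exact ⟨_, P', h1, fun h => h2 (Polynomial.X_dvd_iff.2 h)⟩

namespace SliceData
variable {k : Type} [Field k] {R₀ : Subalgebra k (MvPolynomial (Fin 2) k)}
  {q : MvPolynomial (Fin 2) k}

lemma transcendental (hs : SliceData k R₀ q) : Transcendental R₀ q := by
  rintro ⟨P, hP, hPq⟩
  obtain ⟨n, P', hP', h0⟩ := Polynomial.exists_eq_X_pow_mul hP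
  have hq0 : q ≠ 0 := fun h => hs.notMem (h ▸ R₀.zero_mem)
  rw [hP', map_mul, map_pow, Polynomial.aeval_X, mul_eq_zero,
    or_iff_right (pow_ne_zero _ hq0), ← P'.divX_mul_X_add, map_add, map_mul, Polynomial.aeval_X,
    Polynomial.aeval_C, mul_comm, add_eq_zero_iff_eq_neg] at hPq
  refine hs.notMem (hs.closed _ _ (?_ : q * Polynomial.aeval q P'.divX ≠ 0) ?_)
  · rw [hPq, neg_ne_zero]
    exact fun h => h0 (Subtype.ext h)
  · rw [hPq]
    exact R₀.neg_mem (P'.coeff 0).2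

lemma exists_nonconstant (hs : SliceData k R₀ q) : ∃ p ∈ R₀, p.totalDegree ≠ 0 := by
  by_contra! hcon
  have halg : Algebra.IsAlgebraic (Algebra.adjoin k {q}) (MvPolynomial (Fin 2) k) := by
    refine ⟨fun ρ => ?_⟩
    obtain ⟨c, hc, hc0, P, hP, hPρ⟩ := hs.slice ρ
    have hmem : P.eval q ∈ Algebra.adjoin k {q} := by
      rw [Polynomial.eval_eq_sum_range]
      refine Subalgebra.sum_mem _ fun i _ => Subalgebra.mul_mem _ ?_
        (Subalgebra.pow_mem _ (Algebra.self_mem_adjoin_singleton k q) _)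
      rw [totalDegree_eq_zero_iff_eq_C.1 (hcon _ (hP i))]
      exact Subalgebra.algebraMap_mem _ _
    have hcmem : c ∈ Algebra.adjoin k {q} := by
      rw [totalDegree_eq_zero_iff_eq_C.1 (hcon _ hc)]
      exact Subalgebra.algebraMap_mem _ _
    refine ⟨Polynomial.C ⟨c, hcmem⟩ * Polynomial.X - Polynomial.C ⟨_, hmem⟩, fun h => ?_, ?_⟩
    · have := congrArg (fun P => Polynomial.coeff P 1) h
      simp [Polynomial.coeff_C] at this
      exact hc0 (congrArg Subtype.val this)
    · simp [hPρ, Algebra.algebraMap_eq_smul_one, Subalgebra.smul_def]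
  have h1 := Algebra.IsAlgebraic.trdeg_le_cardinalMk k ({q} : Set (MvPolynomial (Fin 2) k))
  rw [MvPolynomial.trdeg_of_isDomain] at h1
  simp at h1

lemma exists_dvd_aeval (hs : SliceData k R₀ q) {p h : MvPolynomial (Fin 2) k} (hp : p ∈ R₀)
    (hp0 : p ≠ 0) (hh : h ∈ R₀) : ∃ χ : Polynomial k, χ ≠ 0 ∧ p ∣ Polynomial.aeval h χ := by
  by_cases hh' : IsAlgebraic k h
  · obtain ⟨χ, h1, h2⟩ := hh'
    exact ⟨χ, h1, h2 ▸ dvd_zero p⟩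
  have h1 : AlgebraicIndependent k (fun _ : Unit => h) :=
    algebraicIndependent_unique_type_iff.2 hh'
  have h2 : IsAlgebraic (Algebra.adjoin k (Set.range fun _ : Unit => h)) p := by
    by_contra hcon
    have h2 := (h1.option_iff_transcendental p).2 hcon
    have hle : Algebra.adjoin k (Set.range fun o : Option Unit => o.elim p fun _ => h) ≤ R₀ := by
      refine Algebra.adjoin_le ?_
      rintro _ ⟨o, rfl⟩
      cases o
      exacts [hp, hh]
    have h3 : Transcendental (Algebra.adjoin k
        (Set.range fun o : Option Unit => o.elim p fun _ => h)) q := by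
      rintro ⟨P, hP, hPq⟩
      refine hs.transcendental ⟨P.map (Subalgebra.inclusion hle).toRingHom, ?_, ?_⟩
      · rwa [Ne, Polynomial.map_eq_zero_iff (Subalgebra.inclusion_injective hle)]
      · rw [Polynomial.aeval_def, Polynomial.eval₂_map]
        exact hPq
    have h4 := ((h2.option_iff_transcendental q).2 h3).lift_cardinalMk_le_trdeg
    rw [MvPolynomial.trdeg_of_isDomain] at h4
    simp at h4
    norm_cast at h4
  obtain ⟨P, hP, hPp⟩ := h2
  obtain ⟨n, P', hP', h0⟩ := Polynomial.exists_eq_X_pow_mul hP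
  rw [hP', map_mul, map_pow, Polynomial.aeval_X, mul_eq_zero,
    or_iff_right (pow_ne_zero _ hp0), ← P'.divX_mul_X_add, map_add, map_mul, Polynomial.aeval_X,
    Polynomial.aeval_C, mul_comm, add_eq_zero_iff_eq_neg'] at hPp
  obtain ⟨χ, hχ⟩ : ∃ χ : Polynomial k, Polynomial.aeval h χ = (P'.coeff 0 : MvPolynomial _ k) := by
    have h3 : ∀ x ∈ Algebra.adjoin k (Set.range fun _ : Unit => h),
        ∃ χ : Polynomial k, Polynomial.aeval h χ = x := by
      rw [Set.range_const, Algebra.adjoin_singleton_eq_range_aeval]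
      exact fun x hx => hx
    exact h3 _ (P'.coeff 0).2
  refine ⟨χ, ?_, ?_⟩
  · rintro rfl
    exact h0 (Subtype.ext (by rw [← hχ, map_zero]; rfl))
  · rw [hχ]
    change p ∣ algebraMap _ _ (P'.coeff 0)
    rw [hPp]
    exact (dvd_mul_right _ _).neg_right

end SliceData

lemma MvPolynomial.totalDegree_eq_zero_of_isUnit {σ K : Type} [Field K] {p : MvPolynomial σ K}
    (h : IsUnit p) : p.totalDegree = 0 := by
  obtain ⟨b, hb⟩ := h.exists_right_inv
  have hp : p ≠ 0 := h.ne_zero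
  have hb0 : b ≠ 0 := by rintro rfl; simp at hb
  have := totalDegree_mul_of_isDomain hp hb0
  rw [hb, totalDegree_one] at this
  omega

lemma MvPolynomial.isUnit_of_totalDegree_eq_zero {σ K : Type} [Field K] {p : MvPolynomial σ K}
    (h0 : p ≠ 0) (h : p.totalDegree = 0) : IsUnit p := by
  rw [totalDegree_eq_zero_iff_eq_C.1 h] at h0 ⊢
  exact (isUnit_iff_ne_zero.2 (by rintro h; simp [h] at h0)).map C

lemma MvPolynomial.totalDegree_sub_C {σ K : Type} [Field K] (p : MvPolynomial σ K) (a : K) :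
    (p - C a).totalDegree = p.totalDegree := by
  refine le_antisymm (by simpa using totalDegree_sub p (C a)) ?_
  have := totalDegree_add (p - C a) (C a)
  rw [sub_add_cancel] at this
  simpa using this

namespace SliceData
variable {k : Type} [Field k] {R₀ : Subalgebra k (MvPolynomial (Fin 2) k)}
  {q : MvPolynomial (Fin 2) k}

lemma exists_generator (hs : SliceData k R₀ q) :
    ∃ p ∈ R₀, p.totalDegree ≠ 0 ∧ ∀ h ∈ R₀, ∃ β : Polynomial k, Polynomial.aeval p β = h := by
  classical
  have hex : ∃ n, ∃ p ∈ R₀, p.totalDegree ≠ 0 ∧ p.totalDegree = n := by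
    obtain ⟨p, hp, hd⟩ := hs.exists_nonconstant
    exact ⟨_, p, hp, hd, rfl⟩
  obtain ⟨p', hp', hd', hn⟩ := Nat.find_spec hex
  have hC : ∀ a, C a ∈ R₀ := fun a => R₀.algebraMap_mem a
  obtain ⟨p, hpp⟩ : ∃ p, p = p' - C (constantCoeff p') := ⟨_, rfl⟩
  have hp : p ∈ R₀ := hpp ▸ R₀.sub_mem hp' (hC _)
  have hdeg : p.totalDegree = p'.totalDegree := by rw [hpp, totalDegree_sub_C]
  have hd : p.totalDegree ≠ 0 := hdeg ▸ hd'
  have hp00 : constantCoeff p = 0 := by simp [hpp]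
  have hmin : ∀ a ∈ R₀, a.totalDegree ≠ 0 → p.totalDegree ≤ a.totalDegree := by
    intro a ha h0
    rw [hdeg, hn]
    exact Nat.find_min' hex ⟨a, ha, h0, rfl⟩
  have hp0 : p ≠ 0 := by rintro h; simp [h] at hd
  have hirr : Irreducible p := by
    refine ⟨fun h => hd (totalDegree_eq_zero_of_isUnit h), fun a b hab => ?_⟩
    have ha0 : a ≠ 0 := by rintro rfl; simp at hab; exact hp0 hab
    have hb0 : b ≠ 0 := by rintro rfl; simp at hab; exact hp0 hab
    have ha : a ∈ R₀ := hs.closed a b (hab ▸ hp0) (hab ▸ hp)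
    have hb : b ∈ R₀ := hs.closed b a (by rw [mul_comm]; exact hab ▸ hp0)
      (by rw [mul_comm]; exact hab ▸ hp)
    have hsum := totalDegree_mul_of_isDomain ha0 hb0
    rw [← hab] at hsum
    by_contra hcon
    push Not at hcon
    have h1 := hmin a ha fun h => hcon.1 (isUnit_of_totalDegree_eq_zero ha0 h)
    have h2 := hmin b hb fun h => hcon.2 (isUnit_of_totalDegree_eq_zero hb0 h)
    omega
  have hprime : Prime p := hirr.prime
  refine ⟨p, hp, hd, ?_⟩
  have key : ∀ n, ∀ h ∈ R₀, h.totalDegree = n → ∃ β : Polynomial k, Polynomial.aeval p β = h := by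
    intro n
    induction n using Nat.strong_induction_on with
    | _ n ih =>
      intro h hh hn
      set l := constantCoeff h with hl
      by_cases h0 : h - C l = 0
      · refine ⟨Polynomial.C l, ?_⟩
        rw [Polynomial.aeval_C, algebraMap_eq, sub_eq_zero.1 h0]
      obtain ⟨χ, hχ, hdvd⟩ := hs.exists_dvd_aeval hp hp0 hh
      obtain ⟨χ', h1, h2⟩ := χ.exists_eq_pow_rootMultiplicity_mul_and_not_dvd hχ l
      rw [h1, map_mul, map_pow, map_sub, Polynomial.aeval_X, Polynomial.aeval_C] at hdvd
      rcases hprime.dvd_or_dvd hdvd with h3 | ⟨b, hb⟩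
      · obtain ⟨b, hb⟩ := hprime.dvd_of_dvd_pow h3
        rw [algebraMap_eq] at hb
        have hb0 : b ≠ 0 := by rintro rfl; rw [mul_zero] at hb; exact h0 hb
        have hbR : b ∈ R₀ := hs.closed b p (by rw [mul_comm, ← hb]; exact h0)
          (by rw [mul_comm, ← hb]; exact R₀.sub_mem hh (hC _))
        have hdb := totalDegree_mul_of_isDomain hp0 hb0
        rw [← hb, totalDegree_sub_C] at hdb
        obtain ⟨β, hβ⟩ := ih _ (by omega) b hbR rfl
        refine ⟨Polynomial.X * β + Polynomial.C l, ?_⟩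
        rw [map_add, map_mul, Polynomial.aeval_X, hβ, Polynomial.aeval_C, ← hb, algebraMap_eq,
          sub_add_cancel]
      · exfalso
        apply h2
        rw [Polynomial.dvd_iff_isRoot, Polynomial.IsRoot.def]
        have h4 := congrArg constantCoeff hb
        rw [map_mul, hp00, zero_mul, Polynomial.aeval_def, Polynomial.hom_eval₂, ← hl] at h4
        have h5 : (constantCoeff (σ := Fin 2)).comp (algebraMap k (MvPolynomial (Fin 2) k))
            = RingHom.id k := by ext; simp
        rw [h5] at h4
        simpa [Polynomial.eval₂_id] using h4
  exact fun h hh => key _ h hh rfl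

end SliceData

section
variable {K S : Type} [Field K] [CommRing S] [Algebra K S]

/-- Evaluation of polynomials in two variables at `(p, t)`. -/
def evalTwo (K : Type) {S : Type} [Field K] [CommRing S] [Algebra K S] (p t : S) :
    Polynomial (Polynomial K) →+* S :=
  Polynomial.eval₂RingHom (Polynomial.aeval p : Polynomial K →ₐ[K] S).toRingHom t

@[simp] lemma evalTwo_C (p t : S) (c : Polynomial K) :
    evalTwo K p t (Polynomial.C c) = Polynomial.aeval p c := Polynomial.eval₂_C _ _

@[simp] lemma evalTwo_X (p t : S) : evalTwo K p t Polynomial.X = t := Polynomial.eval₂_X _ _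

/-- `ρ` lies in `K(p)[t]`. -/
def InGeneric (K : Type) {S : Type} [Field K] [CommRing S] [Algebra K S] (p t ρ : S) : Prop :=
  ∃ c : Polynomial K, c ≠ 0 ∧ ∃ H, Polynomial.aeval p c * ρ = evalTwo K p t H

lemma InGeneric.add {p t ρ ρ' : S} (h : InGeneric K p t ρ) (h' : InGeneric K p t ρ') :
    InGeneric K p t (ρ + ρ') := by
  obtain ⟨c, hc, H, hH⟩ := h
  obtain ⟨c', hc', H', hH'⟩ := h'
  refine ⟨c * c', mul_ne_zero hc hc', Polynomial.C c' * H + Polynomial.C c * H', ?_⟩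
  rw [map_add, map_mul, map_mul, map_mul, ← hH, ← hH', evalTwo_C, evalTwo_C]
  ring

lemma InGeneric.mul {p t ρ ρ' : S} (h : InGeneric K p t ρ) (h' : InGeneric K p t ρ') :
    InGeneric K p t (ρ * ρ') := by
  obtain ⟨c, hc, H, hH⟩ := h
  obtain ⟨c', hc', H', hH'⟩ := h'
  refine ⟨c * c', mul_ne_zero hc hc', H * H', ?_⟩
  rw [map_mul, map_mul, ← hH, ← hH']
  ring

lemma inGeneric_algebraMap (p t : S) (a : K) : InGeneric K p t (algebraMap K S a) :=
  ⟨1, one_ne_zero, Polynomial.C (Polynomial.C a), by simp⟩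

lemma inGeneric_of_X {σ : Type} {p t : MvPolynomial σ K} (h : ∀ i, InGeneric K p t (X i))
    (ρ : MvPolynomial σ K) : InGeneric K p t ρ :=
  MvPolynomial.induction_on ρ (fun a => inGeneric_algebraMap p t a) (fun _ _ => .add)
    fun _ i hp => hp.mul (h i)

lemma transcendental_of_totalDegree {σ : Type} {p : MvPolynomial σ K} (hp : p.totalDegree ≠ 0) :
    Transcendental K p := by
  rintro ⟨c, hc, hcp⟩
  have hp0 : p ≠ 0 := by rintro rfl; simp at hp
  obtain ⟨n, c', rfl, h0⟩ := Polynomial.exists_eq_X_pow_mul hc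
  rw [map_mul, map_pow, Polynomial.aeval_X, mul_eq_zero, or_iff_right (pow_ne_zero _ hp0),
    ← c'.divX_mul_X_add, map_add, map_mul, Polynomial.aeval_X, Polynomial.aeval_C, mul_comm,
    add_eq_zero_iff_eq_neg'] at hcp
  apply hp
  refine totalDegree_eq_zero_of_isUnit (isUnit_of_dvd_unit (?_ : p ∣ C (c'.coeff 0))
    ((isUnit_iff_ne_zero.2 h0).map C))
  rw [← algebraMap_eq, hcp]
  exact (dvd_mul_right _ _).neg_right

lemma evalTwo_injective {p t : MvPolynomial (Fin 2) K} (hp : p.totalDegree ≠ 0)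
    (h : ∀ ρ, InGeneric K p t ρ) : Function.Injective (evalTwo K p t) := by
  have htr := transcendental_of_totalDegree hp
  let x : Option Unit → MvPolynomial (Fin 2) K := fun o => o.elim t fun _ => p
  have hev : ∀ H, evalTwo K p t H ∈ Algebra.adjoin K (Set.range x) := by
    intro H
    have ht : t ∈ Algebra.adjoin K (Set.range x) := Algebra.subset_adjoin ⟨none, rfl⟩
    have hp : p ∈ Algebra.adjoin K (Set.range x) := Algebra.subset_adjoin ⟨some (), rfl⟩
    induction H using Polynomial.induction_on' with
    | add a b ha hb => rw [map_add]; exact add_mem ha hb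
    | monomial n a =>
      rw [← Polynomial.C_mul_X_pow_eq_monomial, map_mul, map_pow, evalTwo_C, evalTwo_X]
      exact mul_mem (Polynomial.aeval_mem_adjoin_singleton K p |> fun h =>
        Algebra.adjoin_mono (by rintro _ rfl; exact ⟨some (), rfl⟩) h) (pow_mem ht n)
  have halg : Algebra.IsAlgebraic (Algebra.adjoin K (Set.range x)) (MvPolynomial (Fin 2) K) := by
    refine ⟨fun ρ => ?_⟩
    obtain ⟨c, hc, H, hH⟩ := h ρ
    have hc' := hev (Polynomial.C c)
    rw [evalTwo_C] at hc'
    refine ⟨Polynomial.C ⟨_, hc'⟩ * Polynomial.X - Polynomial.C ⟨_, hev H⟩, fun h => ?_, ?_⟩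
    · have := congrArg (fun P => Polynomial.coeff P 1) h
      simp [Polynomial.coeff_C] at this
      exact htr ⟨c, hc, congrArg Subtype.val this⟩
    · simp [hH, Algebra.algebraMap_eq_smul_one, Subalgebra.smul_def]
  have hb := Algebra.IsAlgebraic.isTranscendenceBasis_of_lift_le_trdeg_of_finite K x (by
    rw [MvPolynomial.trdeg_of_isDomain]; simp)
  have h1 : AlgebraicIndependent K (fun _ : Unit => p) :=
    algebraicIndependent_unique_type_iff.2 htr
  have h2 := (h1.option_iff_transcendental t).1 hb.1
  rw [injective_iff_map_eq_zero]
  intro H hH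
  by_contra hH0
  let φ : Polynomial K →ₐ[K] Algebra.adjoin K (Set.range fun _ : Unit => p) :=
    Polynomial.aeval ⟨p, Algebra.subset_adjoin ⟨(), rfl⟩⟩
  have hφ : ∀ c, (φ c : MvPolynomial (Fin 2) K) = Polynomial.aeval p c := fun c =>
    (Polynomial.aeval_algHom_apply (Subalgebra.val _) _ c).symm
  have hφi : Function.Injective φ := by
    rw [injective_iff_map_eq_zero]
    intro c hc
    by_contra hc0
    exact htr ⟨c, hc0, by rw [← hφ, hc]; rfl⟩
  refine h2 ⟨H.map φ.toRingHom, ?_, ?_⟩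
  · rwa [Ne, Polynomial.map_eq_zero_iff hφi]
  · rw [Polynomial.aeval_def, Polynomial.eval₂_map, ← hH, evalTwo, Polynomial.coe_eval₂RingHom]
    congr 1
    exact RingHom.ext hφ

end

section
variable {K : Type} [Field K] {p t : MvPolynomial (Fin 2) K}

lemma X_sub_C_dvd_of_dvd_aeval {l : K} (hu : ¬ IsUnit (p - C l)) {A : Polynomial K}
    (h : p - C l ∣ Polynomial.aeval p A) : Polynomial.X - Polynomial.C l ∣ A := by
  rw [Polynomial.dvd_iff_isRoot, Polynomial.IsRoot.def]
  obtain ⟨B, hB⟩ := Polynomial.X_sub_C_dvd_sub_C_eval (a := l) (p := A)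
  have h1 := congrArg (Polynomial.aeval p) hB
  rw [map_sub, map_mul, map_sub, Polynomial.aeval_X, Polynomial.aeval_C, Polynomial.aeval_C,
    algebraMap_eq] at h1
  by_contra h0
  refine hu (isUnit_of_dvd_unit (?_ : p - C l ∣ C (A.eval l)) ((isUnit_iff_ne_zero.2 h0).map C))
  rw [← sub_sub_cancel (Polynomial.aeval p A) (C (A.eval l)), h1]
  exact dvd_sub h (dvd_mul_right _ _)

lemma sub_C_ne_zero (hp : p.totalDegree ≠ 0) (l : K) : p - C l ≠ 0 := fun h =>
  hp (by rw [sub_eq_zero.1 h, totalDegree_C])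

lemma not_isUnit_sub_C (hp : p.totalDegree ≠ 0) (l : K) : ¬ IsUnit (p - C l) := fun h =>
  hp (by rw [← totalDegree_sub_C p l, totalDegree_eq_zero_of_isUnit h])

variable [IsAlgClosed K]

lemma exists_aeval_eq_of_mul (hp : p.totalDegree ≠ 0) (n : ℕ) :
    ∀ (c A : Polynomial K) (a : MvPolynomial (Fin 2) K), c.natDegree = n → c ≠ 0 →
      Polynomial.aeval p c * a = Polynomial.aeval p A → ∃ A' : Polynomial K, Polynomial.aeval p A' = a := by
  induction n with
  | zero =>
    intro c A a hn hc h
    obtain ⟨s, rfl⟩ := Polynomial.natDegree_eq_zero.1 hn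
    have hs : s ≠ 0 := by rintro rfl; simp at hc
    refine ⟨Polynomial.C s⁻¹ * A, ?_⟩
    rw [map_mul, ← h, ← mul_assoc, ← map_mul, ← map_mul, inv_mul_cancel₀ hs]
    simp
  | succ n ih =>
    intro c A a hn hc h
    obtain ⟨l, hl⟩ := IsAlgClosed.exists_root c (by
      rw [Polynomial.degree_eq_natDegree hc, hn]; exact_mod_cast n.succ_ne_zero)
    obtain ⟨c', rfl⟩ := Polynomial.dvd_iff_isRoot.2 hl
    have hc' : c' ≠ 0 := right_ne_zero_of_mul hc
    rw [Polynomial.natDegree_mul (Polynomial.X_sub_C_ne_zero l) hc', Polynomial.natDegree_X_sub_C]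
      at hn
    rw [map_mul, map_sub, Polynomial.aeval_X, Polynomial.aeval_C, algebraMap_eq, mul_assoc] at h
    obtain ⟨A', rfl⟩ := X_sub_C_dvd_of_dvd_aeval (not_isUnit_sub_C hp l) ⟨_, h.symm⟩
    rw [map_mul, map_sub, Polynomial.aeval_X, Polynomial.aeval_C, algebraMap_eq] at h
    exact ih c' A' a (by omega) hc' (mul_left_cancel₀ (sub_C_ne_zero hp l) h)

lemma prime_sub_C (hp : p.totalDegree ≠ 0) (h : ∀ ρ, InGeneric K p t ρ) (l : K) :
    Prime (p - C l) := by
  have hinj := evalTwo_injective hp h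
  have hinj' : Function.Injective (Polynomial.aeval p : Polynomial K → MvPolynomial (Fin 2) K) := by
    intro a b hab
    have : evalTwo K p t (Polynomial.C a) = evalTwo K p t (Polynomial.C b) := by simpa using hab
    exact Polynomial.C_injective (hinj this)
  have key : ∀ a b, a * b = p - C l → ∃ A : Polynomial K, Polynomial.aeval p A = a := by
    intro a b hab
    obtain ⟨c, hc, H, hH⟩ := h a
    obtain ⟨c', hc', H', hH'⟩ := h b
    have hmul : H * H' = Polynomial.C (c * c' * (Polynomial.X - Polynomial.C l)) := by
      apply hinj
      rw [map_mul, ← hH, ← hH', evalTwo_C, map_mul, map_mul, map_sub, Polynomial.aeval_X,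
        Polynomial.aeval_C, algebraMap_eq, ← hab]
      ring
    have hne : c * c' * (Polynomial.X - Polynomial.C l) ≠ 0 :=
      mul_ne_zero (mul_ne_zero hc hc') (Polynomial.X_sub_C_ne_zero l)
    have hH0 : H * H' ≠ 0 := by
      rw [hmul]; exact (map_ne_zero_iff _ Polynomial.C_injective).2 hne
    have hdeg := congrArg Polynomial.natDegree hmul
    rw [Polynomial.natDegree_C, Polynomial.natDegree_mul (left_ne_zero_of_mul hH0)
      (right_ne_zero_of_mul hH0)] at hdeg
    obtain ⟨A, rfl⟩ := Polynomial.natDegree_eq_zero.1 (show H.natDegree = 0 by omega)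
    rw [evalTwo_C] at hH
    exact exists_aeval_eq_of_mul hp _ c A a rfl hc hH
  refine Irreducible.prime ⟨not_isUnit_sub_C hp l, fun a b hab => ?_⟩
  obtain ⟨A, rfl⟩ := key a b hab.symm
  obtain ⟨B, rfl⟩ := key b _ (by rw [mul_comm, ← hab])
  have h1 : Polynomial.X - Polynomial.C l = A * B := by
    apply hinj'
    rw [map_mul, ← hab, map_sub, Polynomial.aeval_X, Polynomial.aeval_C, algebraMap_eq]
  exact ((Polynomial.irreducible_X_sub_C l).isUnit_or_isUnit h1).imp
    (fun h => h.map (Polynomial.aeval p)) (fun h => h.map (Polynomial.aeval p))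

lemma exists_sub_C_dvd (l : K) (hpr : Prime (p - C l)) (n : ℕ) :
    ∀ c : Polynomial K, c.natDegree = n → c ≠ 0 → p - C l ∣ Polynomial.aeval t c →
      ∃ μ, p - C l ∣ t - C μ := by
  induction n with
  | zero =>
    intro c hn hc h
    obtain ⟨s, rfl⟩ := Polynomial.natDegree_eq_zero.1 hn
    have hs : s ≠ 0 := by rintro rfl; simp at hc
    rw [Polynomial.aeval_C, algebraMap_eq] at h
    exact absurd (isUnit_of_dvd_unit h ((isUnit_iff_ne_zero.2 hs).map C)) hpr.not_isUnit
  | succ n ih =>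
    intro c hn hc h
    obtain ⟨μ, hl⟩ := IsAlgClosed.exists_root c (by
      rw [Polynomial.degree_eq_natDegree hc, hn]; exact_mod_cast n.succ_ne_zero)
    obtain ⟨c', rfl⟩ := Polynomial.dvd_iff_isRoot.2 hl
    have hc' : c' ≠ 0 := right_ne_zero_of_mul hc
    rw [Polynomial.natDegree_mul (Polynomial.X_sub_C_ne_zero μ) hc', Polynomial.natDegree_X_sub_C]
      at hn
    rw [map_mul, map_sub, Polynomial.aeval_X, Polynomial.aeval_C, algebraMap_eq] at h
    rcases hpr.dvd_or_dvd h with h1 | h1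
    · exact ⟨μ, h1⟩
    · exact ih c' (by omega) hc' h1

/-- If `p`, `t` generate `K[Z,T]` generically and no fibre of `p` can be split off `t`, they
generate. -/
theorem exists_evalTwo_eq (hp : p.totalDegree ≠ 0) (h : ∀ ρ, InGeneric K p t ρ)
    (hmin : ∀ l μ, ¬ p - C l ∣ t - C μ) (n : ℕ) :
    ∀ (c : Polynomial K) (H : Polynomial (Polynomial K)) (ρ : MvPolynomial (Fin 2) K),
      c.natDegree = n → c ≠ 0 → Polynomial.aeval p c * ρ = evalTwo K p t H →
      ∃ H', evalTwo K p t H' = ρ := by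
  induction n with
  | zero =>
    intro c H ρ hn hc h
    obtain ⟨s, rfl⟩ := Polynomial.natDegree_eq_zero.1 hn
    have hs : s ≠ 0 := by rintro rfl; simp at hc
    refine ⟨Polynomial.C (Polynomial.C s⁻¹) * H, ?_⟩
    rw [map_mul, ← h, ← mul_assoc, evalTwo_C, ← map_mul, ← map_mul, inv_mul_cancel₀ hs]
    simp
  | succ n ih =>
    intro c H ρ hn hc hH
    obtain ⟨l, hl⟩ := IsAlgClosed.exists_root c (by
      rw [Polynomial.degree_eq_natDegree hc, hn]; exact_mod_cast n.succ_ne_zero)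
    obtain ⟨c', rfl⟩ := Polynomial.dvd_iff_isRoot.2 hl
    have hc' : c' ≠ 0 := right_ne_zero_of_mul hc
    rw [Polynomial.natDegree_mul (Polynomial.X_sub_C_ne_zero l) hc', Polynomial.natDegree_X_sub_C]
      at hn
    rw [map_mul, map_sub, Polynomial.aeval_X, Polynomial.aeval_C, algebraMap_eq, mul_assoc] at hH
    have hdvd : Polynomial.C (Polynomial.X - Polynomial.C l) ∣ H -
        (H.map (Polynomial.evalRingHom l)).map Polynomial.C := by
      rw [Polynomial.C_dvd_iff_dvd_coeff]
      intro i
      rw [Polynomial.coeff_sub, Polynomial.coeff_map, Polynomial.coeff_map]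
      exact Polynomial.X_sub_C_dvd_sub_C_eval
    obtain ⟨H', hH'⟩ := hdvd
    have hev : evalTwo K p t ((H.map (Polynomial.evalRingHom l)).map Polynomial.C)
        = Polynomial.aeval t (H.map (Polynomial.evalRingHom l)) := by
      rw [evalTwo, Polynomial.coe_eval₂RingHom, Polynomial.eval₂_map, Polynomial.aeval_def]
      congr 1
      ext x
      simp
    by_cases h0 : H.map (Polynomial.evalRingHom l) = 0
    · rw [h0, Polynomial.map_zero, sub_zero] at hH'
      rw [hH', map_mul, evalTwo_C, map_sub, Polynomial.aeval_X, Polynomial.aeval_C,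
        algebraMap_eq] at hH
      exact ih c' H' ρ (by omega) hc' (mul_left_cancel₀ (sub_C_ne_zero hp l) hH)
    · exfalso
      obtain ⟨μ, hμ⟩ := exists_sub_C_dvd (t := t) l (prime_sub_C hp h l) _ _ rfl h0 (by
        rw [← hev, ← sub_sub_cancel H (Polynomial.map _ _), hH', map_sub, ← hH, map_mul,
          evalTwo_C, map_sub, Polynomial.aeval_X, Polynomial.aeval_C, algebraMap_eq]
        exact dvd_sub (dvd_mul_right _ _) (dvd_mul_right _ _))
      exact hmin l μ hμ

end

section
variable {k K σ : Type} [Field k] [Field K] [Algebra k K]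

/-- Apply a linear form to the coefficients. -/
def coeffForm (ε : K →ₗ[k] k) : MvPolynomial σ K →+ MvPolynomial σ k where
  toFun := AddMonoidAlgebra.map ε.toAddMonoidHom
  map_zero' := AddMonoidAlgebra.map_zero _
  map_add' := AddMonoidAlgebra.map_add _

lemma coeff_coeffForm (ε : K →ₗ[k] k) (P : MvPolynomial σ K) (s : σ →₀ ℕ) :
    coeff s (coeffForm ε P) = ε (coeff s P) := rfl

lemma coeffForm_map_mul (ε : K →ₗ[k] k) (a : MvPolynomial σ k) (P : MvPolynomial σ K) :
    coeffForm ε (map (algebraMap k K) a * P) = a * coeffForm ε P := by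
  classical
  ext s
  rw [coeff_coeffForm, coeff_mul, coeff_mul, map_sum]
  refine Finset.sum_congr rfl fun x _ => ?_
  rw [coeff_map, ← Algebra.smul_def, map_smul, smul_eq_mul, coeff_coeffForm]

lemma coeffForm_C (ε : K →ₗ[k] k) (a : K) : coeffForm ε (C a : MvPolynomial σ K) = C (ε a) := by
  classical
  ext s
  rw [coeff_coeffForm, coeff_C, coeff_C]
  split_ifs <;> simp

lemma coeffForm_map {ε : K →ₗ[k] k} (hε : ε 1 = 1) (a : MvPolynomial σ k) :
    coeffForm ε (map (algebraMap k K) a) = a := by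
  have := coeffForm_map_mul ε a 1
  rwa [mul_one, ← C_1, coeffForm_C, hε, C_1, mul_one] at this

lemma totalDegree_coeffForm_le (ε : K →ₗ[k] k) (P : MvPolynomial σ K) :
    (coeffForm ε P).totalDegree ≤ P.totalDegree := by
  refine Finset.sup_mono fun s hs => ?_
  rw [mem_support_iff, coeff_coeffForm] at hs
  rw [mem_support_iff]
  intro h
  rw [h, map_zero] at hs
  exact hs rfl

/-- Apply a linear form to the coefficients. -/
def polyForm (ε : K →ₗ[k] k) : Polynomial K →+ Polynomial k where
  toFun P := ⟨AddMonoidAlgebra.map ε.toAddMonoidHom P.toFinsupp⟩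
  map_zero' := by ext; simp
  map_add' _ _ := by ext; simp

lemma coeff_polyForm (ε : K →ₗ[k] k) (P : Polynomial K) (i : ℕ) :
    (polyForm ε P).coeff i = ε (P.coeff i) := rfl

lemma polyForm_monomial (ε : K →ₗ[k] k) (n : ℕ) (a : K) :
    polyForm ε (Polynomial.monomial n a) = Polynomial.monomial n (ε a) := by
  ext i
  rw [coeff_polyForm, Polynomial.coeff_monomial, Polynomial.coeff_monomial]
  split_ifs <;> simp

lemma coeffForm_aeval (ε : K →ₗ[k] k) (p : MvPolynomial σ k) (U : Polynomial K) :
    coeffForm ε (Polynomial.aeval (map (algebraMap k K) p) U)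
      = Polynomial.aeval p (polyForm ε U) := by
  induction U using Polynomial.induction_on' with
  | add a b ha hb => simp only [map_add, ha, hb]
  | monomial n a =>
    rw [polyForm_monomial, Polynomial.aeval_monomial, Polynomial.aeval_monomial, mul_comm,
      ← map_pow, algebraMap_eq, coeffForm_map_mul, coeffForm_C, mul_comm, algebraMap_eq]

lemma exists_evalTwo_eq_coeffForm (ε : K →ₗ[k] k) (p t : MvPolynomial σ k)
    (H : Polynomial (Polynomial K)) :
    ∃ H', evalTwo k p t H' =
      coeffForm ε (evalTwo K (map (algebraMap k K) p) (map (algebraMap k K) t) H) := by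
  induction H using Polynomial.induction_on' with
  | add a b ha hb =>
    obtain ⟨a', ha'⟩ := ha
    obtain ⟨b', hb'⟩ := hb
    exact ⟨a' + b', by simp only [map_add, ha', hb']⟩
  | monomial n a =>
    refine ⟨Polynomial.monomial n (polyForm ε a), ?_⟩
    rw [← Polynomial.C_mul_X_pow_eq_monomial, ← Polynomial.C_mul_X_pow_eq_monomial, map_mul,
      map_mul, evalTwo_C, evalTwo_C, map_pow, map_pow, evalTwo_X, evalTwo_X, ← map_pow,
      mul_comm (Polynomial.aeval _ a), coeffForm_map_mul, coeffForm_aeval, mul_comm]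

lemma polyAeval_map (p : MvPolynomial σ k) (c : Polynomial k) :
    Polynomial.aeval (map (algebraMap k K) p) (c.map (algebraMap k K))
      = map (algebraMap k K) (Polynomial.aeval p c) := by
  rw [Polynomial.aeval_def, Polynomial.eval₂_map, Polynomial.aeval_def, Polynomial.hom_eval₂]
  congr 1
  ext x : 1
  simp [algebraMap_eq]

lemma evalTwo_map_algebraMap (p t : MvPolynomial σ k) (H : Polynomial (Polynomial k)) :
    evalTwo K (map (algebraMap k K) p) (map (algebraMap k K) t)
      (H.map (Polynomial.mapRingHom (algebraMap k K))) = map (algebraMap k K) (evalTwo k p t H) := by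
  rw [evalTwo, Polynomial.coe_eval₂RingHom, Polynomial.eval₂_map, evalTwo,
    Polynomial.coe_eval₂RingHom, Polynomial.hom_eval₂]
  congr 1
  refine RingHom.ext fun c => ?_
  exact polyAeval_map p c

lemma InGeneric.map {p t ρ : MvPolynomial σ k} (h : InGeneric k p t ρ) :
    InGeneric K (MvPolynomial.map (algebraMap k K) p) (MvPolynomial.map (algebraMap k K) t)
      (MvPolynomial.map (algebraMap k K) ρ) := by
  obtain ⟨c, hc, H, hH⟩ := h
  refine ⟨c.map (algebraMap k K), (Polynomial.map_ne_zero_iff (algebraMap k K).injective).2 hc,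
    H.map (Polynomial.mapRingHom (algebraMap k K)), ?_⟩
  rw [polyAeval_map, evalTwo_map_algebraMap, ← map_mul, hH]

end

lemma MvPolynomial.exists_algEquiv_of_adjoin_eq_top {k ι : Type} [Field k] [Finite ι]
    {x : ι → MvPolynomial ι k} (h : Algebra.adjoin k (Set.range x) = ⊤) :
    ∃ σ : MvPolynomial ι k ≃ₐ[k] MvPolynomial ι k, ∀ i, σ (X i) = x i := by
  have halg : Algebra.IsAlgebraic (Algebra.adjoin k (Set.range x)) (MvPolynomial ι k) := by
    refine ⟨fun ρ => ?_⟩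
    exact isAlgebraic_algebraMap
      (⟨ρ, h ▸ Algebra.mem_top⟩ : Algebra.adjoin k (Set.range x))
  have hb := Algebra.IsAlgebraic.isTranscendenceBasis_of_lift_le_trdeg_of_finite k x (by
    rw [MvPolynomial.trdeg_of_isDomain]; simp)
  refine ⟨AlgEquiv.ofBijective (aeval x) ⟨hb.1, ?_⟩, fun i => aeval_X _ _⟩
  rw [← AlgHom.range_eq_top, ← h, Algebra.adjoin_range_eq_range_aeval]

namespace SliceData
variable {k : Type} [Field k] {R₀ : Subalgebra k (MvPolynomial (Fin 2) k)}
  {q : MvPolynomial (Fin 2) k}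

/-- `R₀` is generated by a coordinate, and `q` is affine in the other coordinate. -/
theorem exists_coordinates (hs : SliceData k R₀ q) :
    ∃ σ : MvPolynomial (Fin 2) k ≃ₐ[k] MvPolynomial (Fin 2) k,
      (∀ h ∈ R₀, ∃ β : Polynomial k, σ (Polynomial.aeval (X 0) β) = h) ∧
      ∃ α β : Polynomial k, σ (Polynomial.aeval (X 0) α * X 1 + Polynomial.aeval (X 0) β) = q := by
  classical
  obtain ⟨p, hpR, hp, hgen⟩ := hs.exists_generator
  have htr := transcendental_of_totalDegree hp
  have hpmem : ∀ c : Polynomial k, Polynomial.aeval p c ∈ R₀ := fun c =>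
    Algebra.adjoin_le (Set.singleton_subset_iff.2 hpR)
      (Polynomial.aeval_mem_adjoin_singleton k p)
  have hpne : ∀ c : Polynomial k, c ≠ 0 → Polynomial.aeval p c ≠ 0 := fun c hc h => htr ⟨c, hc, h⟩
  have hq0 : q ≠ 0 := fun h => hs.notMem (h ▸ R₀.zero_mem)
  have hin : ∀ (t : MvPolynomial (Fin 2) k) (c : Polynomial k),
      InGeneric k p t (Polynomial.aeval p c) := fun t c =>
    ⟨1, one_ne_zero, Polynomial.C c, by simp⟩
  have hcancel : ∀ (t ρ : MvPolynomial (Fin 2) k) (c : Polynomial k), c ≠ 0 →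
      InGeneric k p t (Polynomial.aeval p c * ρ) → InGeneric k p t ρ := by
    rintro t ρ c hc ⟨c', hc', H, hH⟩
    exact ⟨c' * c, mul_ne_zero hc' hc, H, by rw [map_mul, mul_assoc, hH]⟩
  have hint : ∀ t : MvPolynomial (Fin 2) k, InGeneric k p t t := fun t =>
    ⟨1, one_ne_zero, Polynomial.X, by simp⟩
  -- elements of `k(p) q + k(p)`
  let M : MvPolynomial (Fin 2) k → Prop := fun a => ∃ N γ δ : Polynomial k, N ≠ 0 ∧ γ ≠ 0 ∧
    Polynomial.aeval p N * a = Polynomial.aeval p γ * q + Polynomial.aeval p δ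
  have hMdeg : ∀ a, M a → a.totalDegree ≠ 0 := by
    rintro a ⟨N, γ, δ, hN, hγ, h⟩ h0
    rw [totalDegree_eq_zero_iff_eq_C] at h0
    refine hs.notMem (hs.closed q (Polynomial.aeval p γ) (mul_ne_zero hq0 (hpne _ hγ)) ?_)
    rw [mul_comm, eq_sub_of_add_eq h.symm, h0]
    exact R₀.sub_mem (R₀.mul_mem (hpmem _) (R₀.algebraMap_mem _)) (hpmem _)
  have hex : ∃ n, ∃ a, M a ∧ a.totalDegree = n :=
    ⟨_, q, ⟨1, 1, 0, one_ne_zero, one_ne_zero, by simp⟩, rfl⟩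
  obtain ⟨t, ⟨N, γ, δ, hN, hγ, hNt⟩, htdeg⟩ := Nat.find_spec hex
  have hmin : ∀ a, M a → t.totalDegree ≤ a.totalDegree := fun a ha =>
    htdeg ▸ Nat.find_min' hex ⟨a, ha, rfl⟩
  have ht0 : t.totalDegree ≠ 0 := hMdeg t ⟨N, γ, δ, hN, hγ, hNt⟩
  have hqt : InGeneric k p t q := by
    refine hcancel t q γ hγ ?_
    rw [eq_sub_of_add_eq hNt.symm, sub_eq_add_neg, ← map_neg]
    exact ((hin t N).mul (hint t)).add (hin t _)
  have hqpow : ∀ i : ℕ, InGeneric k p t (q ^ i) := by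
    intro i
    induction i with
    | zero => simpa using hin t 1
    | succ i ih => rw [pow_succ]; exact ih.mul hqt
  have hall : ∀ ρ, InGeneric k p t ρ := by
    intro ρ
    obtain ⟨c, hc, hc0, P, hP, hPρ⟩ := hs.slice ρ
    obtain ⟨c, rfl⟩ := hgen c hc
    refine hcancel t ρ c (by rintro rfl; simp at hc0) ?_
    rw [hPρ, Polynomial.eval_eq_sum_range]
    refine Finset.sum_induction _ (InGeneric k p t) (fun _ _ => .add)
      (by simpa using hin t 0) fun i _ => ?_
    obtain ⟨b, hb⟩ := hgen _ (hP i)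
    rw [← hb]
    exact (hin t b).mul (hqpow i)
  have hinj := evalTwo_injective hp hall
  let K := AlgebraicClosure k
  obtain ⟨ε, hε⟩ : ∃ ε : K →ₗ[k] k, ε 1 = 1 := by
    obtain ⟨ε, h⟩ := LinearMap.exists_leftInverse_of_injective (Algebra.linearMap k K)
      (LinearMap.ker_eq_bot.2 (algebraMap k K).injective)
    exact ⟨ε, by simpa using LinearMap.congr_fun h 1⟩
  have hdegmap : ∀ a : MvPolynomial (Fin 2) k,
      (map (algebraMap k K) a).totalDegree = a.totalDegree := fun a => by
    rw [totalDegree, totalDegree, support_map_of_injective _ (algebraMap k K).injective]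
  have hpK : (map (algebraMap k K) p).totalDegree ≠ 0 := by rwa [hdegmap]
  have hminK : ∀ l μ, ¬ map (algebraMap k K) p - C l ∣ map (algebraMap k K) t - C μ := by
    rintro l μ ⟨t₂, ht₂⟩
    have hne : t₂ ≠ 0 := by
      rintro rfl
      rw [mul_zero] at ht₂
      exact sub_C_ne_zero (by rwa [hdegmap]) μ ht₂
    have hdeg := totalDegree_mul_of_isDomain (sub_C_ne_zero hpK l) hne
    rw [← ht₂, totalDegree_sub_C, totalDegree_sub_C, hdegmap, hdegmap] at hdeg
    have hl : IsIntegral k l := Algebra.IsIntegral.isIntegral l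
    obtain ⟨w, hw⟩ : Polynomial.X - Polynomial.C l ∣ (minpoly k l).map (algebraMap k K) := by
      rw [Polynomial.dvd_iff_isRoot, Polynomial.IsRoot.def, Polynomial.eval_map_algebraMap]
      exact minpoly.aeval k l
    have hwm : w.Monic := by
      have := (minpoly.monic hl).map (algebraMap k K)
      rw [hw] at this
      exact (Polynomial.monic_X_sub_C l).of_mul_monic_left this
    have hMt : M (coeffForm ε t₂) := by
      have hγw : polyForm ε (γ.map (algebraMap k K) * w) ≠ 0 := by
        intro h
        have h1 := congrArg (fun P => Polynomial.coeff P (γ.natDegree + w.natDegree)) h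
        have h2 := Polynomial.coeff_mul_degree_add_degree (γ.map (algebraMap k K)) w
        rw [Polynomial.natDegree_map] at h2
        simp only [coeff_polyForm, h2, hwm.leadingCoeff, Polynomial.leadingCoeff_map, mul_one,
          Polynomial.coeff_zero] at h1
        rw [Algebra.algebraMap_eq_smul_one, map_smul, hε, smul_eq_mul, mul_one] at h1
        exact hγ (Polynomial.leadingCoeff_eq_zero.1 h1)
      refine ⟨N * minpoly k l, _, polyForm ε ((δ.map (algebraMap k K) -
        Polynomial.C μ * N.map (algebraMap k K)) * w),
        mul_ne_zero hN (minpoly.ne_zero hl), hγw, ?_⟩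
      rw [← coeffForm_map_mul, ← coeffForm_aeval, ← coeffForm_aeval, mul_comm _ q,
        ← coeffForm_map_mul, ← map_add]
      congr 1
      have h1 := congrArg (map (algebraMap k K)) hNt
      rw [map_add, map_mul, map_mul] at h1
      rw [← polyAeval_map, Polynomial.map_mul, hw]
      simp only [map_mul, map_sub, Polynomial.aeval_X, Polynomial.aeval_C, polyAeval_map,
        algebraMap_eq]
      linear_combination (Polynomial.aeval (map (algebraMap k K) p) w) * h1 -
        (map (algebraMap k K) (Polynomial.aeval p N)) *
          (Polynomial.aeval (map (algebraMap k K) p) w) * ht₂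
    have h1 := hmin _ hMt
    have h2 := totalDegree_coeffForm_le ε t₂
    omega
  have hsurj : ∀ ρ, ∃ H, evalTwo k p t H = ρ := by
    intro ρ
    have hallK : ∀ ρ, InGeneric K (map (algebraMap k K) p) (map (algebraMap k K) t) ρ := by
      refine inGeneric_of_X fun i => ?_
      simpa using (hall (X i)).map (K := K)
    obtain ⟨c, hc, H, hH⟩ := hallK (map (algebraMap k K) ρ)
    obtain ⟨H', hH'⟩ := exists_evalTwo_eq hpK hallK hminK _ c H _ rfl hc hH
    obtain ⟨H'', h⟩ := exists_evalTwo_eq_coeffForm ε p t H'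
    exact ⟨H'', by rw [h, hH', coeffForm_map hε]⟩
  obtain ⟨σ, hσ⟩ := exists_algEquiv_of_adjoin_eq_top (x := ![p, t]) (by
    rw [eq_top_iff]
    rintro ρ -
    obtain ⟨H, rfl⟩ := hsurj ρ
    have ht : t ∈ Algebra.adjoin k (Set.range ![p, t]) := Algebra.subset_adjoin ⟨1, rfl⟩
    have hp : Algebra.adjoin k {p} ≤ Algebra.adjoin k (Set.range ![p, t]) :=
      Algebra.adjoin_mono (by rintro _ rfl; exact ⟨0, rfl⟩)
    induction H using Polynomial.induction_on' with
    | add a b ha hb => rw [map_add]; exact add_mem ha hb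
    | monomial n a =>
      rw [← Polynomial.C_mul_X_pow_eq_monomial, map_mul, map_pow, evalTwo_C, evalTwo_X]
      exact mul_mem (hp (Polynomial.aeval_mem_adjoin_singleton k p)) (pow_mem ht n))
  have hσ0 : ∀ c : Polynomial k, σ (Polynomial.aeval (X 0) c) = Polynomial.aeval p c := by
    intro c
    have := Polynomial.aeval_algHom_apply σ.toAlgHom (X 0) c
    simpa [hσ] using this.symm
  refine ⟨σ, fun h hh => ?_, ?_⟩
  · obtain ⟨β, hβ⟩ := hgen h hh
    exact ⟨β, by rw [hσ0, hβ]⟩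
  · obtain ⟨H, hH⟩ := hsurj q
    have h1 : Polynomial.C N * Polynomial.X = Polynomial.C γ * H + Polynomial.C δ := by
      apply hinj
      simp only [map_add, map_mul, evalTwo_C, evalTwo_X, hH, hNt]
    have h2 : H = Polynomial.C (H.coeff 1) * Polynomial.X + Polynomial.C (H.coeff 0) := by
      refine Polynomial.ext fun j => ?_
      rcases j with _ | _ | j
      · simp
      · simp
      · have h3 := congrArg (fun P => Polynomial.coeff P (j + 2)) h1
        simp [Polynomial.coeff_C, Polynomial.coeff_X, hγ] at h3
        simp [Polynomial.coeff_C, Polynomial.coeff_X, ← h3]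
    refine ⟨H.coeff 1, H.coeff 0, ?_⟩
    rw [map_add, map_mul, hσ0, hσ0, hσ, ← hH]
    conv_rhs => rw [h2]
    simp

end SliceData

/-- Polynomial data presenting `R[σ] / (G)` as a polynomial ring in the variables `τ`. -/
def IsPolyQuotient {R σ : Type} [CommRing R] (τ : Type) (G : MvPolynomial σ R) : Prop :=
  ∃ (a : σ → MvPolynomial τ R) (b : τ → MvPolynomial σ R) (h : σ → MvPolynomial σ R),
    bind₁ a G = 0 ∧ (∀ j, bind₁ a (b j) = X j) ∧ ∀ s, bind₁ b (a s) - X s = G * h s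

namespace IsPolyQuotient
variable {R R' σ τ : Type} [CommRing R] [CommRing R'] {G : MvPolynomial σ R}

lemma map (hG : IsPolyQuotient τ G) (φ : R →+* R') : IsPolyQuotient τ (MvPolynomial.map φ G) := by
  obtain ⟨a, b, h, h1, h2, h3⟩ := hG
  refine ⟨fun s => MvPolynomial.map φ (a s), fun j => MvPolynomial.map φ (b j),
    fun s => MvPolynomial.map φ (h s), ?_, fun j => ?_, fun s => ?_⟩
  · rw [← map_bind₁, h1, map_zero]
  · rw [← map_bind₁, h2, map_X]
  · rw [← map_bind₁, ← map_mul, ← h3, map_sub, map_X]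

lemma of_algEquiv (e : (MvPolynomial σ R ⧸ Ideal.span {G}) ≃ₐ[R] MvPolynomial τ R) :
    IsPolyQuotient τ G := by
  let π := Ideal.Quotient.mkₐ R (Ideal.span {G})
  have hπ : Function.Surjective π := Ideal.Quotient.mkₐ_surjective R _
  choose b hb using fun j => hπ (e.symm (X j))
  let a : σ → MvPolynomial τ R := fun s => e (π (X s))
  have ha : ∀ P, bind₁ a P = e (π P) := fun P =>
    DFunLike.congr_fun (algHom_ext (f := bind₁ a) (g := e.toAlgHom.comp π) fun s => by simp [a]) P
  have hb' : ∀ P, π (bind₁ b P) = e.symm P := fun P =>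
    DFunLike.congr_fun (algHom_ext (f := π.comp (bind₁ b)) (g := e.symm.toAlgHom) fun s => by
      simp [hb]) P
  have hdvd : ∀ s, G ∣ bind₁ b (a s) - X s := fun s => by
    rw [← Ideal.mem_span_singleton, ← Ideal.Quotient.eq]
    exact (hb' _).trans (e.symm_apply_apply _)
  choose h hh using hdvd
  refine ⟨a, b, h, ?_, fun j => ?_, hh⟩
  · have : π G = 0 := Ideal.Quotient.eq_zero_iff_mem.2 (Ideal.mem_span_singleton_self G)
    rw [ha, this, map_zero]
  · rw [ha, hb, e.apply_symm_apply]

lemma nonempty_algEquiv (hG : IsPolyQuotient τ G) :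
    Nonempty ((MvPolynomial σ R ⧸ Ideal.span {G}) ≃ₐ[R] MvPolynomial τ R) := by
  obtain ⟨a, b, h, h1, h2, h3⟩ := hG
  let π := Ideal.Quotient.mkₐ R (Ideal.span {G})
  have h0 : ∀ P ∈ Ideal.span {G}, bind₁ a P = 0 := fun P hP => by
    obtain ⟨c, rfl⟩ := Ideal.mem_span_singleton.1 hP
    rw [map_mul, h1, zero_mul]
  refine ⟨AlgEquiv.ofAlgHom (Ideal.Quotient.liftₐ _ (bind₁ a) h0) (π.comp (bind₁ b)) ?_ ?_⟩
  · refine algHom_ext fun j => ?_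
    have : Ideal.Quotient.liftₐ _ (bind₁ a) h0 (π (b j)) = bind₁ a (b j) := rfl
    simpa [h2] using this
  · refine Ideal.Quotient.algHom_ext _ (algHom_ext fun s => ?_)
    have : Ideal.Quotient.mk (Ideal.span {G}) (bind₁ b (a s)) = Ideal.Quotient.mk _ (X s) := by
      rw [Ideal.Quotient.eq, h3]
      exact Ideal.mem_span_singleton.2 ⟨_, rfl⟩
    change π (bind₁ b (bind₁ a (X s))) = π (X s)
    rwa [bind₁_X_right]

lemma nonempty_zeros_equiv (hG : IsPolyQuotient τ G) :
    Nonempty ({v : σ → R // eval v G = 0} ≃ (τ → R)) := by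
  obtain ⟨a, b, h, h1, h2, h3⟩ := hG
  have key : ∀ {σ τ : Type} (c : σ → MvPolynomial τ R) (w : τ → R) (P : MvPolynomial σ R),
      eval w (bind₁ c P) = eval (fun s => eval w (c s)) P := fun c w P => by
    have := DFunLike.congr_fun (algHom_ext (f := (aeval w).comp (bind₁ c))
      (g := aeval fun s => eval w (c s)) fun s => by simp [aeval_eq_eval]) P
    simpa [aeval_eq_eval] using this
  refine ⟨⟨fun v j => eval v.1 (b j), fun w => ⟨fun s => eval w (a s), ?_⟩, fun v => ?_,
    fun w => ?_⟩⟩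
  · rw [← key, h1, map_zero]
  · ext s
    have := congrArg (eval v.1) (h3 s)
    rw [map_sub, key, map_mul, v.2, zero_mul, eval_X, sub_eq_zero] at this
    exact this
  · ext j
    change eval (fun s => eval w (a s)) (b j) = w j
    rw [← key, h2, eval_X]

/-- Descent along an injective ring homomorphism whose range contains the relevant coefficients. -/
lemma exists_descent {k : Type} [Field k] [Finite σ] [Finite τ] {G : MvPolynomial σ k}
    (hG : IsPolyQuotient τ G) :
    ∃ S : Finset k, ∀ R : Subring k, (S : Set k) ⊆ R → ∀ G' : MvPolynomial σ R,
      MvPolynomial.map R.subtype G' = G → IsPolyQuotient τ G' := by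
  classical
  obtain ⟨a, b, h, h1, h2, h3⟩ := hG
  have := Fintype.ofFinite σ
  have := Fintype.ofFinite τ
  refine ⟨(Finset.univ.biUnion fun s => (a s).coeffs) ∪ (Finset.univ.biUnion fun s => (b s).coeffs)
    ∪ (Finset.univ.biUnion fun s => (h s).coeffs), fun R hR G' hG' => ?_⟩
  have key : ∀ {υ : Type} (P : MvPolynomial υ k), (P.coeffs : Set k) ⊆ R →
      ∃ P', MvPolynomial.map R.subtype P' = P := fun P hP =>
    (mem_range_map_iff_coeffs_subset (f := R.subtype)).2 (by simpa using hP)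
  have hinj (υ : Type) : Function.Injective (MvPolynomial.map (σ := υ) R.subtype) :=
    map_injective _ R.subtype_injective
  simp only [Finset.coe_union, Finset.coe_biUnion, Set.union_subset_iff, Set.iUnion_subset_iff,
    Finset.mem_coe, Finset.mem_univ, true_imp_iff] at hR
  choose a' ha using fun s => key (a s) (hR.1.1 s)
  choose b' hb using fun s => key (b s) (hR.1.2 s)
  choose h' hh using fun s => key (h s) (hR.2 s)
  refine ⟨a', b', h', hinj _ ?_, fun j => hinj _ ?_, fun s => hinj _ ?_⟩
  · simp only [map_bind₁, ha, hG', h1, map_zero]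
  · simp only [map_bind₁, ha, hb, h2, map_X]
  · simp only [map_bind₁, map_sub, map_mul, hb, ha, hh, hG', h3, map_X]

end IsPolyQuotient

section
variable {k : Type} [Field k] {m : ℕ} {r : Fin m → ℕ} {F g : MvPolynomial (Fin m ⊕ Fin 2) k}

/-- A point of `{f = 0}` lying over a point `e` of the union of the coordinate hyperplanes. -/
lemma exists_pointHom (hFg : F = rename Sum.inr (fOf k m F) + (∏ i, X (Sum.inl i)) * g)
    (e : Fin m → MvPolynomial (Fin 2) k ⧸ Ideal.span {fOf k m F}) (he : ∏ i, e i = 0) :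
    ∃ θ : RingA k m r F →ₐ[k] MvPolynomial (Fin 2) k ⧸ Ideal.span {fOf k m F},
      (∀ i, θ (xA k m r F i) = e i) ∧ ∀ b, θ (ztA k m r F b) = Ideal.Quotient.mk _ b := by
  let π := Ideal.Quotient.mkₐ k (Ideal.span {fOf k m F})
  let θ₀ : BigP k m →ₐ[k] MvPolynomial (Fin 2) k ⧸ Ideal.span {fOf k m F} :=
    aeval (Sum.elim e (Fin.cons 0 fun j => π (X j)))
  have hincl : θ₀.comp (incl k m) = aeval (Sum.elim e fun j => π (X j)) := by
    refine algHom_ext fun s => ?_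
    rcases s with i | j <;> simp [θ₀, incl]
  have hzt : ∀ b, θ₀ (incl k m (rename Sum.inr b)) = π b := fun b => by
    rw [← AlgHom.comp_apply, hincl, aeval_rename]
    refine DFunLike.congr_fun (algHom_ext (f := aeval _) (g := π) fun j => ?_) b
    simp
  have hG : θ₀ (relG k m r F) = 0 := by
    have h0 : π (fOf k m F) = 0 :=
      Ideal.Quotient.eq_zero_iff_mem.2 (Ideal.mem_span_singleton_self _)
    have h1 : θ₀ (incl k m F) = 0 := by
      refine (congrArg (fun P => θ₀ (incl k m P)) hFg).trans ?_
      rw [map_add, map_add, hzt, h0, zero_add, map_mul, map_mul, ← AlgHom.comp_apply, hincl,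
        map_prod]
      simp [he]
    rw [relG, map_sub, h1, map_mul, sub_zero]
    simp [θ₀]
  refine ⟨Ideal.Quotient.liftₐ _ θ₀ fun a ha => ?_, fun i => ?_, fun b => ?_⟩
  · obtain ⟨b, rfl⟩ := Ideal.mem_span_singleton'.1 ha
    rw [map_mul, hG, mul_zero]
  · change θ₀ (X (Sum.inl i)) = e i
    simp [θ₀]
  · rw [← inclA_rename]
    exact hzt b

lemma exists_prod_pow_mul_eq_inclA (a : RingA k m r F) :
    ∃ N P, inclA k m r F ((∏ i, X (Sum.inl i)) ^ N) * a = inclA k m r F P := by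
  obtain ⟨Q, rfl⟩ := Ideal.Quotient.mk_surjective a
  induction Q using MvPolynomial.induction_on with
  | C c => exact ⟨0, C c, by
      rw [pow_zero, map_one, one_mul, inclA_apply, incl, rename_C]⟩
  | add P Q hP hQ =>
    obtain ⟨N, P', hP⟩ := hP
    obtain ⟨N', Q', hQ⟩ := hQ
    refine ⟨N + N', (∏ i, X (Sum.inl i)) ^ N' * P' + (∏ i, X (Sum.inl i)) ^ N * Q', ?_⟩
    rw [map_add (Ideal.Quotient.mk _), map_add, map_mul _ _ P', map_mul _ _ Q', ← hP, ← hQ,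
      pow_add, map_mul]
    ring
  | mul_X P s hP =>
    obtain ⟨N, P', hP⟩ := hP
    rw [map_mul (Ideal.Quotient.mk _)]
    obtain ⟨M, Q, hQ⟩ : ∃ M Q, inclA k m r F ((∏ i, X (Sum.inl i)) ^ M) *
        Ideal.Quotient.mk _ (X s) = inclA k m r F Q := by
      rcases s with i | j
      · exact ⟨0, X (Sum.inl i), by simp [inclA_X_inl, xA]⟩
      · refine Fin.cases ?_ (fun j => ?_) j
        · refine ⟨∑ i, r i, (∏ i, X (Sum.inl i) ^ (∑ i, r i - r i)) * F, ?_⟩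
          rw [map_mul, ← xA_prod_mul_yA, ← mul_assoc]
          congr 1
          simp only [← inclA_X_inl, ← map_pow, ← map_prod, ← map_mul, ← Finset.prod_mul_distrib,
            ← Finset.prod_pow, ← pow_add]
          congr 2
          ext1 i
          rw [Nat.sub_add_cancel (Finset.single_le_sum (fun _ _ => Nat.zero_le _)
            (Finset.mem_univ i))]
        · exact ⟨0, X (Sum.inr j), by simp [inclA_apply, incl]⟩
    refine ⟨N + M, P' * Q, ?_⟩
    rw [map_mul _ P', ← hP, ← hQ, pow_add, map_mul]
    ring

lemma prod_X_inl_pow_eq_monomial (N : ℕ) :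
    (∏ i : Fin m, X (Sum.inl i) : MvPolynomial (Fin m ⊕ Fin 2) k) ^ N =
      monomial (N • ∑ i : Fin m, Finsupp.single (Sum.inl i) 1) 1 := by
  have h : (∏ i : Fin m, X (Sum.inl i) : MvPolynomial (Fin m ⊕ Fin 2) k) =
      monomial (∑ i : Fin m, Finsupp.single (Sum.inl i) 1) 1 := (monomial_sum_one _ _).symm
  rw [h, monomial_pow, one_pow]

lemma isUnit_inclA_monomial {s : Fin m ⊕ Fin 2 →₀ ℕ} {c : k} (hc : c ≠ 0) (hs : s = 0) :
    IsUnit (inclA k m r F (monomial s c)) := by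
  subst hs
  exact ((isUnit_iff_ne_zero.2 hc).map C).map _

/-- Divisors of monomials in the `x i` are such monomials. -/
lemma exists_monomial_of_mul_eq [IsDomain (RingA k m r F)]
    (hFg : F = rename Sum.inr (fOf k m F) + (∏ i, X (Sum.inl i)) * g)
    (hu : ¬ IsUnit (fOf k m F)) {d e : RingA k m r F} {n : Fin m ⊕ Fin 2 →₀ ℕ}
    (hn : ∀ j, n (Sum.inr j) = 0) {c : k} (hc : c ≠ 0)
    (h : d * e = inclA k m r F (monomial n c)) :
    ∃ s c', c' ≠ 0 ∧ d = inclA k m r F (monomial s c') := by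
  classical
  obtain ⟨N, P, hP⟩ := exists_prod_pow_mul_eq_inclA d
  obtain ⟨N', Q, hQ⟩ := exists_prod_pow_mul_eq_inclA e
  rw [prod_X_inl_pow_eq_monomial] at hP hQ
  have hη : ∀ (N : ℕ) j, (N • ∑ i : Fin m, Finsupp.single (Sum.inl i) 1 : Fin m ⊕ Fin 2 →₀ ℕ)
      (Sum.inr j) = 0 := fun N j => by
    simp
  have hη' := hη N
  set ν : Fin m ⊕ Fin 2 →₀ ℕ := N • ∑ i : Fin m, Finsupp.single (Sum.inl i) 1
  set ν' : Fin m ⊕ Fin 2 →₀ ℕ := N' • ∑ i : Fin m, Finsupp.single (Sum.inl i) 1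
  have hPQ : P ∣ monomial (ν + ν' + n) c := by
    refine ⟨Q, inclA_injective (r := r) (F := F) ?_⟩
    rw [map_mul, ← hP, ← hQ, mul_mul_mul_comm, h, ← map_mul, ← map_mul, monomial_mul, monomial_mul,
      one_mul, one_mul]
  obtain ⟨s, b, hs, hb, rfl⟩ := (dvd_monomial_iff_exists hc).1 hPQ
  have hb0 : b ≠ 0 := ne_zero_of_dvd_ne_zero hc hb
  have hs0 : ∀ j, s (Sum.inr j) = 0 := fun j => Nat.le_zero.1 ((hs _).trans (by
    simp [hη', ν', hn]))
  have hcan : inclA k m r F (monomial (ν - ν ⊓ s) 1) * d =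
      inclA k m r F (monomial (s - ν ⊓ s) b) := by
    have hne : inclA k m r F (monomial (ν ⊓ s) 1) ≠ 0 := fun h0 => by
      rw [← map_zero (inclA k m r F)] at h0
      simpa using inclA_injective h0
    apply mul_left_cancel₀ hne
    rw [← mul_assoc, ← map_mul, ← map_mul, monomial_mul, monomial_mul, one_mul, one_mul,
      add_tsub_cancel_of_le inf_le_left, add_tsub_cancel_of_le inf_le_right, hP]
  refine ⟨s - ν ⊓ s, b, hb0, ?_⟩
  rw [← hcan]
  suffices h0 : ν - ν ⊓ s = 0 by
    rw [h0]
    simp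
  by_contra hne
  obtain ⟨j, hj⟩ := Finsupp.ne_iff.1 hne
  rcases j with i | j
  swap
  · simp [hη'] at hj
  have hnt : Nontrivial (MvPolynomial (Fin 2) k ⧸ Ideal.span {fOf k m F}) :=
    Ideal.Quotient.nontrivial_iff.2 (by rwa [Ne, Ideal.span_singleton_eq_top])
  obtain ⟨θ, hx, -⟩ := exists_pointHom (r := r) hFg (Function.update 1 i 0)
    (Finset.prod_eq_zero (Finset.mem_univ i) (by simp))
  have hmon : ∀ (t : Fin m ⊕ Fin 2 →₀ ℕ) (a : k), (∀ j, t (Sum.inr j) = 0) →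
      θ (inclA k m r F (monomial t a)) = algebraMap k _ a *
        ∏ l, (Function.update 1 i 0 : Fin m → MvPolynomial (Fin 2) k ⧸ Ideal.span {fOf k m F}) l ^
          t (Sum.inl l) := by
    intro t a ht
    rw [monomial_eq, Finsupp.prod_fintype _ _ (by simp)]
    simp [Fintype.prod_sum_type, ht, inclA_X_inl, hx, ← algebraMap_eq]
  have h2 := congrArg θ hcan
  rw [map_mul, hmon _ _ (by simp [hη']), hmon _ _ (by simp [hs0]),
    Finset.prod_eq_zero (Finset.mem_univ i), mul_zero, zero_mul] at h2
  · rw [Finset.prod_eq_one, mul_one] at h2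
    · exact hb0 ((map_eq_zero _).1 h2.symm)
    · intro l _
      by_cases hl : l = i
      · subst hl
        have : (s - ν ⊓ s) (Sum.inl l) = 0 := by
          simp only [Finsupp.coe_tsub, Pi.sub_apply, Finsupp.inf_apply, Finsupp.coe_zero,
            Pi.zero_apply] at hj ⊢
          omega
        rw [this, pow_zero]
      · simp [hl]
  · simp only [Function.update_self]
    exact zero_pow hj

theorem irreducible_fOf {τ : Type} (hm : 1 ≤ m) (hr : ∀ i, 1 < r i)
    (hf : fOf k m F ≠ 0) (hFg : F = rename Sum.inr (fOf k m F) + (∏ i, X (Sum.inl i)) * g)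
    (Ψ : RingA k m r F ≃ₐ[k] MvPolynomial τ k) : Irreducible (fOf k m F) := by
  classical
  have : IsDomain (RingA k m r F) := Ψ.toMulEquiv.isDomain _
  let i₀ : Fin m := ⟨0, hm⟩
  have hdvd : xA k m r F i₀ ∣ ztA k m r F (fOf k m F) := by
    have h1 := xA_prod_mul_yA (k := k) (r := r) (F := F)
    rw [hFg, map_add, inclA_rename, ← hFg, map_mul, map_prod] at h1
    rw [eq_sub_of_add_eq h1.symm]
    refine dvd_sub (Dvd.dvd.mul_right ?_ _) (Dvd.dvd.mul_right ?_ _)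
    · exact (dvd_pow_self _ (zero_lt_one.trans (hr i₀)).ne').trans
        (Finset.dvd_prod_of_mem _ (Finset.mem_univ i₀))
    · rw [← inclA_X_inl]
      exact Finset.dvd_prod_of_mem (fun i => inclA k m r F (X (Sum.inl i))) (Finset.mem_univ i₀)
  have hu : ¬ IsUnit (fOf k m F) := fun hu => by
    have h1 : IsUnit (Ψ (xA k m r F i₀)) := (isUnit_of_dvd_unit hdvd (hu.map _)).map Ψ
    have h2 := totalDegree_eq_zero_iff_eq_C.1 (totalDegree_eq_zero_of_isUnit h1)
    have h3 : xA k m r F i₀ = Ψ.symm (C (coeff 0 (Ψ (xA k m r F i₀)))) := by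
      rw [← h2, Ψ.symm_apply_apply]
    rw [← algebraMap_eq, AlgEquiv.commutes, ← (inclA k m r F).commutes, ← inclA_X_inl] at h3
    have h4 := congrArg (coeff 0) (inclA_injective h3)
    have h5 := congrArg (coeff (Finsupp.single (Sum.inl i₀) 1)) (inclA_injective h3)
    simp [algebraMap_eq, coeff_C, eq_comm (a := (0 : Fin m ⊕ Fin 2 →₀ ℕ))] at h5
  have hnt : Nontrivial (MvPolynomial (Fin 2) k ⧸ Ideal.span {fOf k m F}) :=
    Ideal.Quotient.nontrivial_iff.2 (by rwa [Ne, Ideal.span_singleton_eq_top])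
  obtain ⟨θ, hx, hzt⟩ := exists_pointHom (r := r) hFg (Function.update 1 i₀ 0)
    (Finset.prod_eq_zero (Finset.mem_univ i₀) (by simp))
  have hθ : θ (xA k m r F i₀) = 0 := by simp [hx]
  have hirr : Irreducible (xA k m r F i₀) := by
    refine ⟨fun h => not_isUnit_zero (hθ ▸ h.map θ), fun {d e} hde => ?_⟩
    rw [← inclA_X_inl, X] at hde
    obtain ⟨s, c, hc, rfl⟩ := exists_monomial_of_mul_eq hFg hu (by simp) one_ne_zero hde.symm
    obtain ⟨s', c', hc', rfl⟩ := exists_monomial_of_mul_eq hFg hu (by simp) one_ne_zero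
      ((mul_comm _ _).trans hde.symm)
    rw [← map_mul, monomial_mul] at hde
    have hss : Finsupp.single (Sum.inl i₀) 1 = s + s' := by
      rcases (monomial_eq_monomial_iff _ _ _ _).1 (inclA_injective hde) with h | h
      · exact h.1
      · exact absurd h.1 one_ne_zero
    by_cases hs : s = 0
    · exact Or.inl (isUnit_inclA_monomial hc hs)
    · refine Or.inr (isUnit_inclA_monomial hc' ?_)
      have hdeg := congrArg Finsupp.degree hss
      rw [map_add, Finsupp.degree_single] at hdeg
      have : s.degree ≠ 0 := by rwa [Ne, Finsupp.degree_eq_zero_iff]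
      rw [← Finsupp.degree_eq_zero_iff]
      omega
  have hprime : Prime (xA k m r F i₀) := by
    rw [← MulEquiv.prime_iff Ψ]
    exact ((MulEquiv.irreducible_iff Ψ).2 hirr).prime
  have key : ∀ γ δ, fOf k m F = γ * δ → xA k m r F i₀ ∣ ztA k m r F γ → IsUnit δ := by
    intro γ δ hγδ h
    obtain ⟨w, hw⟩ := h
    have h1 := congrArg θ hw
    rw [hzt, map_mul, hθ, zero_mul, Ideal.Quotient.eq_zero_iff_mem, Ideal.mem_span_singleton] at h1
    obtain ⟨ε, hε⟩ := h1
    refine .of_mul_eq_one ε ?_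
    apply mul_left_cancel₀ hf
    rw [mul_one]
    conv_rhs => rw [hγδ, hε]
    ring
  refine ⟨hu, fun {γ δ} hγδ => ?_⟩
  rw [hγδ, map_mul] at hdvd
  rcases hprime.dvd_or_dvd hdvd with h | h
  · exact Or.inr (key γ δ hγδ h)
  · exact Or.inl (key δ γ (hγδ.trans (mul_comm _ _)) h)

end

lemma incl_map {R R' : Type} [CommRing R] [CommRing R'] (φ : R →+* R') {m : ℕ}
    (F : MvPolynomial (Fin m ⊕ Fin 2) R) :
    incl R' m (map φ F) = map φ (incl R m F) := (map_rename φ _ F).symm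

lemma relG_map {R R' : Type} [CommRing R] [CommRing R'] (φ : R →+* R') {m : ℕ} (r : Fin m → ℕ)
    (F : MvPolynomial (Fin m ⊕ Fin 2) R) :
    relG R' m r (map φ F) = map φ (relG R m r F) := by
  simp [relG, incl_map]

lemma fOf_rename_add {R : Type} [CommRing R] {m : ℕ} (hm : 1 ≤ m) (f : MvPolynomial (Fin 2) R)
    (g : MvPolynomial (Fin m ⊕ Fin 2) R) :
    fOf R m (rename Sum.inr f + (∏ i, X (Sum.inl i)) * g) = f := by
  have : ∏ i : Fin m, (0 : MvPolynomial (Fin 2) R) = 0 :=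
    Finset.prod_eq_zero (Finset.mem_univ ⟨0, hm⟩) rfl
  simp only [fOf, map_add, map_mul, map_prod, aeval_X, Sum.elim_inl, this, zero_mul, add_zero,
    aeval_rename]
  exact (congrArg (fun e => aeval e f) (funext fun _ => rfl)).trans (aeval_X_left_apply f)

section
variable {k : Type} [Field k] {m : ℕ} {r : Fin m → ℕ}

theorem natDegree_eq_one_of_algEquiv {τ : Type} (hm : 1 ≤ m) (hr : ∀ i, 1 < r i)
    {β : Polynomial k} (hβ : β ≠ 0) {g : MvPolynomial (Fin m ⊕ Fin 2) k}
    (Ψ : RingA k m r (rename Sum.inr (Polynomial.aeval (X 0 : MvPolynomial (Fin 2) k) β) +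
      (∏ i, X (Sum.inl i)) * g) ≃ₐ[k] MvPolynomial τ k) : β.natDegree = 1 := by
  let K := AlgebraicClosure k
  let φ := algebraMap k K
  let γ := β.map φ
  have htr : Transcendental K (X 0 : MvPolynomial (Fin 2) K) := transcendental_X _ _
  have hinj := transcendental_iff_injective.1 htr
  have hγ : γ ≠ 0 := (Polynomial.map_ne_zero_iff φ.injective).2 hβ
  let F' := rename Sum.inr (Polynomial.aeval (X 0 : MvPolynomial (Fin 2) K) γ) +
      (∏ i, X (Sum.inl i)) * map φ g
  obtain ⟨Ψ'⟩ : Nonempty (RingA K m r F' ≃ₐ[K] MvPolynomial τ K) := by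
    have hF : map φ (rename Sum.inr (Polynomial.aeval (X 0 : MvPolynomial (Fin 2) k) β) +
        (∏ i, X (Sum.inl i)) * g) = F' := by
      rw [map_add, map_rename, map_mul, map_prod, ← polyAeval_map]
      simp only [map_X, F', γ, φ]
    have h := ((IsPolyQuotient.of_algEquiv Ψ).map φ).nonempty_algEquiv
    rwa [← relG_map, hF] at h
  have hfOf : fOf K m F' = Polynomial.aeval (X 0 : MvPolynomial (Fin 2) K) γ :=
    fOf_rename_add hm _ _
  have hirr := irreducible_fOf (g := map φ g) hm hr (by rw [hfOf]; exact fun h => hγ (hinj (by simpa using h)))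
    (by rw [hfOf]) Ψ'
  rw [hfOf] at hirr
  have : Irreducible γ := by
    refine ⟨fun h => hirr.1 (h.map _), fun {a b} hab => ?_⟩
    have hunit : ∀ a : Polynomial K, IsUnit (Polynomial.aeval (X 0 : MvPolynomial (Fin 2) K) a) →
        IsUnit a := fun a ha => by
      have h := ha.map (aeval (fun _ => Polynomial.X) : MvPolynomial (Fin 2) K →ₐ[K] Polynomial K)
      rwa [← Polynomial.aeval_algHom_apply, aeval_X, Polynomial.aeval_X_left_apply] at h
    exact (hirr.2 (by rw [hab, map_mul])).imp (hunit a) (hunit b)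
  have h1 := Polynomial.natDegree_eq_of_degree_eq_some (IsAlgClosed.degree_eq_one_of_irreducible K this)
  rwa [Polynomial.natDegree_map] at h1

end

section
variable {L : Type} [Field L] {m : ℕ} {r : Fin m → ℕ}

lemma eval_relG {x : Fin m → L} {y : L} {w : Fin 2 → L} {f : MvPolynomial (Fin 2) L}
    {g : MvPolynomial (Fin m ⊕ Fin 2) L} :
    eval (Sum.elim x (Fin.cons y w : Fin 3 → L))
      (relG L m r (rename Sum.inr f + (∏ i, X (Sum.inl i)) * g)) =
    (∏ i, x i ^ r i) * y - (eval w f + (∏ i, x i) * eval (Sum.elim x w) g) := by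
  have h : (Sum.elim x (Fin.cons y w : Fin 3 → L)) ∘ Sum.map id Fin.succ = Sum.elim x w := by
    ext s
    rcases s with i | j <;> simp
  simp [relG, incl, eval_rename, h, ← Function.comp_assoc]

variable [Fintype L] [DecidableEq L]

lemma sum_ite_mul_eq {a : L} (ha : a ≠ 0) (b : L) : (∑ y : L, if a * y = b then 1 else 0) = 1 := by
  simp only [mul_comm a, ← eq_div_iff ha]
  simp

/-- Counting points: the fibre of `f` over the finite field `L` has as many points as a line. -/
theorem card_zeros_of_isPolyQuotient (hm : 1 ≤ m) (hr : ∀ i, 1 < r i)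
    {f : MvPolynomial (Fin 2) L} {g : MvPolynomial (Fin m ⊕ Fin 2) L}
    (h : IsPolyQuotient (Fin (m + 2))
      (relG L m r (rename Sum.inr f + (∏ i, X (Sum.inl i)) * g))) :
    ∑ w : Fin 2 → L, (if eval w f = 0 then 1 else 0) = Fintype.card L := by
  obtain ⟨e⟩ := h.nonempty_zeros_equiv
  have h1 := Fintype.card_congr e
  let e' : (Fin m → L) × (L × (Fin 2 → L)) ≃ (Fin m ⊕ Fin 3 → L) :=
    ((Equiv.refl _).prodCongr (Fin.consEquiv fun _ => L)).trans
      (Equiv.sumArrowEquivProdArrow (Fin m) (Fin 3) L).symm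
  have he' : ∀ x y w, e' (x, (y, w)) = Sum.elim x (Fin.cons y w : Fin 3 → L) := fun x y w => rfl
  rw [Fintype.card_subtype, Finset.card_filter, ← Equiv.sum_comp e', Fintype.sum_prod_type] at h1
  set n := ∑ w : Fin 2 → L, (if eval w f = 0 then 1 else 0)
  set q := Fintype.card L
  have hq : 0 < q := Fintype.card_pos
  have h2 : ∀ x : Fin m → L, (∑ yw : L × (Fin 2 → L), if eval (e' (x, yw))
      (relG L m r (rename Sum.inr f + (∏ i, X (Sum.inl i)) * g)) = 0 then 1 else 0) =
      if ∏ i, x i = 0 then q * n else q * q := by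
    intro x
    rw [Fintype.sum_prod_type]
    simp only [he', eval_relG]
    split_ifs with hx
    · have hx' : ∏ i, x i ^ r i = 0 := by
        obtain ⟨i, -, hi⟩ := Finset.prod_eq_zero_iff.1 hx
        exact Finset.prod_eq_zero (Finset.mem_univ i)
          (by rw [hi, zero_pow (zero_lt_one.trans (hr i)).ne'])
      simp [hx, hx', n, q]
    · have hx' : ∏ i, x i ^ r i ≠ 0 := by
        rw [← Ne, Finset.prod_ne_zero_iff] at hx
        rw [Finset.prod_ne_zero_iff]
        exact fun i hi => pow_ne_zero _ (hx i hi)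
      rw [Finset.sum_comm]
      have : ∀ w : Fin 2 → L, (∑ y : L, if (∏ i, x i ^ r i) * y -
          (eval w f + (∏ i, x i) * eval (Sum.elim x w) g) = 0 then 1 else 0) = 1 := fun w => by
        simp only [sub_eq_zero]
        exact sum_ite_mul_eq hx' _
      simp [this, q, sq]
  simp only [h2, Fintype.card_fun, Fintype.card_fin] at h1
  have h3 : ∑ x : Fin m → L, q * q = q ^ (m + 2) := by
    simp [q, pow_add, sq]
  rw [← h3] at h1
  have hx0 : ∏ i : Fin m, (0 : Fin m → L) i = 0 := Finset.prod_eq_zero (Finset.mem_univ ⟨0, hm⟩) rfl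
  rcases lt_trichotomy n q with hlt | heq | hlt
  · refine absurd h1 (Finset.sum_lt_sum (fun x _ => ?_) ⟨0, Finset.mem_univ _, ?_⟩).ne
    · split_ifs
      · exact Nat.mul_le_mul_left q hlt.le
      · exact le_rfl
    · rw [if_pos hx0]
      exact Nat.mul_lt_mul_of_pos_left hlt hq
  · exact heq
  · refine absurd h1 (Finset.sum_lt_sum (fun x _ => ?_) ⟨0, Finset.mem_univ _, ?_⟩).ne'
    · split_ifs
      · exact Nat.mul_le_mul_left q hlt.le
      · exact le_rfl
    · rw [if_pos hx0]
      exact Nat.mul_lt_mul_of_pos_left hlt hq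

lemma eval_ne_zero_of_card_zeros {α β : Polynomial L}
    (h : ∑ w : Fin 2 → L, (if eval w (Polynomial.aeval (X 0 : MvPolynomial (Fin 2) L) α * X 1 +
      Polynomial.aeval (X 0) β) = 0 then 1 else 0) = Fintype.card L)
    {z₁ : L} (h1 : α.eval z₁ ≠ 0) (z : L) : α.eval z ≠ 0 := by
  intro hz
  have hev : ∀ (w : Fin 2 → L) (c : Polynomial L),
      eval w (Polynomial.aeval (X 0 : MvPolynomial (Fin 2) L) c) = c.eval (w 0) := fun w c => by
    have := Polynomial.aeval_algHom_apply (aeval w : MvPolynomial (Fin 2) L →ₐ[L] L) (X 0) c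
    rw [aeval_X] at this
    simpa [aeval_eq_eval] using this.symm
  rw [← Equiv.sum_comp (finTwoArrowEquiv L).symm, Fintype.sum_prod_type] at h
  have h2 : ∀ x : L, (∑ y : L, if eval ((finTwoArrowEquiv L).symm (x, y))
      (Polynomial.aeval (X 0 : MvPolynomial (Fin 2) L) α * X 1 + Polynomial.aeval (X 0) β) = 0
      then 1 else 0) = if α.eval x = 0 then (if β.eval x = 0 then Fintype.card L else 0) else 1 := by
    intro x
    simp only [map_add, map_mul, hev, eval_X]
    have : ∀ y : L, (finTwoArrowEquiv L).symm (x, y) 0 = x ∧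
      (finTwoArrowEquiv L).symm (x, y) 1 = y := fun y => ⟨rfl, rfl⟩
    simp only [this]
    split_ifs with ha hb
    · simp [ha, hb]
    · simp [ha, hb]
    · simp only [← eq_neg_iff_add_eq_zero]
      exact sum_ite_mul_eq ha _
  simp only [h2] at h
  by_cases hκ : ∃ x, α.eval x = 0 ∧ β.eval x = 0
  · obtain ⟨x, hx, hx'⟩ := hκ
    have h3 := Finset.single_lt_sum (i := x) (j := z₁) (s := Finset.univ)
      (f := fun x => if α.eval x = 0 then (if β.eval x = 0 then Fintype.card L else 0) else 1)
      (by rintro rfl; exact h1 hx) (Finset.mem_univ _) (Finset.mem_univ _) (by simp [h1])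
      (fun _ _ _ => Nat.zero_le _)
    simp only [hx, hx', if_true] at h3
    exact h3.ne' h
  · push Not at hκ
    have h3 : ∑ x : L, 1 = Fintype.card L := by simp
    rw [← h3] at h
    refine absurd h (Finset.sum_lt_sum (fun x _ => ?_) ⟨z, Finset.mem_univ _, ?_⟩).ne
    · split_ifs with ha hb
      · exact absurd hb (hκ x ha)
      · exact zero_le_one
      · exact le_rfl
    · simp [hz, hκ z hz]

end

instance Int.instIsJacobsonRing : IsJacobsonRing ℤ := by
  refine isJacobsonRing_iff_prime_eq.2 fun P hP => ?_
  rcases eq_or_ne P ⊥ with rfl | hP0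
  · refine le_antisymm (fun x hx => ?_) Ideal.le_jacobson
    have h := Int.isUnit_iff.1 (Ideal.mem_jacobson_bot.1 hx x)
    have hx0 : x = 0 := by
      rcases h with h | h <;> nlinarith
    simp [hx0]
  · have := hP.isMaximal hP0
    exact Ideal.jacobson_eq_self_of_isMaximal

/-- A nonzero finitely generated ring has a finite residue field. -/
theorem exists_ringHom_finite_field (R : Type) [CommRing R] [Nontrivial R]
    [Algebra.FiniteType ℤ R] :
    ∃ (K : Type) (_ : Field K) (_ : Finite K), Nonempty (R →+* K) := by
  obtain ⟨M, hM⟩ := Ideal.exists_maximal R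
  let := Ideal.Quotient.field M
  have : Module.Finite ℤ (R ⧸ M) := finite_of_finite_type_of_isJacobsonRing ℤ (R ⧸ M)
  refine ⟨R ⧸ M, inferInstance, ?_, ⟨Ideal.Quotient.mk M⟩⟩
  obtain ⟨p, hp⟩ := CharP.exists (R ⧸ M)
  have hp0 : p ≠ 0 := by
    rintro rfl
    have := CharP.charP_to_charZero (R ⧸ M)
    exact Int.not_isField (isField_of_isIntegral_of_isField
      (algebraMap ℤ (R ⧸ M)).injective_int (Field.toIsField _))
  refine Module.finite_of_fg_torsion _ fun {x} => ⟨⟨(p : ℤ), ?_⟩, ?_⟩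
  · exact mem_nonZeroDivisors_of_ne_zero (by exact_mod_cast hp0)
  · change (p : ℤ) • x = 0
    simp

lemma MvPolynomial.map_polynomial_aeval {R R' σ : Type} [CommRing R] [CommRing R'] (φ : R →+* R')
    (p : MvPolynomial σ R) (c : Polynomial R) :
    map φ (Polynomial.aeval p c) = Polynomial.aeval (map φ p) (c.map φ) := by
  rw [Polynomial.aeval_def, Polynomial.aeval_def, Polynomial.eval₂_map, Polynomial.hom_eval₂]
  congr 1
  ext x : 1
  simp [algebraMap_eq]

lemma Polynomial.exists_finite_field_eval {K : Type} [Field K] [Finite K] {α : Polynomial K}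
    (hα : 0 < α.natDegree) : ∃ (L : Type) (_ : Field L) (_ : Fintype L) (φ : K →+* L),
      ∃ z z₁ : L, (α.map φ).eval z = 0 ∧ (α.map φ).eval z₁ ≠ 0 := by
  have hα0 : α ≠ 0 := fun h => by simp [h] at hα
  let P := Polynomial.X * α - 1
  have hdeg : (Polynomial.X * α).natDegree = α.natDegree + 1 := Polynomial.natDegree_X_mul hα0
  have hP : P.natDegree = α.natDegree + 1 := by
    rw [← hdeg]
    exact Polynomial.natDegree_sub_eq_left_of_natDegree_lt (by simp [hdeg])
  have hP0 : P ≠ 0 := fun h => by simp [h] at hP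
  let L := (α * P).SplittingField
  let φ := algebraMap K L
  have : Finite L := Module.finite_of_finite K
  have hs : ((α * P).map φ).Splits := Polynomial.SplittingField.splits (α * P)
  have h0 : (α * P).map φ ≠ 0 := (Polynomial.map_ne_zero_iff φ.injective).2 (mul_ne_zero hα0 hP0)
  have hroot : ∀ Q : Polynomial K, 0 < Q.natDegree → Q ∣ α * P → ∃ z, (Q.map φ).eval z = 0 :=
    fun Q hQ hd => (hs.of_dvd h0 (Polynomial.map_dvd φ hd)).exists_eval_eq_zero (by
      rw [Polynomial.degree_map]
      exact (Polynomial.natDegree_pos_iff_degree_pos.1 hQ).ne')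
  obtain ⟨z, hz⟩ := hroot α hα (dvd_mul_right _ _)
  obtain ⟨z₁, hz₁⟩ := hroot P (by omega) (dvd_mul_left _ _)
  refine ⟨L, inferInstance, Fintype.ofFinite L, φ, z, z₁, hz, fun h => ?_⟩
  simp [P, h] at hz₁

section
variable {k : Type} [Field k] {m : ℕ} {r : Fin m → ℕ}

theorem natDegree_eq_zero_of_algEquiv (hm : 1 ≤ m) (hr : ∀ i, 1 < r i)
    {α β : Polynomial k} (hα : α ≠ 0) {g : MvPolynomial (Fin m ⊕ Fin 2) k}
    (Ψ : RingA k m r (rename Sum.inr (Polynomial.aeval (X 0 : MvPolynomial (Fin 2) k) α * X 1 +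
      Polynomial.aeval (X 0) β) + (∏ i, X (Sum.inl i)) * g) ≃ₐ[k]
        MvPolynomial (Fin (m + 2)) k) : α.natDegree = 0 := by
  classical
  by_contra hpos
  obtain ⟨S, hS⟩ := (IsPolyQuotient.of_algEquiv Ψ).exists_descent
  let T : Finset k := S ∪ α.coeffs ∪ β.coeffs ∪ g.coeffs ∪ {α.leadingCoeff⁻¹}
  let R₁ := Algebra.adjoin ℤ (T : Set k)
  let R := R₁.toSubring
  have : Algebra.FiniteType ℤ R₁ := (Subalgebra.fg_iff_finiteType _).1 (Subalgebra.fg_adjoin_finset T)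
  have hT : (T : Set k) ⊆ R := Algebra.subset_adjoin
  have hr' : ∀ {c}, c ∈ T → c ∈ Set.range R.subtype := fun {c} hc => ⟨⟨c, hT hc⟩, rfl⟩
  obtain ⟨α', hα'⟩ : α ∈ Polynomial.lifts R.subtype :=
    (Polynomial.lifts_iff_coeffs_subset_range _).2 fun c hc => hr' (by
      simp only [T, Finset.mem_union]; exact .inl (.inl (.inl (.inr hc))))
  obtain ⟨β', hβ'⟩ : β ∈ Polynomial.lifts R.subtype :=
    (Polynomial.lifts_iff_coeffs_subset_range _).2 fun c hc => hr' (by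
      simp only [T, Finset.mem_union]; exact .inl (.inl (.inr hc)))
  obtain ⟨g', hg'⟩ : g ∈ Set.range (map R.subtype) :=
    mem_range_map_iff_coeffs_subset.2 fun c hc => hr' (by
      simp only [T, Finset.mem_union]; exact .inl (.inr hc))
  obtain ⟨u, hu⟩ : α.leadingCoeff⁻¹ ∈ Set.range R.subtype := hr' (by simp [T])
  have hinj : Function.Injective R.subtype := R.subtype_injective
  change α'.map R.subtype = α at hα'
  change β'.map R.subtype = β at hβ'
  have hunit : IsUnit α'.leadingCoeff := by
    refine IsUnit.of_mul_eq_one u (hinj ?_)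
    rw [map_mul, hu, map_one, ← Polynomial.leadingCoeff_map_of_injective hinj, hα']
    exact mul_inv_cancel₀ (Polynomial.leadingCoeff_ne_zero.2 hα)
  have hnat : α'.natDegree = α.natDegree := by
    rw [← hα', Polynomial.natDegree_map_eq_of_injective hinj]
  let F (R : Type) [CommRing R] (α β : Polynomial R) (g : MvPolynomial (Fin m ⊕ Fin 2) R) :
      MvPolynomial (Fin m ⊕ Fin 2) R :=
    rename Sum.inr (Polynomial.aeval (X 0 : MvPolynomial (Fin 2) R) α * X 1 +
      Polynomial.aeval (X 0) β) + (∏ i, X (Sum.inl i)) * g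
  have hF : ∀ {R R' : Type} [CommRing R] [CommRing R'] (φ : R →+* R') (α β : Polynomial R)
      (g : MvPolynomial (Fin m ⊕ Fin 2) R),
      map φ (F R α β g) = F R' (α.map φ) (β.map φ) (map φ g) := fun φ α β g => by
    simp only [F, map_add, map_rename, map_mul, map_prod, map_X, map_polynomial_aeval]
  have hq : IsPolyQuotient (Fin (m + 2)) (relG R m r (F R α' β' g')) := by
    refine hS R (fun c hc => hT ?_) _ ?_
    · simp only [T, Finset.coe_union]; exact .inl (.inl (.inl (.inl hc)))
    · rw [← relG_map, hF, hα', hβ', hg']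
  obtain ⟨K, _, _, ⟨φ⟩⟩ := exists_ringHom_finite_field R₁
  have hφ : (α'.map φ).natDegree = α.natDegree := by
    rw [Polynomial.natDegree_map_of_leadingCoeff_ne_zero _ (hunit.map φ).ne_zero, hnat]
  obtain ⟨L, _, _, ψ, z, z₁, hz, hz₁⟩ :=
    Polynomial.exists_finite_field_eval (α := α'.map φ) (by rw [hφ]; omega)
  have hq' := hq.map (ψ.comp φ)
  rw [← relG_map, hF] at hq'
  rw [Polynomial.map_map] at hz hz₁
  exact eval_ne_zero_of_card_zeros (card_zeros_of_isPolyQuotient hm hr hq') hz₁ z hz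

end

/-- An automorphism of `R[τ]` extends along an injection of variables `τ → υ`, fixing the new
variables. -/
lemma MvPolynomial.exists_algEquiv_extend {R τ υ : Type} [CommRing R] {j : τ → υ}
    (hj : Function.Injective j) (σ : MvPolynomial τ R ≃ₐ[R] MvPolynomial τ R) :
    ∃ Θ : MvPolynomial υ R ≃ₐ[R] MvPolynomial υ R,
      (∀ p, Θ (rename j p) = rename j (σ p)) ∧ ∀ u ∉ Set.range j, Θ (X u) = X u := by
  classical
  let e (σ : MvPolynomial τ R ≃ₐ[R] MvPolynomial τ R) : MvPolynomial υ R →ₐ[R] MvPolynomial υ R :=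
    aeval fun u => if h : ∃ t, j t = u then rename j (σ (X h.choose)) else X u
  have h1 : ∀ σ p, e σ (rename j p) = rename j (σ p) := fun σ p => by
    have : (e σ).comp (rename j) = (rename j).comp (σ : MvPolynomial τ R →ₐ[R] _) :=
      algHom_ext fun t => by
        have h : ∃ t', j t' = j t := ⟨t, rfl⟩
        have h' : h.choose = t := hj h.choose_spec
        simp [e, h, h']
    exact DFunLike.congr_fun this p
  have h2 : ∀ σ, ∀ u ∉ Set.range j, e σ (X u) = X u := fun σ u hu => by
    have h : ¬ ∃ t, j t = u := hu
    simp only [e, aeval_X, dif_neg h]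
  have h3 : ∀ σ, (e σ).comp (e σ.symm) = AlgHom.id R _ := fun σ => algHom_ext fun u => by
    rw [AlgHom.comp_apply, AlgHom.id_apply]
    by_cases hu : u ∈ Set.range j
    · obtain ⟨t, rfl⟩ := hu
      rw [← rename_X, h1, h1, AlgEquiv.apply_symm_apply]
    · rw [h2 _ u hu, h2 _ u hu]
  exact ⟨AlgEquiv.ofAlgHom (e σ) (e σ.symm) (h3 σ) (h3 σ.symm), h1 σ, h2 σ⟩

section
variable {k : Type} [Field k] {m : ℕ} {r : Fin m → ℕ}

lemma exists_relG_changeCoordinates (r : Fin m → ℕ)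
    (σ : MvPolynomial (Fin 2) k ≃ₐ[k] MvPolynomial (Fin 2) k)
    (f : MvPolynomial (Fin 2) k) (g : MvPolynomial (Fin m ⊕ Fin 2) k) :
    ∃ (g' : MvPolynomial (Fin m ⊕ Fin 2) k) (Θ : BigP k m ≃ₐ[k] BigP k m),
      (∀ i, Θ (X (Sum.inl i)) = X (Sum.inl i)) ∧
      Θ (relG k m r (rename Sum.inr f + (∏ i, X (Sum.inl i)) * g)) =
        relG k m r (rename Sum.inr (σ f) + (∏ i, X (Sum.inl i)) * g') := by
  obtain ⟨σ₁, h1, h1'⟩ := exists_algEquiv_extend (υ := Fin m ⊕ Fin 2) Sum.inr_injective σ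
  obtain ⟨Θ, h2, h2'⟩ := exists_algEquiv_extend (υ := Fin m ⊕ Fin 3)
    (Sum.inr_injective.comp (Fin.succ_injective 2)) σ
  have hx : ∀ i : Fin m, Θ (X (Sum.inl i)) = X (Sum.inl i) := fun i => h2' _ (by simp)
  have hx' : ∀ i : Fin m, σ₁ (X (Sum.inl i)) = X (Sum.inl i) := fun i => h1' _ (by simp)
  have hy : Θ (X (Sum.inr 0)) = X (Sum.inr 0) := h2' _ (by simp)
  have hincl : ∀ p, Θ (incl k m p) = incl k m (σ₁ p) := fun p => by
    have : (Θ : BigP k m →ₐ[k] BigP k m).comp (incl k m) = (incl k m).comp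
        (σ₁ : MvPolynomial (Fin m ⊕ Fin 2) k →ₐ[k] _) := algHom_ext fun s => by
      rcases s with i | t
      · simp [incl, hx, hx']
      · have e1 := h1 (X t)
        have e2 := h2 (X t)
        simp only [rename_X, Function.comp_apply] at e1 e2
        simp [incl, e1, e2, rename_rename, Function.comp_def]
    exact DFunLike.congr_fun this p
  refine ⟨σ₁ g, Θ, hx, ?_⟩
  simp only [relG, map_sub, map_mul, map_prod, map_pow, hx, hy, hincl, map_add, h1, hx']

lemma nonempty_ringA_changeCoordinates (r : Fin m → ℕ)
    (σ : MvPolynomial (Fin 2) k ≃ₐ[k] MvPolynomial (Fin 2) k)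
    (f : MvPolynomial (Fin 2) k) (g : MvPolynomial (Fin m ⊕ Fin 2) k) :
    ∃ g' : MvPolynomial (Fin m ⊕ Fin 2) k,
      Nonempty (RingA k m r (rename Sum.inr f + (∏ i, X (Sum.inl i)) * g) ≃ₐ[k]
        RingA k m r (rename Sum.inr (σ f) + (∏ i, X (Sum.inl i)) * g')) := by
  obtain ⟨g', Θ, -, hΘ⟩ := exists_relG_changeCoordinates r σ f g
  refine ⟨g', ⟨Ideal.quotientEquivAlg _ _ Θ ?_⟩⟩
  rw [Ideal.map_span, Set.image_singleton]
  exact congrArg (fun P => Ideal.span {P}) hΘ.symm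

lemma exists_algEquiv_aeval_mul_X_add {c : k} (hc : c ≠ 0) (β : Polynomial k) :
    ∃ σ : MvPolynomial (Fin 2) k ≃ₐ[k] MvPolynomial (Fin 2) k,
      σ (X 0) = C c * X 1 + Polynomial.aeval (X 0) β := by
  let x : Fin 2 → MvPolynomial (Fin 2) k := ![C c * X 1 + Polynomial.aeval (X 0) β, X 0]
  have h0 : X 0 ∈ Algebra.adjoin k (Set.range x) := Algebra.subset_adjoin ⟨1, rfl⟩
  have hβ : Polynomial.aeval (X 0) β ∈ Algebra.adjoin k (Set.range x) := by
    have := Polynomial.aeval_mem_adjoin_singleton (p := β) k (X 0 : MvPolynomial (Fin 2) k)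
    exact Algebra.adjoin_le (by simpa using h0) this
  have h1 : X 1 ∈ Algebra.adjoin k (Set.range x) := by
    have hx : x 0 ∈ Algebra.adjoin k (Set.range x) := Algebra.subset_adjoin ⟨0, rfl⟩
    have := Subalgebra.smul_mem _ (sub_mem hx hβ) c⁻¹
    rwa [show x 0 - Polynomial.aeval (X 0) β = c • X 1 by simp [x, smul_eq_C_mul], smul_smul,
      inv_mul_cancel₀ hc, one_smul] at this
  obtain ⟨σ, hσ⟩ := exists_algEquiv_of_adjoin_eq_top (x := x) (by
    rw [eq_top_iff, ← adjoin_range_X]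
    refine Algebra.adjoin_le ?_
    rintro _ ⟨i, rfl⟩
    fin_cases i
    exacts [h0, h1])
  exact ⟨σ, hσ 0⟩

lemma exists_algEquiv_aeval_of_natDegree_eq_one {β : Polynomial k} (hβ : β.natDegree = 1) :
    ∃ σ : MvPolynomial (Fin 2) k ≃ₐ[k] MvPolynomial (Fin 2) k,
      σ (X 0) = Polynomial.aeval (X 0) β := by
  obtain ⟨a, ha, b, hab⟩ := Polynomial.natDegree_eq_one.1 hβ
  obtain ⟨σ, hσ⟩ := exists_algEquiv_aeval_mul_X_add ha (Polynomial.C b)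
  refine ⟨σ.trans (renameEquiv k (Equiv.swap 0 1)), ?_⟩
  simp [← hab, hσ, algebraMap_eq]

/-- If the ring `A` is a polynomial ring over `k`, then `f` is a coordinate of `k[Z,T]`. -/
theorem exists_algEquiv_fOf {F g : MvPolynomial (Fin m ⊕ Fin 2) k} (hm : 1 ≤ m)
    (hr : ∀ i, 1 < r i) (hf : fOf k m F ≠ 0)
    (hFg : F = rename Sum.inr (fOf k m F) + (∏ i, X (Sum.inl i)) * g)
    (Ψ : RingA k m r F ≃ₐ[k] MvPolynomial (Fin (m + 2)) k) :
    ∃ τ : MvPolynomial (Fin 2) k ≃ₐ[k] MvPolynomial (Fin 2) k, τ (X 0) = fOf k m F := by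
  obtain ⟨R₀, q, hs, hfq⟩ := exists_sliceData_of_algEquiv hm hr hf hFg Ψ
  obtain ⟨σ, h1, α, β, h2⟩ := hs.exists_coordinates
  obtain ⟨α, β, hσ⟩ : ∃ α β : Polynomial k,
      σ (Polynomial.aeval (X 0) α * X 1 + Polynomial.aeval (X 0) β) = fOf k m F := by
    rcases hfq with h | h
    · obtain ⟨β, hβ⟩ := h1 _ h
      exact ⟨0, β, by simpa using hβ⟩
    · exact ⟨α, β, h2.trans h.symm⟩
  obtain ⟨g', ⟨e⟩⟩ := nonempty_ringA_changeCoordinates r σ.symm (fOf k m F) g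
  rw [← hFg] at e
  have Ψ' := e.symm.trans Ψ
  rw [← hσ, AlgEquiv.symm_apply_apply] at Ψ'
  suffices h : ∃ τ : MvPolynomial (Fin 2) k ≃ₐ[k] MvPolynomial (Fin 2) k,
      τ (X 0) = Polynomial.aeval (X 0) α * X 1 + Polynomial.aeval (X 0) β by
    obtain ⟨τ, hτ⟩ := h
    exact ⟨τ.trans σ, by rw [AlgEquiv.trans_apply, hτ, hσ]⟩
  by_cases hα : α = 0
  · subst hα
    have h0 : Polynomial.aeval (X 0 : MvPolynomial (Fin 2) k) (0 : Polynomial k) * X 1 +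
        Polynomial.aeval (X 0) β = Polynomial.aeval (X 0) β := by simp
    rw [h0] at hσ Ψ' ⊢
    have hβ : β ≠ 0 := by
      rintro rfl
      simp [eq_comm, hf] at hσ
    exact exists_algEquiv_aeval_of_natDegree_eq_one (natDegree_eq_one_of_algEquiv hm hr hβ Ψ')
  · have h0 := natDegree_eq_zero_of_algEquiv (α := α) (β := β) (g := g') hm hr hα Ψ'
    rw [Polynomial.eq_C_of_natDegree_eq_zero h0] at hα ⊢
    obtain ⟨τ, hτ⟩ := exists_algEquiv_aeval_mul_X_add (k := k) (c := α.coeff 0)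
      (fun h => hα (by rw [h, map_zero])) β
    exact ⟨τ, by rw [hτ, Polynomial.aeval_C, algebraMap_eq]⟩

end

section
variable {k D D' : Type} [CommRing k] [CommRing D] [Algebra k D] [CommRing D'] [Algebra k D']
  {m : ℕ}

lemma sub_dvd_aeval_sub (x : Fin m → D) (t a b : D) (g : MvPolynomial (Fin m ⊕ Fin 2) k) :
    a - b ∣ aeval (Sum.elim x ![a, t]) g - aeval (Sum.elim x ![b, t]) g := by
  have h : ∀ c, Ideal.Quotient.mkₐ k (Ideal.span {a - b}) (aeval (Sum.elim x ![c, t]) g) =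
      aeval (fun s => Ideal.Quotient.mkₐ k (Ideal.span {a - b}) (Sum.elim x ![c, t] s)) g :=
    fun c => comp_aeval_apply _ _ _
  have hab : Ideal.Quotient.mkₐ k (Ideal.span {a - b}) a =
      Ideal.Quotient.mkₐ k (Ideal.span {a - b}) b :=
    Ideal.Quotient.eq.2 (Ideal.mem_span_singleton_self _)
  rw [← Ideal.mem_span_singleton, ← Ideal.Quotient.eq]
  refine (h a).trans (Eq.trans ?_ (h b).symm)
  congr 2
  ext s
  rcases s with i | j
  · rfl
  · fin_cases j
    exacts [hab, rfl]

/-- Successive approximations to the solution `z` of `z + x₁⋯xₘ g(x, z, t) = H`. -/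
def approxRoot (x : Fin m → D) (t H : D) (g : MvPolynomial (Fin m ⊕ Fin 2) k) : ℕ → D
  | 0 => H
  | n + 1 => H - (∏ i, x i) * aeval (Sum.elim x ![approxRoot x t H g n, t]) g

lemma map_approxRoot (φ : D →ₐ[k] D') (x : Fin m → D) (t H : D)
    (g : MvPolynomial (Fin m ⊕ Fin 2) k) (n : ℕ) :
    φ (approxRoot x t H g n) = approxRoot (fun i => φ (x i)) (φ t) (φ H) g n := by
  induction n with
  | zero => rfl
  | succ n ih =>
    rw [approxRoot, approxRoot, map_sub, map_mul, map_prod, ← ih]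
    rw [comp_aeval_apply]
    congr 4
    ext s
    rcases s with i | j
    · rfl
    · fin_cases j <;> rfl

lemma pow_dvd_approxRoot_sub (x : Fin m → D) (t H : D) (g : MvPolynomial (Fin m ⊕ Fin 2) k)
    (n : ℕ) : (∏ i, x i) ^ (n + 1) ∣ approxRoot x t H g n - approxRoot x t H g (n + 1) := by
  induction n with
  | zero => simp [approxRoot]
  | succ n ih =>
    have h := mul_dvd_mul_left (∏ i, x i)
      (ih.trans (sub_dvd_aeval_sub x t (approxRoot x t H g n) (approxRoot x t H g (n + 1)) g))
    rw [← pow_succ', ← dvd_neg] at h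
    convert h using 1
    change (H - _ * aeval (Sum.elim x ![approxRoot x t H g n, t]) g) -
      (H - _ * aeval (Sum.elim x ![approxRoot x t H g (n + 1), t]) g) = _
    ring

lemma exists_sub_approxRoot {x : Fin m → D} {t H z p : D} {g : MvPolynomial (Fin m ⊕ Fin 2) k}
    (h : p ∣ z + (∏ i, x i) * aeval (Sum.elim x ![z, t]) g - H) (n : ℕ) :
    ∃ a b, z - approxRoot x t H g n = (∏ i, x i) ^ (n + 1) * a + p * b := by
  obtain ⟨c, hc⟩ := h
  induction n with
  | zero => exact ⟨-aeval (Sum.elim x ![z, t]) g, c, by rw [approxRoot, ← hc]; ring⟩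
  | succ n ih =>
    obtain ⟨a, b, hab⟩ := ih
    obtain ⟨d, hd⟩ := sub_dvd_aeval_sub x t z (approxRoot x t H g n) g
    refine ⟨-a * d, c - (∏ i, x i) * b * d, ?_⟩
    rw [hab] at hd
    rw [approxRoot]
    linear_combination hc - (∏ i, x i) * hd

end

section
variable {k : Type} [Field k] {m : ℕ}

theorem exists_algEquiv_relG_of_X (r : Fin m → ℕ)
    (g : MvPolynomial (Fin m ⊕ Fin 2) k) :
    ∃ Θ : BigP k m ≃ₐ[k] BigP k m, (∀ i, Θ (X (Sum.inl i)) = X (Sum.inl i)) ∧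
      Θ (X (Sum.inr 1)) =
        relG k m r (rename Sum.inr (X 0) + (∏ i, X (Sum.inl i)) * g) := by
  let G := relG k m r (rename Sum.inr (X 0) + (∏ i, X (Sum.inl i)) * g)
  let x : Fin m → BigP k m := fun i => X (Sum.inl i)
  let p := ∏ i, x i ^ r i
  have hG : X (Sum.inr 1) + (∏ i, x i) * aeval (Sum.elim x ![X (Sum.inr 1), X (Sum.inr 2)]) g
      - -G = p * X (Sum.inr 0) := by
    have h1 : aeval (Sum.elim x ![X (Sum.inr 1), X (Sum.inr 2)]) g = incl k m g := by
      refine DFunLike.congr_fun (algHom_ext fun s => ?_) g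
      rcases s with i | j
      · simp [incl, x]
      · fin_cases j <;> simp [incl]
    rw [h1]
    simp only [G, relG, map_add, map_mul, map_prod]
    simp [incl, p, x]
  have hp : ∀ {D : Type} [CommRing D] (x : Fin m → D),
      ∏ i, x i ^ r i ∣ (∏ i, x i) ^ (∑ i, r i + 1) := fun x => by
    rw [← Finset.prod_pow]
    exact Finset.prod_dvd_prod_of_dvd _ _ fun i hi => pow_dvd_pow _
      ((Finset.single_le_sum (fun _ _ => Nat.zero_le _) hi).trans (Nat.le_succ _))
  have hdvd : p ∣ X (Sum.inr 1) - approxRoot x (X (Sum.inr 2)) (-G) g (∑ i, r i) := by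
    obtain ⟨a, b, hab⟩ := exists_sub_approxRoot ⟨_, hG⟩ (∑ i, r i)
    rw [hab]
    exact dvd_add ((hp x).mul_right a) (dvd_mul_right _ _)
  obtain ⟨Y', hY'⟩ := hdvd
  let v : Fin m ⊕ Fin 3 → BigP k m := Sum.elim x ![Y', G, X (Sum.inr 2)]
  let S := Algebra.adjoin k (Set.range v)
  let v' : Fin m ⊕ Fin 3 → S := fun s => ⟨v s, Algebra.subset_adjoin ⟨s, rfl⟩⟩
  let x' : Fin m → S := fun i => v' (Sum.inl i)
  let p' := ∏ i, x' i ^ r i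
  let q := approxRoot x' (v' (Sum.inr 2)) (-v' (Sum.inr 1)) g (∑ i, r i)
  have hq : (q : BigP k m) = approxRoot x (X (Sum.inr 2)) (-G) g (∑ i, r i) :=
    map_approxRoot S.val _ _ _ _ _
  have hp' : (p' : BigP k m) = p := by simp [p', p, x', v', v]
  let z := q + p' * v' (Sum.inr 0)
  have hz : (z : BigP k m) = X (Sum.inr 1) := by
    rw [← hq, ← hp'] at hY'
    simp only [z, v', v, Subalgebra.coe_add, Subalgebra.coe_mul, Sum.elim_inr, Matrix.cons_val_zero]
    linear_combination -hY'
  have hY : p' ∣ z + (∏ i, x' i) * aeval (Sum.elim x' ![z, v' (Sum.inr 2)]) g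
      - -v' (Sum.inr 1) := by
    obtain ⟨a, ha⟩ := (hp x').trans
      (pow_dvd_approxRoot_sub x' (v' (Sum.inr 2)) (-v' (Sum.inr 1)) g (∑ i, r i))
    obtain ⟨b, hb⟩ := sub_dvd_aeval_sub x' (v' (Sum.inr 2)) z q g
    rw [approxRoot] at ha
    refine ⟨a + v' (Sum.inr 0) * (1 + (∏ i, x' i) * b), ?_⟩
    change q - (_ - _ * aeval (Sum.elim x' ![q, _]) g) = p' * a at ha
    linear_combination ha + (∏ i, x' i) * hb
  obtain ⟨w, hw⟩ := hY
  have hw' : p * (w : BigP k m) = p * X (Sum.inr 0) := by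
    have h1 : (aeval (Sum.elim x' ![z, v' (Sum.inr 2)]) g : S) =
        aeval (Sum.elim x ![X (Sum.inr 1), X (Sum.inr 2)]) g := by
      refine (comp_aeval_apply (f := Sum.elim x' ![z, v' (Sum.inr 2)]) S.val g).trans ?_
      congr 2
      ext1 s
      rcases s with i | j
      · rfl
      · fin_cases j
        exacts [hz, rfl]
    rw [← hG, ← h1, ← hp', ← hz]
    refine (congrArg S.val hw).symm.trans ?_
    simp [x', v', v]
  have hp0 : p ≠ 0 := Finset.prod_ne_zero_iff.2 fun i _ => pow_ne_zero _ (X_ne_zero _)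
  have hwY := mul_left_cancel₀ hp0 hw'
  obtain ⟨Θ, hΘ⟩ := exists_algEquiv_of_adjoin_eq_top (x := v) (by
    rw [eq_top_iff, ← adjoin_range_X]
    refine Algebra.adjoin_le ?_
    rintro _ ⟨s, rfl⟩
    rcases s with i | j
    · exact (x' i).2
    · fin_cases j
      · exact hwY ▸ w.2
      · exact hz ▸ z.2
      · exact (v' (Sum.inr 2)).2)
  exact ⟨Θ, fun i => hΘ _, hΘ _⟩

theorem exists_algEquiv_relG (r : Fin m → ℕ)
    {F g : MvPolynomial (Fin m ⊕ Fin 2) k}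
    (hFg : F = rename Sum.inr (fOf k m F) + (∏ i, X (Sum.inl i)) * g)
    {τ : MvPolynomial (Fin 2) k ≃ₐ[k] MvPolynomial (Fin 2) k} (hτ : τ (X 0) = fOf k m F) :
    ∃ Θ : BigP k m ≃ₐ[k] BigP k m, (∀ i, Θ (X (Sum.inl i)) = X (Sum.inl i)) ∧
      Θ (X (Sum.inr 1)) = relG k m r F := by
  obtain ⟨g', Θ₁, h1, h2⟩ := exists_relG_changeCoordinates r τ.symm (fOf k m F) g
  rw [← hFg, ← hτ, AlgEquiv.symm_apply_apply] at h2
  obtain ⟨Θ₂, h3, h4⟩ := exists_algEquiv_relG_of_X r g'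
  refine ⟨Θ₂.trans Θ₁.symm, fun i => ?_, ?_⟩
  · rw [AlgEquiv.trans_apply, h3, AlgEquiv.symm_apply_eq, h1]
  · rw [AlgEquiv.trans_apply, h4, AlgEquiv.symm_apply_eq, h2]

end

section
variable {k B ι κ υ : Type} [Field k] [CommRing B] [Algebra k B]

/-- If `B` is a polynomial ring over `k[v]` with `v` algebraically independent, then `B` is a
polynomial ring over `k` with `v` among the variables. -/
lemma AlgebraicIndependent.nonempty_algEquiv {v : ι → B} (hv : AlgebraicIndependent k v)
    {S : Set B} (hS : Set.range v = S)
    (e : MvPolynomial κ (Algebra.adjoin k S) ≃ₐ[Algebra.adjoin k S] B) :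
    Nonempty (MvPolynomial (κ ⊕ ι) k ≃ₐ[k] B) := by
  subst hS
  exact ⟨((sumAlgEquiv k κ ι).trans (mapAlgEquiv κ hv.aevalEquiv)).trans (e.restrictScalars k)⟩

lemma nonempty_algEquiv_adjoin {v : ι → B} (Φ : MvPolynomial (κ ⊕ ι) k ≃ₐ[k] B)
    (hΦ : ∀ i, Φ (X (Sum.inr i)) = v i) {S : Set B} (hS : Set.range v = S) :
    Nonempty (MvPolynomial κ (Algebra.adjoin k S) ≃ₐ[Algebra.adjoin k S] B) := by
  subst hS
  have h1 : ∀ p, aeval v p = Φ (rename Sum.inr p) := fun p =>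
    DFunLike.congr_fun (algHom_ext (f := aeval v)
      (g := (Φ : MvPolynomial (κ ⊕ ι) k →ₐ[k] B).comp (rename Sum.inr)) fun i => by simp [hΦ]) p
  have hv : AlgebraicIndependent k v := by
    intro p q hpq
    change aeval v p = aeval v q at hpq
    rw [h1, h1] at hpq
    exact rename_injective _ Sum.inr_injective (Φ.injective hpq)
  let e := ((sumAlgEquiv k κ ι).trans (mapAlgEquiv κ hv.aevalEquiv)).symm.trans Φ
  refine ⟨AlgEquiv.ofRingEquiv (f := (e : _ ≃+* B)) fun c => ?_⟩
  obtain ⟨p, rfl⟩ := hv.aevalEquiv.surjective c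
  have h2 : (sumAlgEquiv k κ ι).trans (mapAlgEquiv κ hv.aevalEquiv) (rename Sum.inr p) =
      C (hv.aevalEquiv p) := by
    have : (sumAlgEquiv k κ ι) (rename Sum.inr p) = C p := by
      refine DFunLike.congr_fun (algHom_ext (f := (sumAlgEquiv k κ ι :
        MvPolynomial (κ ⊕ ι) k →ₐ[k] MvPolynomial κ (MvPolynomial ι k)).comp (rename Sum.inr))
        (g := IsScalarTower.toAlgHom k (MvPolynomial ι k) _) fun i => ?_) p
      exact (congrArg _ (rename_X _ _)).trans ((sumRingEquiv_X_inr k κ ι i).trans rfl)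
    rw [AlgEquiv.trans_apply, this]
    simp
  change e (C (hv.aevalEquiv p)) = _
  rw [← h2, AlgEquiv.trans_apply, AlgEquiv.symm_apply_apply, ← h1]
  exact (hv.algebraMap_aevalEquiv p).symm

/-- If `k[υ]` is a polynomial ring over `k[v]` in the right number of variables, then `v` is part
of a system of coordinates. -/
lemma exists_algEquiv_of_adjoin [Finite υ] (ε : κ ⊕ ι ≃ υ) (v : ι → MvPolynomial υ k)
    {S : Set (MvPolynomial υ k)} (hS : Set.range v = S)
    (e : MvPolynomial κ (Algebra.adjoin k S) ≃ₐ[Algebra.adjoin k S] MvPolynomial υ k) :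
    ∃ Φ : MvPolynomial υ k ≃ₐ[k] MvPolynomial υ k, ∀ i, Φ (X (ε (Sum.inr i))) = v i := by
  subst hS
  let x : υ → MvPolynomial υ k := fun u => Sum.elim (fun j => e (X j)) v (ε.symm u)
  obtain ⟨Φ, hΦ⟩ := exists_algEquiv_of_adjoin_eq_top (x := x) (by
    rw [eq_top_iff]
    rintro b -
    obtain ⟨p, rfl⟩ := e.surjective b
    induction p using MvPolynomial.induction_on with
    | C c =>
      have hle : Algebra.adjoin k (Set.range v) ≤ Algebra.adjoin k (Set.range x) := by
        refine Algebra.adjoin_mono ?_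
        rintro _ ⟨i, rfl⟩
        exact ⟨ε (Sum.inr i), by simp [x]⟩
      rw [← algebraMap_eq, e.commutes]
      exact hle c.2
    | add p q hp hq => rw [map_add]; exact add_mem hp hq
    | mul_X p j hp =>
      rw [map_mul]
      exact mul_mem hp (Algebra.subset_adjoin ⟨ε (Sum.inl j), by simp [x]⟩))
  exact ⟨Φ, fun i => by simp [hΦ, x]⟩

/-- The quotient of a polynomial ring by a coordinate. -/
lemma exists_quotient_algEquiv (ε : κ ⊕ Unit ≃ υ) {G : MvPolynomial υ k}
    (Φ : MvPolynomial υ k ≃ₐ[k] MvPolynomial υ k) (hΦ : Φ (X (ε (Sum.inr ()))) = G) :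
    ∃ e : MvPolynomial κ k ≃ₐ[k] (MvPolynomial υ k ⧸ Ideal.span {G}),
      ∀ j, e (X j) = Ideal.Quotient.mk _ (Φ (X (ε (Sum.inl j)))) := by
  let π := Ideal.Quotient.mkₐ k (Ideal.span {G})
  let a : MvPolynomial υ k →ₐ[k] MvPolynomial κ k :=
    aeval fun u => Sum.elim X (fun _ => 0) (ε.symm u)
  let f : MvPolynomial κ k →ₐ[k] MvPolynomial υ k ⧸ Ideal.span {G} :=
    aeval fun j => π (Φ (X (ε (Sum.inl j))))
  have h0 : ∀ P ∈ Ideal.span {G}, (a.comp (Φ.symm : MvPolynomial υ k →ₐ[k] _)) P = 0 :=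
    fun P hP => by
      obtain ⟨c, rfl⟩ := Ideal.mem_span_singleton.1 hP
      simp [← hΦ, a]
  let f' := Ideal.Quotient.liftₐ _ _ h0
  have hf' : ∀ P, f' (π P) = a (Φ.symm P) := fun P => Ideal.Quotient.liftₐ_apply _ _ _ _
  have hπG : π G = 0 := Ideal.Quotient.eq_zero_iff_mem.2 (Ideal.mem_span_singleton_self _)
  have hfa : f.comp a = π.comp (Φ : MvPolynomial υ k →ₐ[k] _) := algHom_ext fun u => by
    obtain ⟨s, rfl⟩ := ε.surjective u
    rcases s with j | ⟨⟩
    · simp [a, f]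
    · simp [a, hΦ, hπG]
  refine ⟨AlgEquiv.ofAlgHom f f' ?_ ?_, fun j => ?_⟩
  · refine AlgHom.cancel_right (Ideal.Quotient.mkₐ_surjective k (Ideal.span {G})) |>.1 ?_
    refine AlgHom.ext fun P => ?_
    change f (f' (π P)) = π P
    rw [hf']
    exact (DFunLike.congr_fun hfa _).trans (congrArg π (Φ.apply_symm_apply P))
  · refine algHom_ext fun j => ?_
    simp only [AlgHom.comp_apply, f, aeval_X, hf', AlgEquiv.symm_apply_apply, AlgHom.id_apply]
    simp [a]
  · simp [f]
    rfl

end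

/-- The variables of `k[X₁,…,Xₘ,Y,Z,T]`, with `Z` singled out. -/
def bigPEquiv (m : ℕ) : (Fin m ⊕ Fin 2) ⊕ Unit ≃ Fin m ⊕ Fin 3 :=
  (Equiv.sumAssoc _ _ _).trans ((Equiv.refl _).sumCongr
    ((Equiv.optionEquivSumPUnit (Fin 2)).symm.trans (finSuccEquiv' 1).symm))

/-- The two-element type as a sum, with `Sum.inr ()` corresponding to `0`. -/
def unitSumUnitEquiv : Unit ⊕ Unit ≃ Fin 2 where
  toFun := Sum.elim (fun _ => 1) fun _ => 0
  invFun := ![Sum.inr (), Sum.inl ()]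
  left_inv := by rintro (⟨⟩ | ⟨⟩) <;> rfl
  right_inv i := by fin_cases i <;> rfl

section
variable {k : Type} [Field k] {m : ℕ} {r : Fin m → ℕ} {F : MvPolynomial (Fin m ⊕ Fin 2) k}

lemma nonempty_ringA_algEquiv (Φ : BigP k m ≃ₐ[k] BigP k m)
    (hΦ : Φ (X (Sum.inr 1)) = relG k m r F) :
    Nonempty (RingA k m r F ≃ₐ[k] MvPolynomial (Fin (m + 2)) k) := by
  obtain ⟨e, -⟩ := exists_quotient_algEquiv (bigPEquiv m) Φ hΦ
  exact ⟨e.symm.trans (renameEquiv k finSumFinEquiv)⟩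

lemma algebraicIndependent_xA : AlgebraicIndependent k (xA k m r F) := by
  have h : ∀ p, aeval (xA k m r F) p = inclA k m r F (rename Sum.inl p) := fun p =>
    DFunLike.congr_fun (algHom_ext (f := aeval (xA k m r F))
      (g := (inclA k m r F).comp (rename Sum.inl)) fun i => by
        rw [AlgHom.comp_apply, rename_X, inclA_X_inl, aeval_X]) p
  intro p q hpq
  change aeval (xA k m r F) p = aeval (xA k m r F) q at hpq
  rw [h, h] at hpq
  exact rename_injective _ Sum.inl_injective (inclA_injective hpq)

lemma nonempty_algEquiv_adjoin_iff {f : MvPolynomial (Fin 2) k} :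
    Nonempty (Polynomial (Algebra.adjoin k {f}) ≃ₐ[Algebra.adjoin k {f}] MvPolynomial (Fin 2) k) ↔
      ∃ τ : MvPolynomial (Fin 2) k ≃ₐ[k] MvPolynomial (Fin 2) k, τ (X 0) = f := by
  have hS : Set.range (fun _ : Unit => f) = {f} := Set.range_const
  constructor
  · rintro ⟨e⟩
    obtain ⟨τ, hτ⟩ := exists_algEquiv_of_adjoin unitSumUnitEquiv _ hS
      ((uniqueAlgEquiv (Algebra.adjoin k {f}) Unit).trans e)
    exact ⟨τ, hτ ()⟩
  · rintro ⟨τ, hτ⟩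
    obtain ⟨e⟩ := nonempty_algEquiv_adjoin (κ := Unit) (v := fun _ : Unit => f)
      ((renameEquiv k unitSumUnitEquiv).trans τ)
      (fun _ => by simpa [unitSumUnitEquiv] using hτ) hS
    exact ⟨(uniqueAlgEquiv _ Unit).symm.trans e⟩

end

/-!
STATEMENT 7 (Theorem B).  Suppose `F = f(Z,T) + X_1⋯X_m·g(X_1,…,X_m,Z,T)` and
`G = X_1^{r_1}⋯X_m^{r_m}Y − F`.  Then the following are equivalent:
(i) `k[X_1,…,X_m,Y,Z,T] = k[X_1,…,X_m,G]^{[2]}`;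
(ii) `k[X_1,…,X_m,Y,Z,T] = k[G]^{[m+2]}`;
(iii) `A = k[x_1,…,x_m]^{[2]}`;
(iv) `A ≅ k^{[m+2]}`;
(v) `k[Z,T] = k[f(Z,T)]^{[1]}`.
-/

theorem statement7 (k : Type) [Field k] (m : ℕ) (hm : 1 ≤ m)
    (r : Fin m → ℕ) (hr : ∀ i, 1 < r i)
    (F : MvPolynomial (Fin m ⊕ Fin 2) k) (hf : fOf k m F ≠ 0)
    [IsDomain (RingA k m r F)]
    (g : MvPolynomial (Fin m ⊕ Fin 2) k)
    (hFg : F = rename Sum.inr (fOf k m F) + (∏ i, X (Sum.inl i)) * g) :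
    List.TFAE
      [ Nonempty (MvPolynomial (Fin 2)
            ↥(Algebra.adjoin k
              (Set.range (fun i : Fin m => (X (Sum.inl i) : BigP k m)) ∪ {relG k m r F}))
          ≃ₐ[↥(Algebra.adjoin k
              (Set.range (fun i : Fin m => (X (Sum.inl i) : BigP k m)) ∪ {relG k m r F}))]
          BigP k m),
        Nonempty (MvPolynomial (Fin (m + 2)) ↥(Algebra.adjoin k {relG k m r F})
          ≃ₐ[↥(Algebra.adjoin k {relG k m r F})] BigP k m),
        Nonempty (MvPolynomial (Fin 2) ↥(EA k m r F) ≃ₐ[↥(EA k m r F)] RingA k m r F),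
        Nonempty (RingA k m r F ≃ₐ[k] MvPolynomial (Fin (m + 2)) k),
        Nonempty (Polynomial ↥(Algebra.adjoin k {fOf k m F})
          ≃ₐ[↥(Algebra.adjoin k {fOf k m F})] MvPolynomial (Fin 2) k) ] := by
  have hS₁ : Set.range (Sum.elim (fun i : Fin m => (X (Sum.inl i) : BigP k m))
      fun _ : Unit => relG k m r F) =
      Set.range (fun i : Fin m => (X (Sum.inl i) : BigP k m)) ∪ {relG k m r F} := by
    rw [Set.Sum.elim_range, Set.range_const]
  have hS₂ : Set.range (fun _ : Unit => relG k m r F) = {relG k m r F} := Set.range_const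
  let ε₁ : Fin 2 ⊕ (Fin m ⊕ Unit) ≃ Fin m ⊕ Fin 3 := (Equiv.sumAssoc _ _ _).symm.trans
    (((Equiv.sumComm _ _).sumCongr (Equiv.refl _)).trans (bigPEquiv m))
  let ε₂ : Fin (m + 2) ⊕ Unit ≃ Fin m ⊕ Fin 3 :=
    (finSumFinEquiv.symm.sumCongr (Equiv.refl _)).trans (bigPEquiv m)
  tfae_have 1 → 4 := fun ⟨e⟩ => by
    obtain ⟨Φ, hΦ⟩ := exists_algEquiv_of_adjoin ε₁ _ hS₁ e
    exact nonempty_ringA_algEquiv Φ (hΦ (Sum.inr ()))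
  tfae_have 2 → 4 := fun ⟨e⟩ => by
    obtain ⟨Φ, hΦ⟩ := exists_algEquiv_of_adjoin ε₂ _ hS₂ e
    exact nonempty_ringA_algEquiv Φ (hΦ ())
  tfae_have 3 → 4 := fun ⟨e⟩ => by
    obtain ⟨Ψ⟩ := algebraicIndependent_xA.nonempty_algEquiv rfl e
    exact ⟨Ψ.symm.trans (renameEquiv k ((Equiv.sumComm _ _).trans finSumFinEquiv))⟩
  tfae_have 4 → 5 := fun ⟨Ψ⟩ =>
    nonempty_algEquiv_adjoin_iff.2 (exists_algEquiv_fOf hm hr hf hFg Ψ)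
  tfae_have 5 → 1 := fun h => by
    obtain ⟨τ, hτ⟩ := nonempty_algEquiv_adjoin_iff.1 h
    obtain ⟨Θ, hx, hz⟩ := exists_algEquiv_relG r hFg hτ
    refine nonempty_algEquiv_adjoin ((renameEquiv k ε₁).trans Θ) (fun s => ?_) hS₁
    rw [AlgEquiv.trans_apply, renameEquiv_apply, rename_X]
    rcases s with i | ⟨⟩
    exacts [hx i, hz]
  tfae_have 5 → 2 := fun h => by
    obtain ⟨τ, hτ⟩ := nonempty_algEquiv_adjoin_iff.1 h
    obtain ⟨Θ, hx, hz⟩ := exists_algEquiv_relG r hFg hτ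
    refine nonempty_algEquiv_adjoin ((renameEquiv k ε₂).trans Θ) (fun s => ?_) hS₂
    rw [AlgEquiv.trans_apply, renameEquiv_apply, rename_X]
    exact hz
  tfae_have 5 → 3 := fun h => by
    obtain ⟨τ, hτ⟩ := nonempty_algEquiv_adjoin_iff.1 h
    obtain ⟨Θ, hx, hz⟩ := exists_algEquiv_relG r hFg hτ
    obtain ⟨e, he⟩ := exists_quotient_algEquiv (bigPEquiv m) Θ hz
    refine nonempty_algEquiv_adjoin (v := xA k m r F)
      ((renameEquiv k (Equiv.sumComm (Fin 2) (Fin m))).trans e) (fun i => ?_) rfl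
    rw [AlgEquiv.trans_apply, renameEquiv_apply, rename_X]
    exact (he _).trans (congrArg _ (hx i))
  tfae_finish
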